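/- Let a ∈ [1,3], and let E ⊆ [-1,1]² be a set of finite perimeter such that either Leb(E) < a, or Leb(E) ≤ a and E is decomposable. Then there exists a set of finite perimeter E' ⊆ [-1,1]² with Leb(E') = a and I_τ(∂E)/Leb(E) > I_τ(∂E')/Leb(E'). -/

import Mathlib

open MeasureTheory Set Filter ENNReal

noncomputable section

/-- The closed square `[-1,1]²` in `ℝ × ℝ`. -/
def Isq : Set (ℝ × ℝ) := Set.Icc (-1, -1) (1, 1)

/-- The open square `(-1,1)²` in `ℝ × ℝ`. -/
def Osq : Set (ℝ × ℝ) := Set.Ioo (-1, -1) (1, 1)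

/-- `τ` is a norm on `ℝ²`. -/
def IsNorm2 (τ : ℝ × ℝ → ℝ) : Prop :=
  (∀ x, τ x = 0 ↔ x = 0) ∧ (∀ (c : ℝ) (x), τ (c • x) = |c| * τ x) ∧
    ∀ x y, τ (x + y) ≤ τ x + τ y

/-- The Euclidean norm on `ℝ × ℝ`. -/
def eNorm2 (v : ℝ × ℝ) : ℝ := Real.sqrt (v.1 ^ 2 + v.2 ^ 2)

/-- The dual norm `τ*` of a norm `τ` on `ℝ²`. -/
def dualNorm (τ : ℝ × ℝ → ℝ) (w : ℝ × ℝ) : ℝ :=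
  sSup {x | ∃ v : ℝ × ℝ, τ v ≤ 1 ∧ x = v.1 * w.1 + v.2 * w.2}

/-- The divergence of a vector field on `ℝ²`. -/
def div2 (f : ℝ × ℝ → ℝ × ℝ) (x : ℝ × ℝ) : ℝ :=
  (fderiv ℝ f x (1, 0)).1 + (fderiv ℝ f x (0, 1)).2

/-- The perimeter `per(∂E)` of a set `E ⊆ ℝ²`, as the supremum of `∫_E div f`
over smooth compactly supported vector fields with `|f|₂ ≤ 1`. -/
def per (E : Set (ℝ × ℝ)) : ℝ≥0∞ :=
  ⨆ f ∈ {f : ℝ × ℝ → ℝ × ℝ |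
      ContDiff ℝ (⊤ : ℕ∞) f ∧ HasCompactSupport f ∧ ∀ x, eNorm2 (f x) ≤ 1},
    ENNReal.ofReal (∫ x in E, div2 f x)

/-- The restricted surface energy `I_τ(∂E)`: the supremum of `∫_E div f` over smooth
vector fields compactly supported in the open square with `τ*(f) ≤ 1`. -/
def surfE (τ : ℝ × ℝ → ℝ) (E : Set (ℝ × ℝ)) : ℝ≥0∞ :=
  ⨆ f ∈ {f : ℝ × ℝ → ℝ × ℝ |
      ContDiff ℝ (⊤ : ℕ∞) f ∧ HasCompactSupport f ∧ tsupport f ⊆ Osq ∧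
        ∀ x, dualNorm τ (f x) ≤ 1},
    ENNReal.ofReal (∫ x in E, div2 f x)

/-- `E ∈ 𝒞`: `E` is a subset of `[-1,1]²` of finite perimeter. -/
def MemC (E : Set (ℝ × ℝ)) : Prop := E ⊆ Isq ∧ per E ≠ ⊤

open Classical in
/-- The conductance `I_τ(∂E)/Leb(E)` of `E`, with the convention `0/0 = ∞`. -/
def conduct (τ : ℝ × ℝ → ℝ) (E : Set (ℝ × ℝ)) : ℝ≥0∞ :=
  if volume E = 0 then ⊤ else surfE τ E / volume E

/-- The optimal conductance `ψ_τ^(a)` over sets of finite perimeter in the square. -/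
def psi (τ : ℝ × ℝ → ℝ) (a : ℝ) : ℝ≥0∞ :=
  ⨅ E ∈ {E : Set (ℝ × ℝ) | MemC E ∧ volume E ≤ ENNReal.ofReal a}, conduct τ E

/-- The set of optimizers `𝒞_τ^(a)`. -/
def Copt (τ : ℝ × ℝ → ℝ) (a : ℝ) : Set (Set (ℝ × ℝ)) :=
  {E | MemC E ∧ volume E ≤ ENNReal.ofReal a ∧ conduct τ E = psi τ a}

/-- A set of finite perimeter is decomposable if it can be split into two parts of positive
measure whose perimeters add up to the perimeter of the whole. -/
def Decomposable (E : Set (ℝ × ℝ)) : Prop :=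
  ∃ A B : Set (ℝ × ℝ), E = A ∪ B ∧ Disjoint A B ∧ 0 < volume A ∧ 0 < volume B ∧
    per E = per A + per B

/-- The length of the curve `γ` measured with the gauge `β`: the supremum, over partitions
`0 = t₀ ≤ t₁ ≤ ⋯ ≤ t_n = 1`, of `∑ β(γ(t_j) - γ(t_{j-1}))`. -/
def varLength (β : ℝ × ℝ → ℝ) (γ : ℝ → ℝ × ℝ) : ℝ≥0∞ :=
  ⨆ (n : ℕ) (t : Fin (n + 1) → ℝ)
    (_ : Monotone t ∧ t 0 = 0 ∧ t (Fin.last n) = 1),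
    ENNReal.ofReal (∑ i : Fin n, β (γ (t i.succ) - γ (t i.castSucc)))

/-- `C` is a rectifiable Jordan curve: the image of a continuous injective map of the unit
circle (equivalently, a continuous `1`-periodic map injective on `[0,1)`) of finite length. -/
def IsRectJordanCurve (C : Set (ℝ × ℝ)) : Prop :=
  ∃ γ : ℝ → ℝ × ℝ, Continuous γ ∧ (∀ t, γ (t + 1) = γ t) ∧
    Set.InjOn γ (Set.Ico 0 1) ∧ C = γ '' Set.Icc 0 1 ∧ varLength eNorm2 γ ≠ ⊤

/-- The hull of a curve `C`: the union of `C` with all bounded connected components of its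
complement. -/
def hullSet (C : Set (ℝ × ℝ)) : Set (ℝ × ℝ) :=
  C ∪ {x | x ∉ C ∧ Bornology.IsBounded (connectedComponentIn Cᶜ x)}

/-- `R ∈ ℛ`: `R` is a compact subset of the square with nonempty interior whose boundary is
a finite union of rectifiable Jordan curves, any two of which have `ℋ¹`-null intersection. -/
def MemR (R : Set (ℝ × ℝ)) : Prop :=
  IsCompact R ∧ R ⊆ Isq ∧ (interior R).Nonempty ∧
    ∃ F : Finset (Set (ℝ × ℝ)),
      (∀ C ∈ F, IsRectJordanCurve C) ∧ frontier R = ⋃ C ∈ F, C ∧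
        ∀ C ∈ F, ∀ C' ∈ F, C ≠ C' →
          (MeasureTheory.Measure.hausdorffMeasure 1 : Measure (ℝ × ℝ)) (C ∩ C') = 0

/-- The optimal conductance `φ_τ^(a)` over the class `ℛ`. -/
def phiR (τ : ℝ × ℝ → ℝ) (a : ℝ) : ℝ≥0∞ :=
  ⨅ R ∈ {R : Set (ℝ × ℝ) | MemR R ∧ volume R ≤ ENNReal.ofReal a}, conduct τ R

/-- The set of optimizers `ℛ_τ^(a)`. -/
def Ropt (τ : ℝ × ℝ → ℝ) (a : ℝ) : Set (Set (ℝ × ℝ)) :=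
  {R | MemR R ∧ volume R ≤ ENNReal.ofReal a ∧ conduct τ R = phiR τ a}

/-- `L¹` convergence of sets: `Leb(E_k Δ E₀) → 0`. -/
def TendstoL1 (E : ℕ → Set (ℝ × ℝ)) (E₀ : Set (ℝ × ℝ)) : Prop :=
  Tendsto (fun k => volume (symmDiff (E k) E₀)) atTop (nhds 0)

/-- `ρ` is a (piecewise-linear) polygonal curve on `[0,1]`. -/
def IsPolygonal (ρ : ℝ → ℝ × ℝ) : Prop :=
  ∃ (n : ℕ) (s : Fin (n + 1) → ℝ), Monotone s ∧ s 0 = 0 ∧ s (Fin.last n) = 1 ∧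
    ∀ i : Fin n, ∀ t ∈ Set.Icc (s i.castSucc) (s i.succ),
      ρ t = ρ (s i.castSucc) +
        ((t - s i.castSucc) / (s i.succ - s i.castSucc)) • (ρ (s i.succ) - ρ (s i.castSucc))

end

/-! ### Basic notions -/

/-- the genuinely open square -/
def Sq : Set (ℝ × ℝ) := Ioo (-1 : ℝ) 1 ×ˢ Ioo (-1 : ℝ) 1

/-- admissible test fields, with the dual-norm constraint spelled out -/
def Adm (τ : ℝ × ℝ → ℝ) (f : ℝ × ℝ → ℝ × ℝ) : Prop :=
  ContDiff ℝ (⊤ : ℕ∞) f ∧ HasCompactSupport f ∧ tsupport f ⊆ Sq ∧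
    ∀ x v, v.1 * (f x).1 + v.2 * (f x).2 ≤ τ v

/-- energy bound -/
def EB (τ : ℝ × ℝ → ℝ) (E : Set (ℝ × ℝ)) (c : ℝ) : Prop :=
  ∀ f, Adm τ f → ∫ x in E, div2 f x ≤ c

lemma div2_continuous {f : ℝ × ℝ → ℝ × ℝ} (hf : ContDiff ℝ (⊤ : ℕ∞) f) :
    Continuous (div2 f) := by
  have h1 : Continuous (fderiv ℝ f) := hf.continuous_fderiv (by simp)
  unfold div2
  exact ((h1.clm_apply continuous_const).fst).add ((h1.clm_apply continuous_const).snd)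

lemma div2_zero_of_notMem {f : ℝ × ℝ → ℝ × ℝ} {x : ℝ × ℝ} (hx : x ∉ tsupport f) :
    div2 f x = 0 := by
  have : fderiv ℝ f x = 0 := by
    by_contra h
    exact hx (support_fderiv_subset ℝ h)
  simp [div2, this]

lemma div2_hasCompactSupport {f : ℝ × ℝ → ℝ × ℝ} (hf : HasCompactSupport f) :
    HasCompactSupport (div2 f) :=
  HasCompactSupport.intro hf (fun _ hx => div2_zero_of_notMem hx)

lemma div2_integrable {f : ℝ × ℝ → ℝ × ℝ} (hf : ContDiff ℝ (⊤ : ℕ∞) f)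
    (hc : HasCompactSupport f) : Integrable (div2 f) :=
  (div2_continuous hf).integrable_of_hasCompactSupport (div2_hasCompactSupport hc)

lemma fderiv_fst_apply {f : ℝ × ℝ → ℝ × ℝ} (hf : Differentiable ℝ f) (x v : ℝ × ℝ) :
    fderiv ℝ (fun x => (f x).1) x v = (fderiv ℝ f x v).1 := by
  have := (hf x).hasFDerivAt.fst.fderiv
  rw [this]; rfl

lemma fderiv_snd_apply {f : ℝ × ℝ → ℝ × ℝ} (hf : Differentiable ℝ f) (x v : ℝ × ℝ) :
    fderiv ℝ (fun x => (f x).2) x v = (fderiv ℝ f x v).2 := by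
  have := (hf x).hasFDerivAt.snd.fderiv
  rw [this]; rfl

lemma div2_add {f g : ℝ × ℝ → ℝ × ℝ} (hf : Differentiable ℝ f) (hg : Differentiable ℝ g)
    (x : ℝ × ℝ) : div2 (fun x => f x + g x) x = div2 f x + div2 g x := by
  unfold div2
  rw [fderiv_fun_add (hf x) (hg x)]
  simp; ring

lemma div2_neg {f : ℝ × ℝ → ℝ × ℝ} 
    (x : ℝ × ℝ) : div2 (fun x => - f x) x = - div2 f x := by
  unfold div2
  rw [fderiv_fun_neg]
  simp; ring

lemma div2_const_smul {f : ℝ × ℝ → ℝ × ℝ} (hf : Differentiable ℝ f) (k : ℝ)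
    (x : ℝ × ℝ) : div2 (fun x => k • f x) x = k * div2 f x := by
  unfold div2
  rw [fderiv_fun_const_smul (hf x)]
  simp; ring

lemma div2_smul {φ : ℝ × ℝ → ℝ} {f : ℝ × ℝ → ℝ × ℝ} (hφ : Differentiable ℝ φ)
    (hf : Differentiable ℝ f) (x : ℝ × ℝ) :
    div2 (fun x => φ x • f x) x = φ x * div2 f x +
      (fderiv ℝ φ x (1, 0) * (f x).1 + fderiv ℝ φ x (0, 1) * (f x).2) := by
  unfold div2
  rw [fderiv_fun_smul (hφ x) (hf x)]
  simp; ring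

lemma div2_comp_affine {f : ℝ × ℝ → ℝ × ℝ} (hf : Differentiable ℝ f) (b : ℝ × ℝ) (k : ℝ)
    (x : ℝ × ℝ) : div2 (fun x => f (b + k • x)) x = k * div2 f (b + k • x) := by
  have h : HasFDerivAt (fun x : ℝ × ℝ => b + k • x) (k • ContinuousLinearMap.id ℝ (ℝ × ℝ)) x :=
    ((hasFDerivAt_id x).const_smul k).const_add b
  have h2 := ((hf (b + k • x)).hasFDerivAt.comp x h).fderiv
  unfold div2
  rw [show (fun x => f (b + k • x)) = f ∘ (fun x => b + k • x) from rfl, h2]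
  simp; ring

lemma integral_fderiv_zero {u : ℝ × ℝ → ℝ} (hu : ContDiff ℝ 1 u) (hc : HasCompactSupport u)
    (v : ℝ × ℝ) : ∫ x, fderiv ℝ u x v = 0 := by
  have h := integral_mul_fderiv_eq_neg_fderiv_mul_of_integrable (𝕜 := ℝ) (μ := (volume : Measure (ℝ × ℝ)))
    (f := fun _ => (1:ℝ)) (g := u) (v := v) (by simp)
    (by
      simp only [one_mul]
      exact ((hu.continuous_fderiv (by simp)).clm_apply continuous_const).integrable_of_hasCompactSupport
        (hc.fderiv_apply ℝ v))
    (by simpa using hu.continuous.integrable_of_hasCompactSupport hc)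
    (fun x _ => differentiableAt_const _) (fun x _ => hu.differentiable (by simp) x)
  simpa using h

lemma integral_div2_zero {f : ℝ × ℝ → ℝ × ℝ} (hf : ContDiff ℝ (⊤ : ℕ∞) f)
    (hc : HasCompactSupport f) : ∫ x, div2 f x = 0 := by
  have hd : Differentiable ℝ f := hf.differentiable (by simp)
  have h1 : ContDiff ℝ 1 (fun x => (f x).1) := (hf.of_le (by exact_mod_cast le_top)).fst
  have h2 : ContDiff ℝ 1 (fun x => (f x).2) := (hf.of_le (by exact_mod_cast le_top)).snd
  have c1 : HasCompactSupport (fun x => (f x).1) := hc.comp_left (g := Prod.fst) rfl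
  have c2 : HasCompactSupport (fun x => (f x).2) := hc.comp_left (g := Prod.snd) rfl
  have e1 := integral_fderiv_zero h1 c1 (1, 0)
  have e2 := integral_fderiv_zero h2 c2 (0, 1)
  have i1 : Integrable (fun x => fderiv ℝ (fun x => (f x).1) x (1, 0)) :=
    ((h1.continuous_fderiv (by simp)).clm_apply continuous_const).integrable_of_hasCompactSupport
        (c1.fderiv_apply ℝ _)
  have i2 : Integrable (fun x => fderiv ℝ (fun x => (f x).2) x (0, 1)) :=
    ((h2.continuous_fderiv (by simp)).clm_apply continuous_const).integrable_of_hasCompactSupport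
        (c2.fderiv_apply ℝ _)
  have : ∀ x, div2 f x = fderiv ℝ (fun x => (f x).1) x (1, 0) + fderiv ℝ (fun x => (f x).2) x (0, 1) := by
    intro x
    rw [fderiv_fst_apply hd, fderiv_snd_apply hd]; rfl
  simp_rw [this]
  rw [integral_add i1 i2, e1, e2, add_zero]

lemma isq_measurable : MeasurableSet Isq := measurableSet_Icc

lemma isOpen_sq : IsOpen Sq := isOpen_Ioo.prod isOpen_Ioo

lemma mem_sq {x : ℝ × ℝ} : x ∈ Sq ↔ (-1 < x.1 ∧ x.1 < 1) ∧ (-1 < x.2 ∧ x.2 < 1) := by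
  simp [Sq, mem_prod]

lemma mem_isq {x : ℝ × ℝ} : x ∈ Isq ↔ (-1 ≤ x.1 ∧ x.1 ≤ 1) ∧ (-1 ≤ x.2 ∧ x.2 ≤ 1) := by
  unfold Isq
  simp only [mem_Icc, Prod.le_def]
  tauto

lemma sq_subset_osq : Sq ⊆ Osq := by
  intro x hx
  rw [mem_sq] at hx
  refine ⟨Prod.lt_iff.2 (Or.inl ⟨hx.1.1, hx.2.1.le⟩), Prod.lt_iff.2 (Or.inl ⟨hx.1.2, hx.2.2.le⟩)⟩

lemma osq_subset_isq : Osq ⊆ Isq := fun _ hx => ⟨hx.1.le, hx.2.le⟩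

lemma sq_subset_isq : Sq ⊆ Isq := sq_subset_osq.trans osq_subset_isq

lemma isq_eq : Isq = Icc (-1:ℝ) 1 ×ˢ Icc (-1:ℝ) 1 := by
  ext x; rw [mem_isq, mem_prod, mem_Icc, mem_Icc]

lemma volume_isq : volume Isq = 4 := by
  rw [isq_eq, Measure.volume_eq_prod, Measure.prod_prod, Real.volume_Icc]
  rw [← ENNReal.ofReal_mul (by norm_num)]
  norm_num

/-! ### norm facts -/

lemma IsNorm2.nonneg {τ : ℝ × ℝ → ℝ} (hτ : IsNorm2 τ) (x : ℝ × ℝ) : 0 ≤ τ x := by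
  have h0 : τ 0 = 0 := (hτ.1 0).2 rfl
  have h1 := hτ.2.2 x ((-1:ℝ) • x)
  rw [hτ.2.1] at h1
  have : x + (-1:ℝ) • x = 0 := by simp
  rw [this, h0] at h1
  norm_num at h1
  linarith

lemma IsNorm2.neg {τ : ℝ × ℝ → ℝ} (hτ : IsNorm2 τ) (x : ℝ × ℝ) : τ (-x) = τ x := by
  have := hτ.2.1 (-1) x
  simpa using this

lemma IsNorm2.le_coord {τ : ℝ × ℝ → ℝ} (hτ : IsNorm2 τ) (x : ℝ × ℝ) :
    τ x ≤ |x.1| * τ (1, 0) + |x.2| * τ (0, 1) := by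
  have h := hτ.2.2 (x.1 • ((1:ℝ), (0:ℝ))) (x.2 • ((0:ℝ), (1:ℝ)))
  rw [hτ.2.1, hτ.2.1] at h
  convert h using 2
  ext <;> simp

lemma IsNorm2.continuous {τ : ℝ × ℝ → ℝ} (hτ : IsNorm2 τ) : Continuous τ := by
  rw [continuous_iff_continuousAt]
  intro x
  have hb : ∀ y, |τ y - τ x| ≤ |y.1 - x.1| * τ (1, 0) + |y.2 - x.2| * τ (0, 1) := by
    intro y
    have h1 := hτ.2.2 x (y - x)
    have h2 := hτ.2.2 y (-(y - x))
    rw [hτ.neg] at h2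
    have h3 := hτ.le_coord (y - x)
    simp only [add_sub_cancel, Prod.fst_sub, Prod.snd_sub] at h1 h3
    have : y + -(y - x) = x := by abel
    rw [this] at h2
    rw [abs_le]; constructor <;> linarith
  rw [ContinuousAt, tendsto_iff_norm_sub_tendsto_zero]
  refine squeeze_zero (fun _ => norm_nonneg _) (fun y => hb y) ?_
  have : Continuous (fun y : ℝ × ℝ => |y.1 - x.1| * τ (1, 0) + |y.2 - x.2| * τ (0, 1)) := by
    fun_prop
  have := this.tendsto x
  simpa using this

/-- norm equivalence -/
lemma IsNorm2.lower {τ : ℝ × ℝ → ℝ} (hτ : IsNorm2 τ) :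
    ∃ k : ℝ, 0 < k ∧ ∀ v : ℝ × ℝ, k * ‖v‖ ≤ τ v := by
  have hc : IsCompact (Metric.sphere (0 : ℝ × ℝ) 1) := isCompact_sphere _ _
  have hne : (Metric.sphere (0 : ℝ × ℝ) 1).Nonempty := ⟨(1, 0), by simp [Prod.norm_def]⟩
  obtain ⟨z, hz, hmin⟩ := hc.exists_isMinOn hne hτ.continuous.continuousOn
  have hz0 : z ≠ 0 := by
    rintro rfl; simp at hz
  refine ⟨τ z, lt_of_le_of_ne (hτ.nonneg z) (fun h => hz0 ((hτ.1 z).1 h.symm)), fun v => ?_⟩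
  rcases eq_or_ne v 0 with rfl | hv
  · simp [(hτ.1 0).2 rfl]
  have hn : 0 < ‖v‖ := norm_pos_iff.2 hv
  have : ‖v‖⁻¹ • v ∈ Metric.sphere (0 : ℝ × ℝ) 1 := by
    simp [norm_smul, hn.ne']
  have h := hmin this
  simp only [mem_ofPred_eq] at h
  rw [hτ.2.1, abs_of_pos (by positivity)] at h
  calc τ z * ‖v‖ ≤ (‖v‖⁻¹ * τ v) * ‖v‖ := by gcongr
    _ = τ v := by field_simp

lemma dualNorm_le_one_iff {τ : ℝ × ℝ → ℝ} (hτ : IsNorm2 τ) (w : ℝ × ℝ) :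
    dualNorm τ w ≤ 1 ↔ ∀ v : ℝ × ℝ, v.1 * w.1 + v.2 * w.2 ≤ τ v := by
  obtain ⟨k, hk, hkl⟩ := hτ.lower
  have hbdd : BddAbove {x | ∃ v : ℝ × ℝ, τ v ≤ 1 ∧ x = v.1 * w.1 + v.2 * w.2} := by
    refine ⟨k⁻¹ * |w.1| + k⁻¹ * |w.2|, ?_⟩
    rintro x ⟨v, hv, rfl⟩
    have h1 : ‖v‖ ≤ k⁻¹ := by
      have := hkl v
      rw [inv_eq_one_div, le_div_iff₀ hk]; linarith
    have h2 : |v.1| ≤ k⁻¹ := (norm_fst_le v).trans h1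
    have h3 : |v.2| ≤ k⁻¹ := (norm_snd_le v).trans h1
    have h4 : v.1 * w.1 ≤ |v.1| * |w.1| := by rw [← abs_mul]; exact le_abs_self _
    have h5 : v.2 * w.2 ≤ |v.2| * |w.2| := by rw [← abs_mul]; exact le_abs_self _
    have := mul_le_mul_of_nonneg_right h2 (abs_nonneg w.1)
    have := mul_le_mul_of_nonneg_right h3 (abs_nonneg w.2)
    linarith
  constructor
  · intro h v
    rcases eq_or_ne v 0 with rfl | hv
    · simp [(hτ.1 0).2 rfl]
    have hp : 0 < τ v := lt_of_le_of_ne (hτ.nonneg v) (fun h => hv ((hτ.1 v).1 h.symm))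
    have hm := le_csSup hbdd (a := ((τ v)⁻¹ • v).1 * w.1 + ((τ v)⁻¹ • v).2 * w.2)
      ⟨(τ v)⁻¹ • v, by rw [hτ.2.1, abs_of_pos (by positivity)]; field_simp; rfl, rfl⟩
    have h2 := hm.trans h
    simp only [Prod.smul_fst, Prod.smul_snd, smul_eq_mul] at h2
    have h3 : (τ v)⁻¹ * (v.1 * w.1 + v.2 * w.2) ≤ 1 := by linarith
    rwa [inv_mul_le_iff₀ hp, mul_one] at h3
  · intro h
    refine csSup_le ⟨0, 0, by simp [(hτ.1 0).2 rfl], by simp⟩ ?_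
    rintro x ⟨v, hv, rfl⟩
    exact (h v).trans hv

lemma eNorm2_le_one_iff (w : ℝ × ℝ) : eNorm2 w ≤ 1 ↔ w.1 ^ 2 + w.2 ^ 2 ≤ 1 := by
  unfold eNorm2
  rw [Real.sqrt_le_iff]; norm_num

lemma isq_compact : IsCompact Isq := isCompact_Icc

lemma Adm.mk' {τ : ℝ × ℝ → ℝ} {f : ℝ × ℝ → ℝ × ℝ} (h1 : ContDiff ℝ (⊤ : ℕ∞) f)
    (h2 : tsupport f ⊆ Sq) (h3 : ∀ x v, v.1 * (f x).1 + v.2 * (f x).2 ≤ τ v) : Adm τ f :=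
  ⟨h1, isq_compact.of_isClosed_subset (isClosed_tsupport f) (h2.trans sq_subset_isq), h2, h3⟩

lemma Adm.zero {τ : ℝ × ℝ → ℝ} (hτ : IsNorm2 τ) : Adm τ (fun _ => 0) := by
  refine Adm.mk' contDiff_const ?_ (fun x v => by simpa using hτ.nonneg v)
  simp [tsupport, Function.support]

lemma Adm.neg {τ : ℝ × ℝ → ℝ} (hτ : IsNorm2 τ) {f : ℝ × ℝ → ℝ × ℝ} (hf : Adm τ f) :
    Adm τ (fun x => - f x) := by
  refine Adm.mk' hf.1.neg ?_ (fun x v => ?_)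
  · exact (tsupport_comp_subset (g := fun y : ℝ × ℝ => -y) (by simp) f).trans hf.2.2.1
  · have := hf.2.2.2 x (-v)
    rw [hτ.neg] at this
    simpa using this

lemma EB.nonneg {τ : ℝ × ℝ → ℝ} (hτ : IsNorm2 τ) {E : Set (ℝ × ℝ)} {c : ℝ} (h : EB τ E c) :
    0 ≤ c := by
  have := h _ (Adm.zero hτ)
  have h0 : ∀ x, div2 (fun _ => (0 : ℝ × ℝ)) x = 0 := by intro x; simp [div2]
  simpa [h0] using this

lemma EB.mono {τ : ℝ × ℝ → ℝ} {E : Set (ℝ × ℝ)} {c d : ℝ} (h : EB τ E c) (hcd : c ≤ d) :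
    EB τ E d := fun f hf => (h f hf).trans hcd

lemma EB_of_surfE {τ : ℝ × ℝ → ℝ} (hτ : IsNorm2 τ) {E : Set (ℝ × ℝ)} (h : surfE τ E ≠ ⊤) :
    EB τ E (surfE τ E).toReal := by
  intro f hf
  rw [← ENNReal.ofReal_le_iff_le_toReal h]
  unfold surfE
  exact le_iSup₂ (f := fun f _ => ENNReal.ofReal (∫ x in E, div2 f x)) f
    ⟨hf.1, hf.2.1, hf.2.2.1.trans sq_subset_osq, fun x => (dualNorm_le_one_iff hτ _).2 (hf.2.2.2 x)⟩

lemma volume_lt_top_of_subset {E : Set (ℝ × ℝ)} (hE : E ⊆ Isq) : volume E < ⊤ :=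
  (measure_mono hE).trans_lt (by rw [volume_isq]; norm_num)

lemma volume_le_four {E : Set (ℝ × ℝ)} (hE : E ⊆ Isq) : volume.real E ≤ 4 := by
  have := measure_mono (μ := volume) hE
  rw [volume_isq] at this
  have := ENNReal.toReal_mono (by norm_num) this
  simpa [Measure.real] using this

lemma tendsto_integral_set_bdd {E : Set (ℝ × ℝ)} (hE : volume E < ⊤) {F : ℕ → ℝ × ℝ → ℝ}
    {G : ℝ × ℝ → ℝ} (C : ℝ) (hm : ∀ n, AEStronglyMeasurable (F n) (volume.restrict E))
    (hb : ∀ n x, |F n x| ≤ C)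
    (hl : ∀ᵐ x ∂(volume.restrict E), Tendsto (fun n => F n x) atTop (nhds (G x))) :
    Tendsto (fun n => ∫ x in E, F n x) atTop (nhds (∫ x in E, G x)) := by
  have : IsFiniteMeasure (volume.restrict E) := ⟨by simpa using hE⟩
  exact tendsto_integral_of_dominated_convergence (fun _ => C) hm (integrable_const C)
    (fun n => Eventually.of_forall (fun x => hb n x)) hl

lemma exists_bound {u : ℝ × ℝ → ℝ} (hu : Continuous u) (hc : HasCompactSupport u) :
    ∃ C, 0 ≤ C ∧ ∀ x, |u x| ≤ C := by
  obtain ⟨C, hC⟩ := hu.bounded_above_of_compact_support hc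
  exact ⟨C, (norm_nonneg _).trans (hC 0), hC⟩

lemma EB.surfE_le {τ : ℝ × ℝ → ℝ} (hτ : IsNorm2 τ) {E : Set (ℝ × ℝ)} (hE : E ⊆ Isq) {c : ℝ}
    (h : EB τ E c) : surfE τ E ≤ ENNReal.ofReal c := by
  unfold surfE
  refine iSup₂_le (fun f hf => ?_)
  obtain ⟨h1, h2, h3, h4⟩ := hf
  apply ENNReal.ofReal_le_ofReal
  obtain ⟨C, hC0, hC⟩ := exists_bound (div2_continuous h1) (div2_hasCompactSupport h2)
  let k : ℕ → ℝ := fun n => 1 + 1 / ((n : ℝ) + 1)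
  have hk1 : ∀ n, 1 < k n := fun n => by simp only [k]; linarith [Nat.one_div_pos_of_nat (α := ℝ) (n := n)]
  have hk2 : ∀ n, k n ≤ 2 := fun n => by
    simp only [k]; linarith [Nat.one_div_le_one_div (α := ℝ) (Nat.zero_le n), Nat.one_div_pos_of_nat (α := ℝ) (n := n), (by norm_num : (1:ℝ) / ((0:ℕ) + 1) = 1)]
  have hk3 : Tendsto k atTop (nhds 1) := by
    have := (tendsto_one_div_add_atTop_nhds_zero_nat (𝕜 := ℝ)).const_add 1
    simpa only [add_zero] using this
  have hd : Differentiable ℝ f := h1.differentiable (by simp)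
  have hadm : ∀ n, Adm τ (fun x => f (0 + k n • x)) := by
    intro n
    refine Adm.mk' (h1.comp (contDiff_const.add (contDiff_id.const_smul _))) ?_
      (fun x => (dualNorm_le_one_iff hτ _).1 (h4 _))
    intro x hx
    have hx2 := osq_subset_isq (h3 (tsupport_comp_subset_preimage f (f := fun x : ℝ × ℝ => 0 + k n • x) (by fun_prop) hx))
    have hkn := hk1 n
    rw [mem_isq] at hx2
    simp only [zero_add, Prod.smul_fst, Prod.smul_snd, smul_eq_mul] at hx2
    rw [mem_sq]
    refine ⟨⟨?_, ?_⟩, ⟨?_, ?_⟩⟩ <;> nlinarith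
  have hle : ∀ n, ∫ x in E, k n * div2 f (0 + k n • x) ≤ c := by
    intro n
    have := h _ (hadm n)
    simpa only [div2_comp_affine hd] using this
  have hcont := div2_continuous h1
  refine le_of_tendsto (tendsto_integral_set_bdd (volume_lt_top_of_subset hE) (2 * C)
    (fun n => ?_) (fun n x => ?_) (Eventually.of_forall (fun x => ?_))) (Eventually.of_forall hle)
  · exact (by fun_prop : Continuous fun x => k n * div2 f (0 + k n • x)).aestronglyMeasurable
  · rw [abs_mul, abs_of_pos (by linarith [hk1 n])]
    exact mul_le_mul (hk2 n) (hC _) (abs_nonneg _) (by norm_num)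
  · have : Continuous (fun s : ℝ => s * div2 f (0 + s • x)) := by fun_prop
    have := (this.tendsto 1).comp hk3
    simpa [Function.comp_def] using this

lemma EB.compl {τ : ℝ × ℝ → ℝ} (hτ : IsNorm2 τ) {E : Set (ℝ × ℝ)} (hE : E ⊆ Isq)
    (hm : MeasurableSet E) {c : ℝ} (h : EB τ E c) : EB τ (Isq \ E) c := by
  intro f hf
  have hi := div2_integrable hf.1 hf.2.1
  have e1 := setIntegral_sdiff hm hi.integrableOn hE (f := div2 f) (μ := volume)
  have e2 : ∫ x in Isq, div2 f x = 0 := by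
    rw [← integral_div2_zero hf.1 hf.2.1]
    exact setIntegral_eq_integral_of_forall_compl_eq_zero
      (fun x hx => div2_zero_of_notMem (fun h => hx (sq_subset_isq (hf.2.2.1 h))))
  have e3 := h _ (hf.neg hτ)
  simp only [div2_neg] at e3
  rw [integral_neg] at e3
  linarith

/-! ### Dilations and the coordinate swap -/

lemma integral_comp_affine (u : ℝ × ℝ → ℝ) (b : ℝ × ℝ) {k : ℝ} (hk : 0 < k) :
    ∫ x, u (b + k • x) = (k ^ 2)⁻¹ * ∫ x, u x := by
  have h1 := Measure.integral_comp_smul (volume : Measure (ℝ × ℝ)) (fun x => u (b + x)) k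
  rw [h1, integral_add_left_eq_self (fun x => u x) b]
  simp [Module.finrank_prod]

lemma setIntegral_comp_affine {F : Set (ℝ × ℝ)} (hF : MeasurableSet F) (u : ℝ × ℝ → ℝ)
    (b : ℝ × ℝ) {k : ℝ} (hk : 0 < k) :
    ∫ x in (fun x => b + k • x) ⁻¹' F, u (b + k • x) = (k ^ 2)⁻¹ * ∫ x in F, u x := by
  have hm : MeasurableSet ((fun x : ℝ × ℝ => b + k • x) ⁻¹' F) :=
    (by fun_prop : Measurable (fun x : ℝ × ℝ => b + k • x)) hF
  rw [← integral_indicator hm, ← integral_indicator hF, ← integral_comp_affine _ b hk]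
  rfl

lemma volume_affine {F : Set (ℝ × ℝ)} (hF : MeasurableSet F)
    (b : ℝ × ℝ) {k : ℝ} (hk : 0 < k) :
    volume.real ((fun x => b + k • x) ⁻¹' F) = (k ^ 2)⁻¹ * volume.real F := by
  have := setIntegral_comp_affine hF (fun _ => 1) b hk
  simpa using this

lemma EB.dilate {τ : ℝ × ℝ → ℝ} {F : Set (ℝ × ℝ)} (hF : MeasurableSet F)
    {c : ℝ} (h : EB τ F c) {c0 : ℝ × ℝ} (hc0 : c0 ∈ Isq) {k : ℝ} (hk : 0 < k) (hk1 : k ≤ 1) :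
    EB τ ((fun x => (1 - k) • c0 + k • x) ⁻¹' F) (k⁻¹ * c) := by
  intro f hf
  have hd : Differentiable ℝ f := hf.1.differentiable (by simp)
  set b' : ℝ × ℝ := (1 - k⁻¹) • c0 with hb'
  have hinv : ∀ x : ℝ × ℝ, b' + k⁻¹ • ((1 - k) • c0 + k • x) = x := by
    intro x
    ext <;> simp [hb'] <;> field_simp <;> ring
  have hinv2 : ∀ y : ℝ × ℝ, (1 - k) • c0 + k • (b' + k⁻¹ • y) = y := by
    intro x
    ext <;> simp [hb'] <;> field_simp <;> ring
  have hadm : Adm τ (fun y => f (b' + k⁻¹ • y)) := by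
    refine Adm.mk' (hf.1.comp (contDiff_const.add (contDiff_id.const_smul _))) ?_
      (fun x => hf.2.2.2 _)
    intro y hy
    have hx2 := hf.2.2.1 (tsupport_comp_subset_preimage f
      (f := fun x : ℝ × ℝ => b' + k⁻¹ • x) (by fun_prop) hy)
    rw [← hinv2 y]
    set z := b' + k⁻¹ • y
    rw [mem_sq] at hx2
    rw [mem_isq] at hc0
    rw [mem_sq]
    simp only [Prod.fst_add, Prod.smul_fst, Prod.smul_snd, Prod.snd_add, smul_eq_mul]
    refine ⟨⟨?_, ?_⟩, ⟨?_, ?_⟩⟩ <;> nlinarith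
  have h1 := h _ hadm
  simp only [div2_comp_affine hd] at h1
  have h2 := setIntegral_comp_affine hF (fun y => k⁻¹ * div2 f (b' + k⁻¹ • y)) ((1 - k) • c0) hk
  simp only [hinv] at h2
  rw [integral_const_mul] at h2
  have h3 : ∫ x in (fun x => (1 - k) • c0 + k • x) ⁻¹' F, div2 f x
      = k⁻¹ * ∫ x in F, k⁻¹ * div2 f (b' + k⁻¹ • x) := by
    field_simp at h2 ⊢
    linarith
  rw [h3]
  gcongr

/-- coordinate swap of a norm -/
def swapN (τ : ℝ × ℝ → ℝ) : ℝ × ℝ → ℝ := fun v => τ v.swap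

lemma IsNorm2.swap {τ : ℝ × ℝ → ℝ} (hτ : IsNorm2 τ) : IsNorm2 (swapN τ) := by
  refine ⟨fun x => ?_, fun c x => ?_, fun x y => ?_⟩
  · unfold swapN
    rw [hτ.1]
    constructor
    · intro h; rw [← Prod.swap_swap x, h]; rfl
    · rintro rfl; rfl
  · exact hτ.2.1 c x.swap
  · exact hτ.2.2 x.swap y.swap

lemma swapN_swapN (τ : ℝ × ℝ → ℝ) : swapN (swapN τ) = τ := rfl

lemma measurePreserving_swap2 :
    MeasurePreserving (Prod.swap : ℝ × ℝ → ℝ × ℝ) volume volume :=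
  Measure.measurePreserving_swap

lemma setIntegral_swap (F : Set (ℝ × ℝ)) (u : ℝ × ℝ → ℝ) :
    ∫ x in Prod.swap ⁻¹' F, u x.swap = ∫ x in F, u x :=
  measurePreserving_swap2.setIntegral_preimage_emb
    (MeasurableEquiv.prodComm (α := ℝ) (β := ℝ)).measurableEmbedding u F

lemma volume_swap (F : Set (ℝ × ℝ)) : volume.real (Prod.swap ⁻¹' F) = volume.real F := by
  unfold Measure.real
  rw [measurePreserving_swap2.measure_preimage_emb
    (MeasurableEquiv.prodComm (α := ℝ) (β := ℝ)).measurableEmbedding]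

lemma measurableSet_swap {F : Set (ℝ × ℝ)} (h : MeasurableSet F) :
    MeasurableSet (Prod.swap ⁻¹' F) := measurable_swap h

lemma swap_subset_isq {F : Set (ℝ × ℝ)} (h : F ⊆ Isq) : Prod.swap ⁻¹' F ⊆ Isq := by
  intro x hx
  have := h hx
  rw [mem_isq] at this ⊢
  exact ⟨this.2, this.1⟩

lemma div2_swap {f : ℝ × ℝ → ℝ × ℝ} (hf : Differentiable ℝ f) (x : ℝ × ℝ) :
    div2 (fun x => (f x.swap).swap) x = div2 f x.swap := by
  let L : (ℝ × ℝ) →L[ℝ] (ℝ × ℝ) := (ContinuousLinearEquiv.prodComm ℝ ℝ ℝ)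
  have h : HasFDerivAt (fun x : ℝ × ℝ => (f x.swap).swap) (L ∘L (fderiv ℝ f x.swap) ∘L L) x :=
    L.hasFDerivAt.comp x ((hf x.swap).hasFDerivAt.comp x L.hasFDerivAt)
  unfold div2
  rw [h.fderiv]
  simp [L]; ring

lemma EB.swap {τ : ℝ × ℝ → ℝ} {F : Set (ℝ × ℝ)} {c : ℝ} (h : EB τ F c) :
    EB (swapN τ) (Prod.swap ⁻¹' F) c := by
  intro f hf
  have hd : Differentiable ℝ f := hf.1.differentiable (by simp)
  have hs : ContDiff ℝ (⊤ : ℕ∞) (Prod.swap : ℝ × ℝ → ℝ × ℝ) := contDiff_snd.prodMk contDiff_fst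
  have hadm : Adm τ (fun x => (f x.swap).swap) := by
    refine Adm.mk' (hs.comp (hf.1.comp hs)) ?_ (fun x v => ?_)
    · intro y hy
      have h1 := tsupport_comp_subset (g := (Prod.swap : ℝ × ℝ → ℝ × ℝ)) rfl (fun x : ℝ × ℝ => f x.swap) hy
      have h2 := hf.2.2.1 (tsupport_comp_subset_preimage f
        (f := (Prod.swap : ℝ × ℝ → ℝ × ℝ)) hs.continuous h1)
      rw [mem_sq] at h2 ⊢
      exact ⟨h2.2, h2.1⟩
    · have := hf.2.2.2 x.swap v.swap
      simp only [swapN, Prod.swap_swap] at this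
      simp only [Prod.fst_swap, Prod.snd_swap] at this ⊢
      linarith
  have h1 := h _ hadm
  simp only [div2_swap hd] at h1
  rw [← setIntegral_swap F] at h1
  simpa using h1

/-! ### Cutoffs and finiteness of the perimeter -/

lemma S_deriv_continuous : Continuous (deriv Real.smoothTransition) :=
  (Real.smoothTransition.contDiff (n := 1)).continuous_deriv le_rfl

lemma S_deriv_zero {x : ℝ} (hx : x ∉ Icc (0:ℝ) 1) : deriv Real.smoothTransition x = 0 := by
  rw [mem_Icc, not_and_or, not_le, not_le] at hx
  rcases hx with hx | hx
  · have : Real.smoothTransition =ᶠ[nhds x] fun _ => 0 := by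
      filter_upwards [Iio_mem_nhds hx] with y hy
      exact Real.smoothTransition.zero_of_nonpos (le_of_lt hy)
    rw [this.deriv_eq]; simp
  · have : Real.smoothTransition =ᶠ[nhds x] fun _ => 1 := by
      filter_upwards [Ioi_mem_nhds hx] with y hy
      exact Real.smoothTransition.one_of_one_le (le_of_lt hy)
    rw [this.deriv_eq]; simp

lemma S_deriv_compact : HasCompactSupport (deriv Real.smoothTransition) :=
  HasCompactSupport.intro isCompact_Icc (fun _ hx => S_deriv_zero hx)

lemma S_deriv_bound : ∃ C, 0 ≤ C ∧ ∀ x, |deriv Real.smoothTransition x| ≤ C := by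
  obtain ⟨C, hC⟩ := S_deriv_continuous.bounded_above_of_compact_support S_deriv_compact
  exact ⟨C, (norm_nonneg _).trans (hC 0), hC⟩

lemma S_comp_deriv (p q x : ℝ) : HasDerivAt (fun s => Real.smoothTransition (p * s + q))
    (p * deriv Real.smoothTransition (p * x + q)) x := by
  have h1 : HasDerivAt (fun s : ℝ => p * s + q) p x := by
    simpa using ((hasDerivAt_id x).const_mul p).add_const q
  have h2 := ((Real.smoothTransition.contDiff (n := 1)).differentiable (by simp)
    (p * x + q)).hasDerivAt.comp x h1
  rw [mul_comm]; exact h2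

lemma S_comp_integral {p : ℝ} (hp : p ≠ 0) (q : ℝ) :
    Integrable (fun s => |p * deriv Real.smoothTransition (p * s + q)|) ∧
    ∫ s, |p * deriv Real.smoothTransition (p * s + q)| = ∫ s, |deriv Real.smoothTransition s| := by
  constructor
  · have h := (S_deriv_continuous.integrable_of_hasCompactSupport S_deriv_compact (μ := volume))
    have := ((h.comp_add_right q).comp_mul_left' hp).const_mul p
    exact this.abs
  · have h := Measure.integral_comp_mul_left (fun y => |deriv Real.smoothTransition (y + q)|) p
    simp_rw [abs_mul]
    rw [integral_const_mul, h, integral_add_right_eq_self (fun y => |deriv Real.smoothTransition y|) q,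
      smul_eq_mul, abs_inv, ← mul_assoc, mul_inv_cancel₀ (abs_ne_zero.2 hp), one_mul]

/-- one-dimensional cutoffs -/
lemma exists_cutoff : ∃ (C : ℝ) (T : ℕ → ℝ → ℝ), 0 ≤ C ∧ (∀ n, ContDiff ℝ (⊤ : ℕ∞) (T n)) ∧
    (∀ n s, 0 ≤ T n s) ∧ (∀ n s, T n s ≤ 1) ∧
    (∀ n s, T n s ≠ 0 → |s| ≤ 1 - 1 / ((n : ℝ) + 1)) ∧
    (∀ s, |s| < 1 → Tendsto (fun n => T n s) atTop (nhds 1)) ∧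
    (∀ n, Integrable (fun s => |deriv (T n) s|)) ∧
    (∀ n, ∫ s, |deriv (T n) s| ≤ C) := by
  set S := Real.smoothTransition with hS
  have hSd : ContDiff ℝ (⊤ : ℕ∞) S := Real.smoothTransition.contDiff
  have hS0 : ∀ x, 0 ≤ S x := Real.smoothTransition.nonneg
  have hS1 : ∀ x, S x ≤ 1 := Real.smoothTransition.le_one
  let T : ℕ → ℝ → ℝ := fun n s => S (((n : ℝ) + 1) * s + n) * S (-((n : ℝ) + 1) * s + n)
  have hT : ∀ n, ContDiff ℝ (⊤ : ℕ∞) (T n) := fun n =>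
    (hSd.comp (by fun_prop)).mul (hSd.comp (by fun_prop))
  have hder : ∀ (n : ℕ) s, |deriv (T n) s| ≤ |((n : ℝ) + 1) * deriv S (((n : ℝ) + 1) * s + n)| +
      |(-((n : ℝ) + 1)) * deriv S (-((n : ℝ) + 1) * s + n)| := by
    intro n s
    have h := (S_comp_deriv ((n : ℝ) + 1) n s).mul (S_comp_deriv (-((n : ℝ) + 1)) n s)
    have h' : deriv (T n) s = _ := h.deriv
    rw [h']
    refine (abs_add_le _ _).trans ?_
    rw [abs_mul _ (Real.smoothTransition _), abs_mul (Real.smoothTransition _)]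
    refine add_le_add ?_ ?_
    · refine mul_le_of_le_one_right (abs_nonneg _) ?_
      rw [abs_of_nonneg (hS0 _)]; exact hS1 _
    · refine mul_le_of_le_one_left (abs_nonneg _) ?_
      rw [abs_of_nonneg (hS0 _)]; exact hS1 _
  have hp : ∀ n : ℕ, ((n : ℝ) + 1) ≠ 0 := fun n => by positivity
  have hIntg : ∀ n, Integrable (fun s => |deriv (T n) s|) := by
    intro n
    refine Integrable.mono' ((S_comp_integral (hp n) n).1.add
      (S_comp_integral (neg_ne_zero.2 (hp n)) n).1) ?_ ?_
    · exact (((hT n).continuous_deriv (by simp)).abs).aestronglyMeasurable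
    · refine Eventually.of_forall (fun s => ?_)
      rw [Real.norm_eq_abs, abs_abs]; exact hder n s
  refine ⟨2 * ∫ s, |deriv S s|, T, ?_, hT, fun n s => mul_nonneg (hS0 _) (hS0 _),
    fun n s => mul_le_one₀ (hS1 _) (hS0 _) (hS1 _), ?_, ?_, hIntg, ?_⟩
  · exact mul_nonneg (by norm_num) (integral_nonneg (fun _ => abs_nonneg _))
  · intro n s hs
    have h1 : S (((n : ℝ) + 1) * s + n) ≠ 0 := left_ne_zero_of_mul hs
    have h2 : S (-((n : ℝ) + 1) * s + n) ≠ 0 := right_ne_zero_of_mul hs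
    have h1' : 0 < ((n : ℝ) + 1) * s + n := by
      by_contra h; exact h1 (Real.smoothTransition.zero_of_nonpos (not_lt.1 h))
    have h2' : 0 < -((n : ℝ) + 1) * s + n := by
      by_contra h; exact h2 (Real.smoothTransition.zero_of_nonpos (not_lt.1 h))
    have hn : (0:ℝ) < (n : ℝ) + 1 := by positivity
    have e : 1 - 1 / ((n : ℝ) + 1) = n / ((n : ℝ) + 1) := by field_simp; ring
    rw [e, abs_le, ← neg_div, div_le_iff₀ hn, le_div_iff₀ hn]
    constructor <;> nlinarith
  · intro s hs
    rw [abs_lt] at hs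
    obtain ⟨N, hN⟩ := exists_nat_gt (2 / min (1 + s) (1 - s))
    have hmin : 0 < min (1 + s) (1 - s) := lt_min (by linarith) (by linarith)
    rw [div_lt_iff₀ hmin] at hN
    refine tendsto_const_nhds.congr' ?_
    filter_upwards [eventually_ge_atTop N] with n hn
    have hn' : (N : ℝ) ≤ n := by exact_mod_cast hn
    have ha : 2 < (n : ℝ) * min (1 + s) (1 - s) := hN.trans_le (by gcongr)
    have h1 : (n : ℝ) * min (1 + s) (1 - s) ≤ n * (1 + s) := by gcongr; exact min_le_left _ _
    have h2 : (n : ℝ) * min (1 + s) (1 - s) ≤ n * (1 - s) := by gcongr; exact min_le_right _ _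
    have e1 : S (((n : ℝ) + 1) * s + n) = 1 := Real.smoothTransition.one_of_one_le (by nlinarith)
    have e2 : S (-((n : ℝ) + 1) * s + n) = 1 := Real.smoothTransition.one_of_one_le (by nlinarith)
    show 1 = S _ * S _
    rw [e1, e2, one_mul]
  · intro n
    calc ∫ s, |deriv (T n) s| ≤ _ := integral_mono (hIntg n) ((S_comp_integral (hp n) n).1.add
      (S_comp_integral (neg_ne_zero.2 (hp n)) n).1) (hder n)
      _ = _ := by
        rw [integral_add' (S_comp_integral (hp n) n).1 (S_comp_integral (neg_ne_zero.2 (hp n)) n).1,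
          (S_comp_integral (hp n) n).2, (S_comp_integral (neg_ne_zero.2 (hp n)) n).2]
        ring

lemma small_adm {τ : ℝ × ℝ → ℝ} {k : ℝ} (hk : 0 < k) (hkl : ∀ v : ℝ × ℝ, k * ‖v‖ ≤ τ v)
    {w : ℝ × ℝ} (h1 : |w.1| ≤ 1) (h2 : |w.2| ≤ 1) (v : ℝ × ℝ) :
    v.1 * ((k / 2) * w.1) + v.2 * ((k / 2) * w.2) ≤ τ v := by
  have a1 : |v.1| ≤ ‖v‖ := norm_fst_le v
  have a2 : |v.2| ≤ ‖v‖ := norm_snd_le v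
  have b1 : v.1 * w.1 ≤ ‖v‖ := by
    refine (le_abs_self _).trans ?_
    rw [abs_mul]
    calc |v.1| * |w.1| ≤ ‖v‖ * 1 := by gcongr
      _ = ‖v‖ := mul_one _
  have b2 : v.2 * w.2 ≤ ‖v‖ := by
    refine (le_abs_self _).trans ?_
    rw [abs_mul]
    calc |v.2| * |w.2| ≤ ‖v‖ * 1 := by gcongr
      _ = ‖v‖ := mul_one _
  refine le_trans ?_ (hkl v)
  nlinarith

lemma abs_le_of_eNorm {w : ℝ × ℝ} (h : w.1 ^ 2 + w.2 ^ 2 ≤ 1) : |w.1| ≤ 1 ∧ |w.2| ≤ 1 := by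
  constructor
  · rw [← sq_le_one_iff_abs_le_one]; nlinarith [sq_nonneg w.2]
  · rw [← sq_le_one_iff_abs_le_one]; nlinarith [sq_nonneg w.1]

lemma ae_mem_sq {E : Set (ℝ × ℝ)} (hE : E ⊆ Isq) : ∀ᵐ x ∂(volume.restrict E), x ∈ Sq := by
  have h0 : volume (Isq \ Sq) = 0 := by
    have h1 : volume Sq = 4 := by
      rw [Sq, Measure.volume_eq_prod, Measure.prod_prod, Real.volume_Ioo]
      rw [← ENNReal.ofReal_mul (by norm_num)]
      norm_num
    rw [measure_sdiff sq_subset_isq isOpen_sq.measurableSet.nullMeasurableSet (by rw [h1]; norm_num),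
      h1, volume_isq]
    norm_num
  have h2 : ∀ᵐ x ∂(volume.restrict Isq), x ∈ Sq := by
    rw [ae_restrict_iff' isq_measurable, ae_iff]
    refine measure_mono_null ?_ h0
    intro x hx
    simp only [mem_ofPred_eq, Classical.not_imp] at hx
    exact hx
  exact ae_mono (Measure.restrict_mono hE le_rfl) h2

lemma per_ne_top {τ : ℝ × ℝ → ℝ} (hτ : IsNorm2 τ) {E : Set (ℝ × ℝ)} (hE : E ⊆ Isq)
    {c : ℝ} (h : EB τ E c) : per E ≠ ⊤ := by
  obtain ⟨k, hk, hkl⟩ := hτ.lower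
  obtain ⟨C, T, hC0, hT, hT0, hT1, hTs, hTl, hTi, hTC⟩ := exists_cutoff
  have key : per E ≤ ENNReal.ofReal (c / (k / 2) + 4 * C) := by
    unfold per
    refine iSup₂_le (fun f hf => ?_)
    obtain ⟨h1, h2, h3⟩ := hf
    apply ENNReal.ofReal_le_ofReal
    have hfb : ∀ x, |(f x).1| ≤ 1 ∧ |(f x).2| ≤ 1 := fun x =>
      abs_le_of_eNorm ((eNorm2_le_one_iff _).1 (h3 x))
    obtain ⟨M, hM0, hM⟩ := exists_bound (div2_continuous h1) (div2_hasCompactSupport h2)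
    have hd : Differentiable ℝ f := h1.differentiable (by simp)
    let φ : ℕ → ℝ × ℝ → ℝ := fun n x => T n x.1 * T n x.2
    have hφ : ∀ n, ContDiff ℝ (⊤ : ℕ∞) (φ n) := fun n =>
      ((hT n).comp contDiff_fst).mul ((hT n).comp contDiff_snd)
    have hφ1 : ∀ n x, |φ n x| ≤ 1 := fun n x => by
      rw [abs_of_nonneg (mul_nonneg (hT0 _ _) (hT0 _ _))]
      exact mul_le_one₀ (hT1 _ _) (hT0 _ _) (hT1 _ _)
    have hφd : ∀ n x, HasFDerivAt (φ n) ((T n x.1) • ((deriv (T n) x.2) • ContinuousLinearMap.snd ℝ ℝ ℝ)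
        + (T n x.2) • ((deriv (T n) x.1) • ContinuousLinearMap.fst ℝ ℝ ℝ)) x := by
      intro n x
      have a1 : HasFDerivAt (fun x : ℝ × ℝ => T n x.1) ((deriv (T n) x.1) • ContinuousLinearMap.fst ℝ ℝ ℝ) x :=
        (((hT n).differentiable (by simp)) x.1).hasDerivAt.comp_hasFDerivAt x hasFDerivAt_fst
      have a2 : HasFDerivAt (fun x : ℝ × ℝ => T n x.2) ((deriv (T n) x.2) • ContinuousLinearMap.snd ℝ ℝ ℝ) x :=
        (((hT n).differentiable (by simp)) x.2).hasDerivAt.comp_hasFDerivAt x hasFDerivAt_snd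
      exact a1.mul a2
    have hsupp : ∀ n, tsupport (fun x => φ n x • ((k / 2) • f x)) ⊆ Sq := by
      intro n
      have hcl : IsClosed ({x : ℝ × ℝ | |x.1| ≤ 1 - 1 / ((n : ℝ) + 1)} ∩ {x | |x.2| ≤ 1 - 1 / ((n : ℝ) + 1)}) :=
        (isClosed_le (by fun_prop) (by fun_prop)).inter (isClosed_le (by fun_prop) (by fun_prop))
      refine (closure_minimal ?_ hcl).trans ?_
      · intro x hx
        have hx' : φ n x ≠ 0 := by
          intro h0; simp [h0] at hx
        exact ⟨hTs n _ (left_ne_zero_of_mul hx'), hTs n _ (right_ne_zero_of_mul hx')⟩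
      · rintro x ⟨hx1, hx2⟩
        have hp : 0 < 1 / ((n : ℝ) + 1) := by positivity
        simp only [mem_ofPred_eq] at hx1 hx2
        rw [abs_le] at hx1 hx2
        rw [mem_sq]
        refine ⟨⟨?_, ?_⟩, ⟨?_, ?_⟩⟩ <;> linarith
    have hadm : ∀ n, Adm τ (fun x => φ n x • ((k / 2) • f x)) := by
      intro n
      refine Adm.mk' ((hφ n).smul (h1.const_smul _)) (hsupp n) (fun x v => ?_)
      have hb : ∀ t : ℝ, |t| ≤ 1 → |φ n x * t| ≤ 1 := fun t ht => by
        rw [abs_mul]; exact mul_le_one₀ (hφ1 n x) (abs_nonneg _) ht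
      have := small_adm hk hkl (w := (φ n x * (f x).1, φ n x * (f x).2)) (hb _ (hfb x).1) (hb _ (hfb x).2) v
      simp only [Prod.smul_fst, Prod.smul_snd, smul_eq_mul]
      simp only at this
      linarith
    have hfin : IsFiniteMeasure (volume.restrict E) := ⟨by simpa using volume_lt_top_of_subset hE⟩
    have hstep : ∀ n, ∫ x in E, φ n x * div2 f x ≤ c / (k / 2) + 4 * C := by
      intro n
      set r : ℝ × ℝ → ℝ := fun x => fderiv ℝ (φ n) x (1, 0) * (f x).1 + fderiv ℝ (φ n) x (0, 1) * (f x).2 with hr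
      have hrb : ∀ x, |r x| ≤ |deriv (T n) x.1| * 1 + 1 * |deriv (T n) x.2| := by
        intro x
        simp only [hr]
        rw [(hφd n x).fderiv]
        simp only [add_apply, smul_apply,
          ContinuousLinearMap.coe_fst', ContinuousLinearMap.coe_snd', smul_eq_mul, mul_zero, mul_one,
          zero_add, add_zero]
        refine (abs_add_le _ _).trans (add_le_add ?_ ?_)
        · rw [abs_mul, abs_mul, abs_of_nonneg (hT0 n x.2)]
          refine le_trans ?_ (mul_one _).le
          exact mul_le_mul (mul_le_of_le_one_left (abs_nonneg _) (hT1 _ _)) (hfb x).1 (abs_nonneg _) (abs_nonneg _)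
        · rw [abs_mul, abs_mul, abs_of_nonneg (hT0 n x.1), mul_comm, one_mul]
          refine (mul_le_of_le_one_left ?_ (hfb x).2).trans (mul_le_of_le_one_left (abs_nonneg _) (hT1 _ _))
          exact mul_nonneg (hT0 _ _) (abs_nonneg _)
      have hTd : Continuous (deriv (T n)) := (hT n).continuous_deriv (by simp)
      have hφdc : Continuous (fderiv ℝ (φ n)) := (hφ n).continuous_fderiv (by simp)
      have hrc : Continuous r :=
        ((hφdc.clm_apply continuous_const).mul h1.continuous.fst).add
          ((hφdc.clm_apply continuous_const).mul h1.continuous.snd)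
      have hri : IntegrableOn r Isq := hrc.continuousOn.integrableOn_compact isq_compact
      have i1 : IntegrableOn (fun x : ℝ × ℝ => |deriv (T n) x.1| * 1) Isq :=
        (by fun_prop : Continuous (fun x : ℝ × ℝ => |deriv (T n) x.1| * 1)).continuousOn.integrableOn_compact isq_compact
      have i2 : IntegrableOn (fun x : ℝ × ℝ => 1 * |deriv (T n) x.2|) Isq :=
        (by fun_prop : Continuous (fun x : ℝ × ℝ => 1 * |deriv (T n) x.2|)).continuousOn.integrableOn_compact isq_compact
      have hle1 : ∫ s in Icc (-1:ℝ) 1, |deriv (T n) s| ≤ C :=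
        (setIntegral_le_integral (hTi n) (Eventually.of_forall fun _ => abs_nonneg _)).trans (hTC n)
      have hv2 : ∫ _ in Icc (-1:ℝ) 1, (1:ℝ) = 2 := by simp; norm_num
      have hR : - ∫ x in E, r x ≤ 4 * C := by
        calc - ∫ x in E, r x ≤ ∫ x in E, |r x| := by
              rw [← integral_neg]
              exact integral_mono (hri.mono_set hE).neg (hri.mono_set hE).abs (fun x => neg_le_abs _)
          _ ≤ ∫ x in Isq, |r x| := setIntegral_mono_set hri.abs
              (Eventually.of_forall fun _ => abs_nonneg _) hE.eventuallyLE
          _ ≤ ∫ x in Isq, (|deriv (T n) x.1| * 1 + 1 * |deriv (T n) x.2|) :=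
              integral_mono hri.abs (i1.add i2) hrb
          _ = (∫ x in Isq, |deriv (T n) x.1| * 1) + ∫ x in Isq, 1 * |deriv (T n) x.2| :=
              integral_add i1 i2
          _ ≤ 4 * C := by
              rw [isq_eq, Measure.volume_eq_prod,
                setIntegral_prod_mul (fun s => |deriv (T n) s|) (fun _ => (1:ℝ)),
                setIntegral_prod_mul (fun _ => (1:ℝ)) (fun s => |deriv (T n) s|), hv2]
              linarith
      have h5 := h _ (hadm n)
      have h6 : ∀ x, div2 (fun x => φ n x • ((k / 2) • f x)) x = (k / 2) * (φ n x * div2 f x + r x) := by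
        intro x
        rw [div2_smul ((hφ n).differentiable (by simp)) (f := fun x => (k / 2) • f x) (hd.const_smul (k / 2)), div2_const_smul hd]
        simp [hr]; ring
      simp_rw [h6] at h5
      rw [integral_const_mul, integral_add ?_ (hri.mono_set hE)] at h5
      · have h7 : (∫ x in E, φ n x * div2 f x) + ∫ x in E, r x ≤ c / (k / 2) := by
          rw [le_div_iff₀ (by positivity)]; linarith
        linarith
      · exact (((hφ n).continuous.mul (div2_continuous h1)).continuousOn.integrableOn_compact isq_compact).mono_set hE
    refine le_of_tendsto (tendsto_integral_set_bdd (volume_lt_top_of_subset hE) M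
      (fun n => ?_) (fun n x => ?_) ?_) (Eventually.of_forall hstep)
    · exact ((hφ n).continuous.mul (div2_continuous h1)).aestronglyMeasurable
    · rw [abs_mul]
      calc |φ n x| * |div2 f x| ≤ 1 * M := by
            refine mul_le_mul (hφ1 n x) (hM x) (abs_nonneg _) zero_le_one
        _ = M := one_mul _
    · filter_upwards [ae_mem_sq hE] with x hx
      rw [mem_sq] at hx
      have := ((hTl x.1 (abs_lt.2 hx.1)).mul (hTl x.2 (abs_lt.2 hx.2))).mul_const (div2 f x)
      simpa [φ] using this
  exact ne_top_of_le_ne_top ENNReal.ofReal_ne_top key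

/-! ### Half-plane competitors -/

lemma S_deriv_nonneg (x : ℝ) : 0 ≤ deriv Real.smoothTransition x :=
  Real.smoothTransition.monotone.deriv_nonneg

lemma S_integral_abs : ∫ s, |deriv Real.smoothTransition s| = 1 := by
  simp_rw [abs_of_nonneg (S_deriv_nonneg _)]
  rw [← setIntegral_eq_integral_of_forall_compl_eq_zero (s := Icc (0:ℝ) 1)
    (fun x hx => S_deriv_zero hx), integral_Icc_eq_integral_Ioc,
    ← intervalIntegral.integral_of_le zero_le_one,
    intervalIntegral.integral_deriv_eq_sub
      (fun x _ => (Real.smoothTransition.contDiff (n := 1)).differentiable (by simp) x)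
      (S_deriv_continuous.intervalIntegrable _ _)]
  simp [Real.smoothTransition.one, Real.smoothTransition.zero]

/-- integration by parts with a smooth weight -/
lemma integral_smul_div2 {φ : ℝ × ℝ → ℝ} {f : ℝ × ℝ → ℝ × ℝ} (hφ : ContDiff ℝ (⊤ : ℕ∞) φ)
    (hf : ContDiff ℝ (⊤ : ℕ∞) f) (hc : HasCompactSupport f) :
    ∫ x, φ x * div2 f x = - ∫ x, (fderiv ℝ φ x (1, 0) * (f x).1 + fderiv ℝ φ x (0, 1) * (f x).2) := by
  have h0 := integral_div2_zero (hφ.smul hf) (hc.smul_left (f := φ))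
  have hdc : Continuous (fderiv ℝ φ) := hφ.continuous_fderiv (by simp)
  have hcd := div2_continuous hf
  have i1 : Integrable (fun x => φ x * div2 f x) :=
    (hφ.continuous.mul hcd).integrable_of_hasCompactSupport
      ((div2_hasCompactSupport hc).mul_left)
  have i2 : Integrable (fun x => fderiv ℝ φ x (1, 0) * (f x).1 + fderiv ℝ φ x (0, 1) * (f x).2) := by
    refine Continuous.integrable_of_hasCompactSupport
      (((hdc.clm_apply continuous_const).mul hf.continuous.fst).add
          ((hdc.clm_apply continuous_const).mul hf.continuous.snd)) ?_
    refine HasCompactSupport.intro hc (fun x hx => ?_)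
    rw [image_eq_zero_of_notMem_tsupport hx]; simp
  have h1 : ∀ x, div2 (fun x => φ x • f x) x = _ :=
    fun x => div2_smul (hφ.differentiable (by simp)) (hf.differentiable (by simp)) x
  have h2 : ∫ x, div2 (fun x => φ x • f x) x = 0 := h0
  simp_rw [h1] at h2
  rw [integral_add i1 i2] at h2
  linarith

/-- clamp -/
def hcl (ν s x : ℝ) : ℝ := max (-1) (min 1 (s - ν * x))

def hset (ν s : ℝ) : Set (ℝ × ℝ) := regionBetween (fun _ => (-1:ℝ)) (hcl ν s) (Icc (-1) 1)

lemma hset_subset (ν s : ℝ) : hset ν s ⊆ Isq := by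
  rintro x ⟨h1, h2, h3⟩
  rw [mem_isq]
  refine ⟨h1, h2.le, h3.le.trans ?_⟩
  exact max_le (by norm_num) (min_le_left _ _)

lemma hcl_cont (ν : ℝ) : Continuous (Function.uncurry (hcl ν)) := by
  unfold hcl Function.uncurry; fun_prop

lemma hset_measurable (ν s : ℝ) : MeasurableSet (hset ν s) :=
  measurableSet_regionBetween measurable_const
    (by unfold hcl; fun_prop) measurableSet_Icc

lemma hset_volume (ν s : ℝ) : volume.real (hset ν s) = ∫ x in Icc (-1:ℝ) 1, (hcl ν s x + 1) := by
  have hc : Continuous (hcl ν s) := by unfold hcl; fun_prop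
  have h0 : ∀ x, -1 ≤ hcl ν s x := fun x => le_max_left _ _
  unfold Measure.real hset
  rw [Measure.volume_eq_prod, volume_regionBetween_eq_integral
    (continuous_const.continuousOn.integrableOn_compact isCompact_Icc)
    (hc.continuousOn.integrableOn_compact isCompact_Icc) measurableSet_Icc (fun x _ => h0 x),
    ENNReal.toReal_ofReal]
  · refine integral_congr_ae (Eventually.of_forall fun x => ?_)
    simp
  · exact integral_nonneg (fun x => by simp; linarith [h0 x])

lemma exists_hset_volume (ν : ℝ) {a : ℝ} (ha : a ∈ Icc (0:ℝ) 4) :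
    ∃ s, volume.real (hset ν s) = a := by
  have hcont : Continuous (fun s => ∫ x in Icc (-1:ℝ) 1, (hcl ν s x + 1)) :=
    continuous_parametric_integral_of_continuous (f := fun s x => hcl ν s x + 1)
      (by have := hcl_cont ν; unfold Function.uncurry at *; fun_prop) isCompact_Icc
  have hb : ∀ x ∈ Icc (-1:ℝ) 1, |ν * x| ≤ |ν| := fun x hx => by
    rw [abs_mul]; exact mul_le_of_le_one_right (abs_nonneg _) (abs_le.2 hx)
  have h0 : ∫ x in Icc (-1:ℝ) 1, (hcl ν (-1 - |ν|) x + 1) = 0 := by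
    rw [setIntegral_congr_fun (g := fun _ => 0) measurableSet_Icc]
    · simp
    · intro x hx
      have := abs_le.1 (hb x hx)
      simp only [hcl]
      rw [min_eq_right (by linarith [abs_nonneg ν]), max_eq_left (by linarith)]; norm_num
  have h1 : ∫ x in Icc (-1:ℝ) 1, (hcl ν (1 + |ν|) x + 1) = 4 := by
    rw [setIntegral_congr_fun (g := fun _ => 2) measurableSet_Icc]
    · simp; norm_num
    · intro x hx
      have := abs_le.1 (hb x hx)
      simp only [hcl]
      rw [min_eq_left (by linarith [abs_nonneg ν]), max_eq_right (by linarith)]; norm_num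
  have hle : -1 - |ν| ≤ 1 + |ν| := by linarith [abs_nonneg ν]
  obtain ⟨s, -, hs⟩ := intermediate_value_Icc hle hcont.continuousOn (by rw [h0, h1]; exact ha)
  exact ⟨s, by rw [hset_volume]; exact hs⟩

lemma hset_EB {τ : ℝ × ℝ → ℝ} (hτ : IsNorm2 τ) (ν s : ℝ) : EB τ (hset ν s) (2 * τ (ν, 1)) := by
  intro f hf
  obtain ⟨M, hM0, hM⟩ := exists_bound (div2_continuous hf.1) (div2_hasCompactSupport hf.2.1)
  let θ : ℕ → ℝ × ℝ → ℝ := fun n x => Real.smoothTransition (((n:ℝ) + 1) * (s - ν * x.1 - x.2))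
  have hθ : ∀ n, ContDiff ℝ (⊤ : ℕ∞) (θ n) := fun n =>
    (Real.smoothTransition.contDiff (n := ⊤)).comp (by fun_prop)
  have hθd : ∀ n x, HasFDerivAt (θ n) ((deriv Real.smoothTransition (((n:ℝ) + 1) * (s - ν * x.1 - x.2))) •
      (((n:ℝ) + 1) • ((-(ν • ContinuousLinearMap.fst ℝ ℝ ℝ)) - ContinuousLinearMap.snd ℝ ℝ ℝ))) x := by
    intro n x
    have a1 : HasFDerivAt (fun x : ℝ × ℝ => ((n:ℝ) + 1) * (s - ν * x.1 - x.2))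
        (((n:ℝ) + 1) • ((-(ν • ContinuousLinearMap.fst ℝ ℝ ℝ)) - ContinuousLinearMap.snd ℝ ℝ ℝ)) x := by
      exact (((hasFDerivAt_fst.const_mul ν).const_sub s).sub hasFDerivAt_snd).const_mul _
    exact ((Real.smoothTransition.contDiff (n := 1)).differentiable (by simp) _).hasDerivAt.comp_hasFDerivAt x a1
  have hz : ∀ x, x ∉ Isq → f x = 0 := fun x hx =>
    image_eq_zero_of_notMem_tsupport (fun h => hx (sq_subset_isq (hf.2.2.1 h)))
  have hstep : ∀ n, ∫ x in Isq, θ n x * div2 f x ≤ 2 * τ (ν, 1) := by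
    intro n
    set m : ℝ := (n:ℝ) + 1 with hm
    have hmp : 0 < m := by positivity
    set D : ℝ × ℝ → ℝ := fun x => m * deriv Real.smoothTransition (m * (s - ν * x.1 - x.2)) with hD
    have hDc : Continuous D := by
      have := S_deriv_continuous
      simp only [hD]; fun_prop
    have hD0 : ∀ x, 0 ≤ D x := fun x => mul_nonneg hmp.le (S_deriv_nonneg _)
    have e1 := integral_smul_div2 (hθ n) hf.1 hf.2.1
    rw [← setIntegral_eq_integral_of_forall_compl_eq_zero (s := Isq)
      (fun x hx => by rw [div2_zero_of_notMem (fun h => hx (sq_subset_isq (hf.2.2.1 h))), mul_zero])] at e1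
    rw [e1, ← setIntegral_eq_integral_of_forall_compl_eq_zero (s := Isq)
      (fun x hx => by rw [hz x hx]; simp), ← integral_neg]
    have hpt : ∀ x, -(fderiv ℝ (θ n) x (1, 0) * (f x).1 + fderiv ℝ (θ n) x (0, 1) * (f x).2)
        ≤ τ (ν, 1) * D x := by
      intro x
      rw [(hθd n x).fderiv]
      simp only [smul_apply, sub_apply, neg_apply,
          ContinuousLinearMap.coe_fst', ContinuousLinearMap.coe_snd', smul_eq_mul]
      have := mul_le_mul_of_nonneg_left (hf.2.2.2 x (ν, 1)) (hD0 x)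
      simp only [hD] at this ⊢
      linarith
    have hdc : Continuous (fderiv ℝ (θ n)) := (hθ n).continuous_fderiv (by simp)
    have hDi : IntegrableOn D Isq := hDc.continuousOn.integrableOn_compact isq_compact
    refine (integral_mono ?_ ?_ hpt).trans ?_
    · have : Continuous (fun x => -(fderiv ℝ (θ n) x (1, 0) * (f x).1 + fderiv ℝ (θ n) x (0, 1) * (f x).2)) :=
        ((((hdc.clm_apply continuous_const).mul hf.1.continuous.fst).add
          ((hdc.clm_apply continuous_const).mul hf.1.continuous.snd))).neg
      exact this.continuousOn.integrableOn_compact isq_compact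
    · exact hDi.const_mul _
    · rw [integral_const_mul, mul_comm]
      refine mul_le_mul_of_nonneg_right ?_ (hτ.nonneg _)
      rw [isq_eq, Measure.volume_eq_prod, setIntegral_prod _ (by rw [isq_eq] at hDi; exact hDi)]
      have hin : ∀ x, ∫ y in Icc (-1:ℝ) 1, D (x, y) ≤ 1 := by
        intro x
        have hne : -m ≠ 0 := by linarith [hmp]
        have h3 := S_comp_integral hne (m * (s - ν * x))
        rw [S_integral_abs] at h3
        have h4 : ∀ y, D (x, y) = |(-m) * deriv Real.smoothTransition ((-m) * y + m * (s - ν * x))| := by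
          intro y
          rw [abs_mul, abs_neg, abs_of_pos hmp, abs_of_nonneg (S_deriv_nonneg _)]
          simp only [hD]; congr 2; ring
        simp_rw [h4]
        rw [← h3.2]
        exact setIntegral_le_integral h3.1 (Eventually.of_forall fun _ => abs_nonneg _)
      have hci : Continuous (fun x => ∫ y in Icc (-1:ℝ) 1, D (x, y)) :=
        continuous_parametric_integral_of_continuous (f := fun x y => D (x, y))
          (by unfold Function.uncurry; fun_prop) isCompact_Icc
      refine (integral_mono (hci.continuousOn.integrableOn_compact isCompact_Icc)
        (g := fun _ => (1:ℝ)) (by simp) hin).trans ?_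
      simp; norm_num
  have heq : ∫ x in hset ν s, div2 f x
      = ∫ x in Isq, indicator {x : ℝ × ℝ | x.2 < s - ν * x.1} 1 x * div2 f x := by
    rw [← integral_indicator (hset_measurable ν s), ← integral_indicator isq_measurable]
    congr 1
    ext x
    by_cases hx : x ∈ Sq
    · rw [indicator_of_mem (sq_subset_isq hx)]
      rw [mem_sq] at hx
      have hiff : x ∈ hset ν s ↔ x.2 < s - ν * x.1 := by
        unfold hset regionBetween hcl
        simp only [mem_ofPred_eq, mem_Ioo, mem_Icc, lt_max_iff, lt_min_iff]
        constructor
        · rintro ⟨-, -, h | h⟩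
          · linarith
          · exact h.2
        · intro h
          exact ⟨⟨hx.1.1.le, hx.1.2.le⟩, hx.2.1, Or.inr ⟨hx.2.2, h⟩⟩
      by_cases hh : x.2 < s - ν * x.1
      · rw [indicator_of_mem (hiff.2 hh), indicator_of_mem (by exact hh)]; simp
      · rw [indicator_of_notMem (fun h => hh (hiff.1 h)), indicator_of_notMem (by exact hh)]; simp
    · have : div2 f x = 0 := div2_zero_of_notMem (fun h => hx (hf.2.2.1 h))
      classical
      rw [indicator_apply, indicator_apply, this, mul_zero, ite_self, ite_self]
  rw [heq]
  refine le_of_tendsto (tendsto_integral_set_bdd (volume_lt_top_of_subset subset_rfl) M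
      (fun n => ?_) (fun n x => ?_) (Eventually.of_forall fun x => ?_)) (Eventually.of_forall hstep)
  · exact ((hθ n).continuous.mul (div2_continuous hf.1)).aestronglyMeasurable
  · rw [abs_mul, abs_of_nonneg (Real.smoothTransition.nonneg _)]
    exact (mul_le_of_le_one_left (abs_nonneg _) (Real.smoothTransition.le_one _)).trans (hM x)
  · refine Tendsto.mul_const _ ?_
    by_cases hh : x.2 < s - ν * x.1
    · rw [indicator_of_mem (by exact hh)]
      have hp : 0 < s - ν * x.1 - x.2 := by linarith
      obtain ⟨N, hN⟩ := exists_nat_gt (1 / (s - ν * x.1 - x.2))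
      rw [div_lt_iff₀ hp] at hN
      refine tendsto_const_nhds.congr' ?_
      filter_upwards [eventually_ge_atTop N] with n hn
      have hn' : (N : ℝ) ≤ n := by exact_mod_cast hn
      exact (Real.smoothTransition.one_of_one_le (by nlinarith)).symm
    · rw [indicator_of_notMem (by exact hh)]
      refine tendsto_const_nhds.congr' (Eventually.of_forall fun n => ?_)
      refine (Real.smoothTransition.zero_of_nonpos ?_).symm
      have : (0:ℝ) < (n:ℝ) + 1 := by positivity
      nlinarith

/-! ### Cutting along a vertical line -/

/-- the closed strips to the right of `x0` -/
def strip (x0 : ℝ) (n : ℕ) : Set (ℝ × ℝ) := {x | x.1 ∈ Icc x0 (x0 + 1 / ((n:ℝ) + 1))}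

/-- negligible density of `G` next to the vertical line through `x0` -/
def Thin (G : Set (ℝ × ℝ)) (x0 : ℝ) : Prop :=
  Tendsto (fun n : ℕ => ((n:ℝ) + 1) * volume.real (G ∩ strip x0 n)) atTop (nhds 0)

lemma strip_measurable (x0 : ℝ) (n : ℕ) : MeasurableSet (strip x0 n) :=
  measurable_fst measurableSet_Icc

lemma tsupport_smul_sub (φ : ℝ × ℝ → ℝ) (f : ℝ × ℝ → ℝ × ℝ) :
    tsupport (fun x => φ x • f x) ⊆ tsupport f :=
  closure_mono (Function.support_smul_subset_right φ f)

lemma cut {τ : ℝ × ℝ → ℝ} {G : Set (ℝ × ℝ)} (hGm : MeasurableSet G) (hG : G ⊆ Isq) {c : ℝ}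
    (h : EB τ G c) {x0 : ℝ} (hx0 : x0 ∈ Ioo (-1:ℝ) 1) (hthin : Thin G x0)
    {fl fr : ℝ × ℝ → ℝ × ℝ}
    (hl : ContDiff ℝ (⊤ : ℕ∞) fl) (hlc : HasCompactSupport fl)
    (hls : ∀ x ∈ tsupport fl, -1 < x.1 ∧ -1 < x.2 ∧ x.2 < 1)
    (hlt : ∀ x v, v.1 * (fl x).1 + v.2 * (fl x).2 ≤ τ v)
    (hr : ContDiff ℝ (⊤ : ℕ∞) fr) (hrc : HasCompactSupport fr)
    (hrs : ∀ x ∈ tsupport fr, x.1 < 1 ∧ -1 < x.2 ∧ x.2 < 1)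
    (hrt : ∀ x v, v.1 * (fr x).1 + v.2 * (fr x).2 ≤ τ v) :
    (∫ x in G ∩ {x | x.1 ≤ x0}, div2 fl x) + ∫ x in G \ {x | x.1 ≤ x0}, div2 fr x ≤ c := by
  obtain ⟨C, hC0, hC⟩ := S_deriv_bound
  obtain ⟨Ml, hMl0, hMl⟩ := exists_bound (div2_continuous hl) (div2_hasCompactSupport hlc)
  obtain ⟨Mr, hMr0, hMr⟩ := exists_bound (div2_continuous hr) (div2_hasCompactSupport hrc)
  obtain ⟨Kl, hKl0, hKl⟩ := exists_bound hl.continuous.fst (hlc.comp_left (g := Prod.fst) rfl)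
  obtain ⟨Kr, hKr0, hKr⟩ := exists_bound hr.continuous.fst (hrc.comp_left (g := Prod.fst) rfl)
  have hld : Differentiable ℝ fl := hl.differentiable (by simp)
  have hrd : Differentiable ℝ fr := hr.differentiable (by simp)
  have hlcd := div2_continuous hl
  have hrcd := div2_continuous hr
  let χ : ℕ → ℝ × ℝ → ℝ := fun n x => Real.smoothTransition (((n:ℝ) + 1) * x.1 + (-((n:ℝ) + 1) * x0))
  have hχ : ∀ n, ContDiff ℝ (⊤ : ℕ∞) (χ n) := fun n =>
    (Real.smoothTransition.contDiff (n := ⊤)).comp (by fun_prop)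
  have hχ' : ∀ n, ContDiff ℝ (⊤ : ℕ∞) (fun x => 1 - χ n x) := fun n => contDiff_const.sub (hχ n)
  have hχ0 : ∀ n x, 0 ≤ χ n x := fun n x => Real.smoothTransition.nonneg _
  have hχ1 : ∀ n x, χ n x ≤ 1 := fun n x => Real.smoothTransition.le_one _
  have hχd : ∀ n x, HasFDerivAt (χ n) ((((n:ℝ) + 1) * deriv Real.smoothTransition
      (((n:ℝ) + 1) * x.1 + (-((n:ℝ) + 1) * x0))) • ContinuousLinearMap.fst ℝ ℝ ℝ) x := fun n x =>
    (S_comp_deriv ((n:ℝ) + 1) (-((n:ℝ) + 1) * x0) x.1).comp_hasFDerivAt x hasFDerivAt_fst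
  have hχz : ∀ (n : ℕ) (x : ℝ × ℝ), x.1 ≤ x0 → χ n x = 0 := fun n x hx =>
    Real.smoothTransition.zero_of_nonpos (by
      have : (0:ℝ) < (n:ℝ) + 1 := by positivity
      nlinarith)
  have hχo : ∀ (n : ℕ) (x : ℝ × ℝ), x0 + 1 / ((n:ℝ) + 1) ≤ x.1 → χ n x = 1 := fun n x hx =>
    Real.smoothTransition.one_of_one_le (by
      have : (0:ℝ) < (n:ℝ) + 1 := by positivity
      have h2 : 1 / ((n:ℝ) + 1) ≤ x.1 - x0 := by linarith
      rw [div_le_iff₀ this] at h2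
      linarith)
  let F : ℕ → ℝ × ℝ → ℝ × ℝ := fun n x => (1 - χ n x) • fl x + χ n x • fr x
  let r : ℕ → ℝ × ℝ → ℝ := fun n x => (((n:ℝ) + 1) * deriv Real.smoothTransition
      (((n:ℝ) + 1) * x.1 + (-((n:ℝ) + 1) * x0))) * ((fr x).1 - (fl x).1)
  have hdiv : ∀ n x, div2 (F n) x = ((1 - χ n x) * div2 fl x + χ n x * div2 fr x) + r n x := by
    intro n x
    have e0 : fderiv ℝ (fun x => 1 - χ n x) x = - fderiv ℝ (χ n) x := by
      rw [fderiv_const_sub]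
    simp only [F]
    rw [div2_add (f := fun x => (1 - χ n x) • fl x) (g := fun x => χ n x • fr x) (((hχ' n).differentiable (by simp)).smul hld) (((hχ n).differentiable (by simp)).smul hrd),
      div2_smul ((hχ' n).differentiable (by simp)) hld, div2_smul ((hχ n).differentiable (by simp)) hrd,
      e0, (hχd n x).fderiv]
    simp [r]; ring
  have hfin : IsFiniteMeasure (volume.restrict G) := ⟨by simpa using volume_lt_top_of_subset hG⟩
  -- main term
  have hmain : Tendsto (fun n => ∫ x in G, ((1 - χ n x) * div2 fl x + χ n x * div2 fr x)) atTop
      (nhds (∫ x in G, indicator {x : ℝ × ℝ | x.1 ≤ x0} (div2 fl) x +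
        indicator {x : ℝ × ℝ | x.1 ≤ x0}ᶜ (div2 fr) x)) := by
    refine tendsto_integral_set_bdd (volume_lt_top_of_subset hG) (Ml + Mr) (fun n => ?_)
      (fun n x => ?_) (Eventually.of_forall fun x => ?_)
    · have := (hχ n).continuous
      exact (by fun_prop : Continuous fun x => ((1 - χ n x) * div2 fl x + χ n x * div2 fr x)).aestronglyMeasurable
    · refine (abs_add_le _ _).trans (add_le_add ?_ ?_)
      · rw [abs_mul, abs_of_nonneg (by linarith [hχ1 n x])]
        exact (mul_le_of_le_one_left (abs_nonneg _) (by linarith [hχ0 n x])).trans (hMl x)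
      · rw [abs_mul, abs_of_nonneg (hχ0 n x)]
        exact (mul_le_of_le_one_left (abs_nonneg _) (hχ1 n x)).trans (hMr x)
    · by_cases hx : x.1 ≤ x0
      · rw [indicator_of_mem (by exact hx), indicator_of_notMem (by simpa using hx)]
        simp [hχz _ x hx]
      · rw [indicator_of_notMem (by exact hx), indicator_of_mem (by simpa using hx)]
        have hx' := not_le.1 hx
        refine tendsto_const_nhds.congr' ?_
        obtain ⟨N, hN⟩ := exists_nat_one_div_lt (sub_pos.2 hx')
        filter_upwards [eventually_ge_atTop N] with n hn
        have := Nat.one_div_le_one_div (α := ℝ) hn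
        rw [hχo n x (by linarith)]; ring
  have hrcont : ∀ n, Continuous (r n) := fun n => by
    have h1 := S_deriv_continuous
    have h2 := hl.continuous
    have h3 := hr.continuous
    simp only [r]; fun_prop
  have herr : Tendsto (fun n => ∫ x in G, r n x) atTop (nhds 0) := by
    have hb : ∀ n, |∫ x in G, r n x| ≤ (C * (Kr + Kl)) * (((n:ℝ) + 1) * volume.real (G ∩ strip x0 n)) := by
      intro n
      have hp : (0:ℝ) < (n:ℝ) + 1 := by positivity
      have e1 : ∫ x in G, r n x = ∫ x in G ∩ strip x0 n, r n x := by
        refine setIntegral_eq_of_subset_of_forall_sdiff_eq_zero hGm inter_subset_left (fun x hx => ?_)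
        have hx2 : x ∉ strip x0 n := fun h => hx.2 ⟨hx.1, h⟩
        simp only [r]
        rw [S_deriv_zero, mul_zero, zero_mul]
        rintro ⟨ha, hb⟩
        refine hx2 ⟨?_, ?_⟩
        · by_contra hh; push Not at hh; nlinarith
        · have : x.1 - x0 ≤ 1 / ((n:ℝ) + 1) := by
            rw [le_div_iff₀ hp]; linarith
          linarith
      rw [e1]
      have := norm_setIntegral_le_of_norm_le_const (μ := volume) (s := G ∩ strip x0 n) (f := r n)
        (C := ((n:ℝ) + 1) * C * (Kr + Kl)) (volume_lt_top_of_subset (inter_subset_left.trans hG))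
        (fun x _ => by
          simp only [r]
          rw [norm_mul, norm_mul, Real.norm_eq_abs, Real.norm_eq_abs, Real.norm_eq_abs, abs_of_pos hp]
          refine mul_le_mul (mul_le_mul_of_nonneg_left (hC _) hp.le) ?_ (abs_nonneg _) (by positivity)
          exact (abs_sub _ _).trans (add_le_add (hKr x) (hKl x)))
      refine this.trans (le_of_eq ?_)
      ring
    refine squeeze_zero_norm hb ?_
    simpa using hthin.const_mul (C * (Kr + Kl))
  have hsum := hmain.add herr
  rw [add_zero] at hsum
  have heq : (∫ x in G, indicator {x : ℝ × ℝ | x.1 ≤ x0} (div2 fl) x +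
        indicator {x : ℝ × ℝ | x.1 ≤ x0}ᶜ (div2 fr) x) =
      (∫ x in G ∩ {x | x.1 ≤ x0}, div2 fl x) + ∫ x in G \ {x | x.1 ≤ x0}, div2 fr x := by
    have hms : MeasurableSet {x : ℝ × ℝ | x.1 ≤ x0} := measurableSet_le measurable_fst measurable_const
    rw [integral_add, setIntegral_indicator hms, setIntegral_indicator hms.compl]
    · rfl
    · exact (div2_integrable hl hlc).integrableOn.indicator hms
    · exact (div2_integrable hr hrc).integrableOn.indicator hms.compl
  rw [← heq]
  refine le_of_tendsto hsum ?_
  obtain ⟨N, hN⟩ := exists_nat_one_div_lt (sub_pos.2 hx0.2)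
  filter_upwards [eventually_ge_atTop N] with n hn
  have hn2 := (Nat.one_div_le_one_div (α := ℝ) hn).trans_lt hN
  have hadm : Adm τ (F n) := by
    refine Adm.mk' (((hχ' n).smul hl).add ((hχ n).smul hr)) ?_ (fun x v => ?_)
    · refine (tsupport_add _ _).trans (union_subset ?_ ?_)
      · intro x hx
        have h1 := hls x (tsupport_smul_sub _ _ hx)
        have h2 : x.1 ≤ x0 + 1 / ((n:ℝ) + 1) := by
          have hcl : IsClosed {x : ℝ × ℝ | x.1 ≤ x0 + 1 / ((n:ℝ) + 1)} :=
            isClosed_le (by fun_prop) (by fun_prop)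
          refine closure_minimal ?_ hcl hx
          intro y hy
          by_contra hh
          simp only [mem_ofPred_eq] at hh
          exact hy (by simp [hχo n y (not_le.1 hh).le])
        rw [mem_sq]
        refine ⟨⟨h1.1, by linarith⟩, h1.2⟩
      · intro x hx
        have h1 := hrs x (tsupport_smul_sub _ _ hx)
        have h2 : x0 ≤ x.1 := by
          have hcl : IsClosed {x : ℝ × ℝ | x0 ≤ x.1} :=
            isClosed_le (by fun_prop) (by fun_prop)
          refine closure_minimal ?_ hcl hx
          intro y hy
          by_contra hh
          simp only [mem_ofPred_eq] at hh
          exact hy (by simp [hχz n y (not_le.1 hh).le])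
        rw [mem_sq]
        refine ⟨⟨by linarith [hx0.1], h1.1⟩, h1.2⟩
    · have a1 := mul_le_mul_of_nonneg_left (hlt x v) (sub_nonneg.2 (hχ1 n x))
      have a2 := mul_le_mul_of_nonneg_left (hrt x v) (hχ0 n x)
      simp only [F, Prod.fst_add, Prod.snd_add, Prod.smul_fst, Prod.smul_snd, smul_eq_mul]
      linarith
  have h9 := h _ hadm
  simp_rw [hdiv] at h9
  rw [integral_add] at h9
  · exact h9
  · have := (hχ n).continuous
    exact ((by fun_prop : Continuous fun x => ((1 - χ n x) * div2 fl x + χ n x * div2 fr x)).continuousOn.integrableOn_compact isq_compact).mono_set hG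
  · exact ((hrcont n).continuousOn.integrableOn_compact isq_compact).mono_set hG

lemma ae_thin {G : Set (ℝ × ℝ)} (hGm : MeasurableSet G) (hG : G ⊆ Isq) {X : Set ℝ}
    (hXm : MeasurableSet X) (hX : ∀ x ∈ X, volume (Prod.mk x ⁻¹' G) = 0) :
    ∀ᵐ x0 ∂(volume.restrict X), Thin G x0 := by
  filter_upwards [Besicovitch.ae_tendsto_measure_inter_div (volume : Measure ℝ) X] with x0 hx0
  have hle : ∀ n : ℕ, ((n:ℝ) + 1) * volume.real (G ∩ strip x0 n) ≤
      4 * (1 - (volume (X ∩ Metric.closedBall x0 (1 / ((n:ℝ) + 1))) /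
        volume (Metric.closedBall x0 (1 / ((n:ℝ) + 1)))).toReal) := by
    intro n
    have hp : (0:ℝ) < (n:ℝ) + 1 := by positivity
    set R : ℝ := 1 / ((n:ℝ) + 1) with hR
    have hRp : 0 < R := by positivity
    set B := Metric.closedBall x0 R with hB
    have hvB : volume B = ENNReal.ofReal (2 * R) := Real.volume_closedBall x0 R
    have h1 : volume (G ∩ strip x0 n) ≤ 2 * volume (B \ X) := by
      rw [Measure.volume_eq_prod, Measure.prod_apply (hGm.inter (strip_measurable x0 n))]
      calc ∫⁻ x, volume (Prod.mk x ⁻¹' (G ∩ strip x0 n))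
          ≤ ∫⁻ x, (B \ X).indicator (fun _ => 2) x := by
            refine lintegral_mono (fun x => ?_)
            by_cases hx : x ∈ B \ X
            · rw [indicator_of_mem hx]
              refine (measure_mono (t := Icc (-1:ℝ) 1) ?_).trans ?_
              · intro y hy
                have := hG hy.1
                rw [mem_isq] at this
                exact this.2
              · rw [Real.volume_Icc]; norm_num
            · rw [indicator_of_notMem hx]
              refine le_of_eq ?_
              by_cases hxX : x ∈ X
              · exact measure_mono_null (fun y hy => hy.1) (hX x hxX)
              · have hxB : x ∉ B := fun h => hx ⟨h, hxX⟩
                convert measure_empty (μ := (volume : Measure ℝ))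
                rw [eq_empty_iff_forall_notMem]
                intro y hy
                have h3 : x ∈ Icc x0 (x0 + 1 / ((n:ℝ) + 1)) := hy.2
                apply hxB
                rw [hB, Real.closedBall_eq_Icc]
                exact ⟨by linarith [h3.1], h3.2⟩
        _ = 2 * volume (B \ X) := by
            rw [lintegral_indicator_const (Metric.isClosed_closedBall.measurableSet.diff hXm)]
    have hBfin : volume B ≠ ⊤ := by rw [hvB]; exact ENNReal.ofReal_ne_top
    have h2 : volume.real (G ∩ strip x0 n) ≤ 2 * volume.real (B \ X) := by
      have := ENNReal.toReal_mono (ENNReal.mul_ne_top (by norm_num)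
        (ne_top_of_le_ne_top hBfin (measure_mono sdiff_subset))) h1
      simpa [Measure.real] using this
    have h3 : volume.real (B \ X) = 2 * R - volume.real (X ∩ B) := by
      have := measureReal_sdiff_add_inter (μ := (volume : Measure ℝ)) (s := B) (t := X) hXm hBfin
      rw [inter_comm] at this
      have hvB' : volume.real B = 2 * R := by
        rw [Measure.real, hvB, ENNReal.toReal_ofReal (by positivity)]
      linarith
    have h4 : (volume (X ∩ B) / volume B).toReal = volume.real (X ∩ B) / (2 * R) := by
      rw [ENNReal.toReal_div, hvB, ENNReal.toReal_ofReal (by positivity)]; rfl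
    rw [h4]
    have h5 : ((n:ℝ) + 1) = 1 / R := by rw [hR]; field_simp
    rw [h5]
    calc 1 / R * volume.real (G ∩ strip x0 n) ≤ 1 / R * (2 * (2 * R - volume.real (X ∩ B))) := by
          gcongr; linarith
      _ = _ := by field_simp; ring
  have hlim : Tendsto (fun n : ℕ => 4 * (1 - (volume (X ∩ Metric.closedBall x0 (1 / ((n:ℝ) + 1))) /
        volume (Metric.closedBall x0 (1 / ((n:ℝ) + 1)))).toReal)) atTop (nhds 0) := by
    have ht : Tendsto (fun n : ℕ => 1 / ((n:ℝ) + 1)) atTop (nhdsWithin 0 (Ioi 0)) :=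
      tendsto_nhdsWithin_iff.2 ⟨tendsto_one_div_add_atTop_nhds_zero_nat,
        Eventually.of_forall fun n => by simp only [mem_Ioi]; positivity⟩
    have h1 := (ENNReal.tendsto_toReal one_ne_top).comp (hx0.comp ht)
    have h2 := (h1.const_sub 1).const_mul 4
    simpa using h2
  exact squeeze_zero (fun n => by positivity) hle hlim

/-! ### Mollification and duality -/

/-- convolution -/
noncomputable def conv (k F : ℝ × ℝ → ℝ) (x : ℝ × ℝ) : ℝ := ∫ t, k t * F (x - t)

/-- mollifiers of radius `r` -/
structure Mol (ψ : ℝ × ℝ → ℝ) (r : ℝ) : Prop where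
  smooth : ContDiff ℝ (⊤ : ℕ∞) ψ
  cpt : HasCompactSupport ψ
  nonneg : ∀ t, 0 ≤ ψ t
  even : ∀ t, ψ (-t) = ψ t
  int : ∫ t, ψ t = 1
  supp : ∀ t, r ≤ ‖t‖ → ψ t = 0

lemma conv_eq (k F : ℝ × ℝ → ℝ) :
    conv k F = convolution k F (ContinuousLinearMap.lsmul ℝ ℝ) volume := by
  ext x; rfl

lemma conv_flip (k F : ℝ × ℝ → ℝ) (x : ℝ × ℝ) : conv k F x = ∫ z, k (x - z) * F z := by
  unfold conv
  rw [← integral_sub_left_eq_self (fun t => k t * F (x - t)) volume x]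
  simp

lemma conv_contDiff {k F : ℝ × ℝ → ℝ} (hk : ContDiff ℝ (⊤ : ℕ∞) k) (hc : HasCompactSupport k)
    (hF : Integrable F) : ContDiff ℝ (⊤ : ℕ∞) (conv k F) := by
  rw [conv_eq]
  exact hc.contDiff_convolution_left _ hk hF.locallyIntegrable

lemma conv_fderiv {k F : ℝ × ℝ → ℝ} (hk : ContDiff ℝ (⊤ : ℕ∞) k) (hc : HasCompactSupport k)
    (hF : Integrable F) (x v : ℝ × ℝ) :
    fderiv ℝ (conv k F) x v = conv (fun t => fderiv ℝ k t v) F x := by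
  have hk1 : ContDiff ℝ 1 k := hk.of_le (by exact_mod_cast le_top)
  have h := (hc.hasFDerivAt_convolution_left (ContinuousLinearMap.lsmul ℝ ℝ) hk1
    hF.locallyIntegrable (μ := volume) x).fderiv
  rw [conv_eq, h]
  have hex := (hc.fderiv ℝ).convolutionExists_left (ContinuousLinearMap.precompL (ℝ × ℝ) (ContinuousLinearMap.lsmul ℝ ℝ : ℝ →L[ℝ] ℝ →L[ℝ] ℝ))
    (hk1.continuous_fderiv (by simp)) hF.locallyIntegrable (μ := volume) x
  rw [convolution_def, ContinuousLinearMap.integral_apply hex]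
  rfl

lemma conv_dual {k F G : ℝ × ℝ → ℝ} (hk : Continuous k) {C : ℝ} (hC : ∀ x, |k x| ≤ C)
    (hodd : ∀ x, k (-x) = - k x) (hF : Integrable F) (hG : Integrable G) :
    ∫ x, G x * conv k F x = - ∫ z, F z * conv k G z := by
  have hI : Integrable (Function.uncurry (fun x z : ℝ × ℝ => G x * (k (x - z) * F z)))
      (volume.prod volume) := by
    have h1 := (hG.mul_prod hF).bdd_mul (c := C) (f := fun p : (ℝ × ℝ) × (ℝ × ℝ) => k (p.1 - p.2))
      (by exact (hk.comp (by fun_prop)).aestronglyMeasurable) (Eventually.of_forall fun p => hC _)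
    refine h1.congr (Eventually.of_forall fun p => ?_)
    simp only [Function.uncurry]; ring
  calc ∫ x, G x * conv k F x = ∫ x, ∫ z, G x * (k (x - z) * F z) := by
        simp_rw [conv_flip, integral_const_mul]
    _ = ∫ z, ∫ x, G x * (k (x - z) * F z) := integral_integral_swap hI
    _ = ∫ z, - (F z * conv k G z) := by
        congr 1; ext z
        rw [conv_flip, ← integral_const_mul, ← integral_neg]
        congr 1; ext x
        rw [← neg_sub x z, hodd]; ring
    _ = _ := integral_neg _

lemma Mol.fderiv_odd {ψ : ℝ × ℝ → ℝ} {r : ℝ} (h : Mol ψ r) (x v : ℝ × ℝ) :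
    fderiv ℝ ψ (-x) v = - fderiv ℝ ψ x v := by
  have hd : Differentiable ℝ ψ := h.smooth.differentiable (by simp)
  have h1 : HasFDerivAt (fun y => ψ (-y)) ((fderiv ℝ ψ (-x)).comp (-ContinuousLinearMap.id ℝ (ℝ × ℝ))) x :=
    (hd (-x)).hasFDerivAt.comp x (hasFDerivAt_id x).neg
  have h2 : (fun y => ψ (-y)) = ψ := funext h.even
  rw [h2] at h1
  rw [h1.fderiv]
  simp

lemma Mol.integrable {ψ : ℝ × ℝ → ℝ} {r : ℝ} (h : Mol ψ r) : Integrable ψ :=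
  h.smooth.continuous.integrable_of_hasCompactSupport h.cpt

lemma Mol.dual {ψ F G : ℝ × ℝ → ℝ} {r : ℝ} (h : Mol ψ r) (hF : Integrable F) (hG : Integrable G)
    (v : ℝ × ℝ) :
    ∫ x, G x * fderiv ℝ (conv ψ F) x v = - ∫ z, F z * fderiv ℝ (conv ψ G) z v := by
  have hk : Continuous (fun t => fderiv ℝ ψ t v) :=
    (h.smooth.continuous_fderiv (by simp)).clm_apply continuous_const
  obtain ⟨C, _, hC⟩ := exists_bound hk (h.cpt.fderiv_apply ℝ v)
  simp_rw [conv_fderiv h.smooth h.cpt hF, conv_fderiv h.smooth h.cpt hG]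
  exact conv_dual hk hC (fun x => h.fderiv_odd x v) hF hG

/-- bounded measurable functions -/
lemma Mol.int_conv {ψ F : ℝ × ℝ → ℝ} {r : ℝ} (h : Mol ψ r) (hF : Integrable F) (x : ℝ × ℝ) :
    Integrable (fun t => ψ t * F (x - t)) := by
  obtain ⟨C, _, hC⟩ := exists_bound h.smooth.continuous h.cpt
  exact (hF.comp_sub_left x).bdd_mul h.smooth.continuous.aestronglyMeasurable
    (Eventually.of_forall fun p => hC _)

lemma Mol.conv_le {ψ F : ℝ × ℝ → ℝ} {r : ℝ} (h : Mol ψ r) (hF : Integrable F) {c : ℝ}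
    {x : ℝ × ℝ} (hc : ∀ y, F y ≤ c) : conv ψ F x ≤ c := by
  have : ∫ t, ψ t * F (x - t) ≤ ∫ t, ψ t * c :=
    integral_mono (h.int_conv hF x) (h.integrable.mul_const c)
      (fun t => mul_le_mul_of_nonneg_left (hc _) (h.nonneg t))
  rw [integral_mul_const, h.int, one_mul] at this
  exact this

lemma Mol.conv_lin {ψ F1 F2 : ℝ × ℝ → ℝ} {r : ℝ} (h : Mol ψ r) (h1 : Integrable F1)
    (h2 : Integrable F2) (a b : ℝ) (x : ℝ × ℝ) :
    conv ψ (fun y => a * F1 y + b * F2 y) x = a * conv ψ F1 x + b * conv ψ F2 x := by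
  unfold conv
  rw [← integral_const_mul, ← integral_const_mul,
    ← integral_add ((h.int_conv h1 x).const_mul a) ((h.int_conv h2 x).const_mul b)]
  congr 1; ext t; ring

lemma Mol.conv_constraint {ψ F1 F2 : ℝ × ℝ → ℝ} {r : ℝ} (h : Mol ψ r) (h1 : Integrable F1)
    (h2 : Integrable F2) {v : ℝ × ℝ} {T : ℝ} (hT : ∀ y, v.1 * F1 y + v.2 * F2 y ≤ T) (x : ℝ × ℝ) :
    v.1 * conv ψ F1 x + v.2 * conv ψ F2 x ≤ T := by
  rw [← h.conv_lin h1 h2]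
  exact h.conv_le ((h1.const_mul _).add (h2.const_mul _)) hT

lemma Mol.conv_zero {ψ F : ℝ × ℝ → ℝ} {r : ℝ} (h : Mol ψ r) {x : ℝ × ℝ}
    (hF : ∀ y, ‖x - y‖ < r → F y = 0) : conv ψ F x = 0 := by
  unfold conv
  rw [← integral_zero (ℝ × ℝ) ℝ (μ := volume)]
  congr 1; ext t
  by_cases ht : r ≤ ‖t‖
  · rw [h.supp t ht, zero_mul]
  · rw [hF (x - t) (by simpa using ht), mul_zero]

/-- a mollifying sequence -/
lemma exists_mol : ∃ ψ : ℕ → ℝ × ℝ → ℝ, (∀ n : ℕ, Mol (ψ n) (1 / ((n:ℝ) + 1))) ∧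
    ∀ F : ℝ × ℝ → ℝ, Integrable F →
      ∀ᵐ x, Tendsto (fun n => conv (ψ n) F x) atTop (nhds (F x)) := by
  let b : ℕ → ContDiffBump (0 : ℝ × ℝ) := fun n =>
    ⟨1 / ((n:ℝ) + 1) / 2, 1 / ((n:ℝ) + 1), by positivity, half_lt_self (by positivity)⟩
  refine ⟨fun n => (b n).normed volume, fun n => ⟨(b n).contDiff_normed, (b n).hasCompactSupport_normed,
    fun t => (b n).nonneg_normed t, fun t => (b n).normed_neg t, (b n).integral_normed, fun t ht => ?_⟩, ?_⟩
  · rw [← Function.notMem_support, ContDiffBump.support_normed_eq]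
    simpa only [Metric.mem_ball, dist_zero_right, not_lt] using ht
  · intro F hF
    have := ContDiffBump.ae_convolution_tendsto_right_of_locallyIntegrable (φ := b) (K := 2)
      (μ := volume) (l := atTop) tendsto_one_div_add_atTop_nhds_zero_nat
      (Eventually.of_forall fun n => by show 1 / ((n:ℝ) + 1) ≤ 2 * (1 / ((n:ℝ) + 1) / 2); linarith)
      hF.locallyIntegrable
    exact this

/-- vector version of duality -/
lemma Mol.dual_div {ψ F1 F2 : ℝ × ℝ → ℝ} {r : ℝ} (h : Mol ψ r) (h1 : Integrable F1)
    (h2 : Integrable F2) {B : Set (ℝ × ℝ)} (hB : MeasurableSet B) (hBf : volume B < ⊤) :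
    ∫ x in B, div2 (fun x => (conv ψ F1 x, conv ψ F2 x)) x =
      - ∫ z, (F1 z * fderiv ℝ (conv ψ (B.indicator 1)) z (1, 0)
        + F2 z * fderiv ℝ (conv ψ (B.indicator 1)) z (0, 1)) := by
  have hI : Integrable (B.indicator (1 : ℝ × ℝ → ℝ)) := by
    rw [integrable_indicator_iff hB]; exact integrableOn_const hBf.ne
  have key : ∀ {F : ℝ × ℝ → ℝ} (_ : Integrable F) (v : ℝ × ℝ),
      ∫ x in B, fderiv ℝ (conv ψ F) x v = ∫ x, B.indicator 1 x * fderiv ℝ (conv ψ F) x v := by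
    intro F hF v
    rw [← integral_indicator hB]
    congr 1; ext x
    by_cases hx : x ∈ B <;> simp [hx]
  have hbd : ∀ {F : ℝ × ℝ → ℝ} (_ : Integrable F) (v : ℝ × ℝ),
      Continuous (fun x => fderiv ℝ (conv ψ F) x v) ∧ ∃ C, ∀ x, ‖fderiv ℝ (conv ψ F) x v‖ ≤ C := by
    intro F hF v
    refine ⟨((conv_contDiff h.smooth h.cpt hF).continuous_fderiv (by simp)).clm_apply continuous_const, ?_⟩
    have hk : Continuous (fun t => fderiv ℝ ψ t v) :=
      (h.smooth.continuous_fderiv (by simp)).clm_apply continuous_const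
    obtain ⟨C, hC0, hC⟩ := exists_bound hk (h.cpt.fderiv_apply ℝ v)
    refine ⟨C * ∫ t, ‖F t‖, fun x => ?_⟩
    rw [conv_fderiv h.smooth h.cpt hF, conv_flip, ← integral_const_mul]
    refine norm_integral_le_of_norm_le (hF.norm.const_mul C) (Eventually.of_forall fun z => ?_)
    rw [norm_mul]
    exact mul_le_mul_of_nonneg_right (hC _) (norm_nonneg _)
  have hIntg : ∀ {F G : ℝ × ℝ → ℝ} (_ : Integrable F) (_ : Integrable G) (v : ℝ × ℝ),
      Integrable (fun x => G x * fderiv ℝ (conv ψ F) x v) := by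
    intro F G hF hG v
    obtain ⟨hc, C, hC⟩ := hbd hF v
    exact hG.mul_bdd hc.aestronglyMeasurable (Eventually.of_forall hC)
  have hinS : ∀ {F : ℝ × ℝ → ℝ} (_ : Integrable F) (v : ℝ × ℝ),
      IntegrableOn (fun x => fderiv ℝ (conv ψ F) x v) B := by
    intro F hF v
    obtain ⟨hc, C, hC⟩ := hbd hF v
    exact IntegrableOn.of_bound hBf hc.aestronglyMeasurable C (Eventually.of_forall hC)
  have e : ∀ x, div2 (fun x => (conv ψ F1 x, conv ψ F2 x)) x
      = fderiv ℝ (conv ψ F1) x (1, 0) + fderiv ℝ (conv ψ F2) x (0, 1) := by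
    intro x
    unfold div2
    rw [DifferentiableAt.fderiv_prodMk ((conv_contDiff h.smooth h.cpt h1).differentiable (by simp) x)
      ((conv_contDiff h.smooth h.cpt h2).differentiable (by simp) x)]
    simp
  simp_rw [e]
  rw [integral_add (hinS h1 _) (hinS h2 _), integral_add (hIntg hI h1 _) (hIntg hI h2 _), key h1, key h2,
    h.dual h1 hI, h.dual h2 hI]
  ring

/-! ### Crossing lemma -/

lemma integrable_ind {B : Set (ℝ × ℝ)} (hB : MeasurableSet B) (hBs : B ⊆ Isq) :
    Integrable (B.indicator (1 : ℝ × ℝ → ℝ)) := by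
  rw [integrable_indicator_iff hB]; exact integrableOn_const (volume_lt_top_of_subset hBs).ne

/-- small closed squares -/
def Qs (s : ℝ) : Set (ℝ × ℝ) := Icc (-s) s ×ˢ Icc (-s) s

lemma qs_measurable (s : ℝ) : MeasurableSet (Qs s) := measurableSet_Icc.prod measurableSet_Icc

lemma conv_tsupport {ψ F : ℝ × ℝ → ℝ} {r s : ℝ} (h : Mol ψ r) (hF : ∀ z, z ∉ Qs s → F z = 0) :
    ∀ x, x ∉ Qs (s + r) → conv ψ F x = 0 := by
  intro x hx
  apply h.conv_zero
  intro y hy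
  apply hF
  intro hys
  apply hx
  rw [Prod.norm_def, max_lt_iff] at hy
  simp only [Prod.fst_sub, Prod.snd_sub, Real.norm_eq_abs, abs_lt] at hy
  simp only [Qs, mem_prod, mem_Icc] at hys ⊢
  refine ⟨⟨?_, ?_⟩, ?_, ?_⟩ <;> linarith [hy.1.1, hy.1.2, hy.2.1, hy.2.2, hys.1.1, hys.1.2, hys.2.1, hys.2.2]

lemma qs_isClosed (s : ℝ) : IsClosed (Qs s) := isClosed_Icc.prod isClosed_Icc

lemma qs_subset_sq {s : ℝ} (hs : s < 1) : Qs s ⊆ Sq := by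
  intro x hx
  simp only [Qs, mem_prod, mem_Icc] at hx
  rw [mem_sq]
  refine ⟨⟨?_, ?_⟩, ?_, ?_⟩ <;> linarith [hx.1.1, hx.1.2, hx.2.1, hx.2.2]

lemma crossing_aux {τ : ℝ × ℝ → ℝ} {E : Set (ℝ × ℝ)} (hEm : MeasurableSet E)
    (hE : E ⊆ Isq) {c : ℝ} (h : EB τ E c) {t : ℝ} (ht : 0 < t) (htτ : ∀ v : ℝ × ℝ, t * |v.2| ≤ τ v)
    {ψ : ℝ × ℝ → ℝ} {r s : ℝ} (hψ : Mol ψ r) (hrs : s + r < 1) :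
    ∫⁻ z in Qs s, ‖fderiv ℝ (conv ψ (E.indicator 1)) z (0, 1)‖ₑ ≤ ENNReal.ofReal (c / t) := by
  set D : ℝ × ℝ → ℝ := fun z => fderiv ℝ (conv ψ (E.indicator 1)) z (0, 1) with hD
  have hIE := integrable_ind hEm hE
  have hDc : Continuous D :=
    ((conv_contDiff hψ.smooth hψ.cpt hIE).continuous_fderiv (by simp)).clm_apply continuous_const
  let F2 : ℝ × ℝ → ℝ := (Qs s).indicator (fun z => -t * (SignType.sign (D z) : ℝ))
  have hsm : Measurable (fun z => (SignType.sign (D z) : ℝ)) := by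
    have : (fun z => (SignType.sign (D z) : ℝ)) =
        fun z => if 0 < D z then 1 else if D z < 0 then -1 else 0 := by
      ext z
      simp only [sign_apply]
      split_ifs <;> simp
    rw [this]
    exact Measurable.ite (measurableSet_lt measurable_const hDc.measurable) measurable_const
      (Measurable.ite (measurableSet_lt hDc.measurable measurable_const) measurable_const measurable_const)
  have hs1 : ∀ z, |(SignType.sign (D z) : ℝ)| ≤ 1 := by
    intro z
    rcases SignType.sign (D z) <;> simp
  have hQf : volume (Qs s) < ⊤ := (isCompact_Icc.prod isCompact_Icc).measure_lt_top
  have hF2 : Integrable F2 := by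
    rw [integrable_indicator_iff (qs_measurable s)]
    refine IntegrableOn.of_bound hQf (hsm.const_mul _).aestronglyMeasurable t (Eventually.of_forall fun z => ?_)
    rw [norm_mul, norm_neg, Real.norm_of_nonneg ht.le]
    exact mul_le_of_le_one_right ht.le (hs1 z)
  have hF1 : Integrable (fun _ : ℝ × ℝ => (0:ℝ)) := integrable_zero _ _ _
  have hA : Adm τ (fun x => (conv ψ (fun _ => 0) x, conv ψ F2 x)) := by
    refine Adm.mk' ((conv_contDiff hψ.smooth hψ.cpt hF1).prodMk (conv_contDiff hψ.smooth hψ.cpt hF2)) ?_ ?_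
    · refine (closure_minimal ?_ (qs_isClosed (s + r))).trans (qs_subset_sq hrs)
      intro x hx
      by_contra hxn
      apply hx
      have e2 : conv ψ F2 x = 0 := conv_tsupport hψ (fun z hz => indicator_of_notMem hz _) x hxn
      have e1 : conv ψ (fun _ => 0) x = 0 := by simp [conv]
      simp [e1, e2]
    · intro x v
      refine hψ.conv_constraint hF1 hF2 (fun y => ?_) x
      refine le_trans ?_ (htτ v)
      simp only [mul_zero, zero_add]
      refine (le_abs_self _).trans ?_
      rw [abs_mul, mul_comm]
      refine mul_le_mul_of_nonneg_right ?_ (abs_nonneg _)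
      by_cases hy : y ∈ Qs s
      · simp only [F2, indicator_of_mem hy, abs_mul, abs_neg, abs_of_pos ht]
        exact mul_le_of_le_one_right ht.le (hs1 y)
      · simp only [F2, indicator_of_notMem hy, abs_zero]; exact ht.le
  have h1 := h _ hA
  rw [hψ.dual_div hF1 hF2 hEm (volume_lt_top_of_subset hE)] at h1
  have h2 : - ∫ z, ((0:ℝ) * fderiv ℝ (conv ψ (E.indicator 1)) z (1, 0) + F2 z * D z)
      = t * ∫ z in Qs s, ‖D z‖ := by
    rw [← integral_neg, ← integral_const_mul, ← integral_indicator (qs_measurable s)]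
    congr 1; ext z
    by_cases hz : z ∈ Qs s
    · simp only [F2, indicator_of_mem hz, Real.norm_eq_abs, ← self_mul_sign (D z)]
      ring
    · simp [F2, hz]
  rw [h2] at h1
  have hDi : IntegrableOn D (Qs s) :=
    hDc.continuousOn.integrableOn_compact (isCompact_Icc.prod isCompact_Icc)
  rw [← ofReal_integral_norm_eq_lintegral_enorm hDi]
  apply ENNReal.ofReal_le_ofReal
  rw [le_div_iff₀ ht]; linarith

lemma line_bound {u : ℝ × ℝ → ℝ} (hu : ContDiff ℝ (⊤ : ℕ∞) u) {s x y1 y2 : ℝ} (h1 : y1 ∈ Icc (-s) s)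
    (h2 : y2 ∈ Icc (-s) s) :
    ‖u (x, y1) - u (x, y2)‖ₑ ≤ ∫⁻ y in Icc (-s) s, ‖fderiv ℝ u (x, y) (0, 1)‖ₑ := by
  have hd : ∀ y, HasDerivAt (fun y => u (x, y)) (fderiv ℝ u (x, y) (0, 1)) y := by
    intro y
    have ha : HasFDerivAt u (fderiv ℝ u (x, y)) (x, y) := (hu.differentiable (by simp) _).hasFDerivAt
    have hb : HasDerivAt (fun y : ℝ => (x, y)) ((0:ℝ), (1:ℝ)) y :=
      (hasDerivAt_const y x).prodMk (hasDerivAt_id y)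
    exact ha.comp_hasDerivAt y hb
  have hc : Continuous (fun y => fderiv ℝ u (x, y) (0, 1)) := by
    have := hu.continuous_fderiv (by simp)
    exact (this.comp (by fun_prop)).clm_apply continuous_const
  have hf := intervalIntegral.integral_eq_sub_of_hasDerivAt (a := y2) (b := y1) (fun y _ => hd y)
    (hc.intervalIntegrable _ _)
  have hn := intervalIntegral.norm_intervalIntegral_eq (fun y => fderiv ℝ u (x, y) (0, 1)) y2 y1 volume
  rw [← hf, ← ofReal_norm_eq_enorm, hn, ofReal_norm_eq_enorm]
  refine (enorm_integral_le_lintegral_enorm _).trans (lintegral_mono_set ?_)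
  intro y hy
  rw [mem_uIoc] at hy
  simp only [mem_Icc] at *
  rcases hy with hy | hy <;> constructor <;> linarith [h1.1, h1.2, h2.1, h2.2]

lemma exists_of_ae_of_pos {S : Set ℝ} {P : ℝ → Prop} (hP : ∀ᵐ y, P y) (hS : 0 < volume S) :
    ∃ y ∈ S, P y := by
  by_contra hcon
  push Not at hcon
  have : volume S ≤ volume {y | ¬ P y} := measure_mono hcon
  rw [ae_iff] at hP
  rw [hP] at this
  exact absurd hS (not_lt.2 this)

/-- vertical section -/
def sec (E : Set (ℝ × ℝ)) (x : ℝ) : Set ℝ := Prod.mk x ⁻¹' E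

lemma sec_meas {E : Set (ℝ × ℝ)} (hE : MeasurableSet E) (x : ℝ) : MeasurableSet (sec E x) :=
  measurable_prodMk_left hE

lemma sec_vol_meas {E : Set (ℝ × ℝ)} (hE : MeasurableSet E) : Measurable (fun x => volume (sec E x)) :=
  measurable_measure_prodMk_left hE

lemma crossing_s {τ : ℝ × ℝ → ℝ} {E : Set (ℝ × ℝ)} (hEm : MeasurableSet E)
    (hE : E ⊆ Isq) {c : ℝ} (h : EB τ E c) {t : ℝ} (ht : 0 < t) (htτ : ∀ v : ℝ × ℝ, t * |v.2| ≤ τ v)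
    {s : ℝ} (hs : s < 1) :
    volume {x | x ∈ Icc (-s) s ∧ 0 < volume (sec E x ∩ Icc (-s) s) ∧ 0 < volume (Icc (-s) s \ sec E x)}
      ≤ ENNReal.ofReal (c / t) := by
  obtain ⟨ψ, hψ, hψl⟩ := exists_mol
  have hIE := integrable_ind hEm hE
  set u : ℕ → ℝ × ℝ → ℝ := fun n => conv (ψ n) (E.indicator 1) with hu
  have hus : ∀ n, ContDiff ℝ (⊤ : ℕ∞) (u n) := fun n => conv_contDiff (hψ n).smooth (hψ n).cpt hIE
  set g : ℕ → ℝ → ℝ≥0∞ := fun n x => ∫⁻ y in Icc (-s) s, ‖fderiv ℝ (u n) (x, y) (0, 1)‖ₑ with hg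
  have hgm0 : ∀ n, Measurable (fun z : ℝ × ℝ => ‖fderiv ℝ (u n) z (0, 1)‖ₑ) := fun n =>
    (((hus n).continuous_fderiv (by simp)).clm_apply continuous_const).enorm.measurable
  have hgm : ∀ n, Measurable (g n) := fun n => by
    exact (hgm0 n).lintegral_prod_right'
  have hgb : ∀ᶠ n in atTop, ∫⁻ x in Icc (-s) s, g n x ≤ ENNReal.ofReal (c / t) := by
    have hev : ∀ᶠ n : ℕ in atTop, 1 / ((n:ℝ) + 1) < 1 - s :=
      (tendsto_one_div_add_atTop_nhds_zero_nat (𝕜 := ℝ)).eventually_lt_const (by linarith)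
    filter_upwards [hev] with n hn
    have := crossing_aux hEm hE h ht htτ (hψ n) (s := s) (by linarith)
    rw [Qs, Measure.volume_eq_prod, ← Measure.prod_restrict, lintegral_prod _ (hgm0 n).aemeasurable] at this
    exact this
  have hfat : ∫⁻ x in Icc (-s) s, liminf (fun n => g n x) atTop ≤ ENNReal.ofReal (c / t) := by
    refine (lintegral_liminf_le hgm).trans ?_
    exact liminf_le_of_frequently_le' hgb.frequently
  have hXm : MeasurableSet {x | x ∈ Icc (-s) s ∧ 0 < volume (sec E x ∩ Icc (-s) s) ∧ 0 < volume (Icc (-s) s \ sec E x)} := by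
    have m1 : Measurable (fun x => volume (sec E x ∩ Icc (-s) s)) :=
      sec_vol_meas (hEm.inter (measurable_snd (measurableSet_Icc (a := -s) (b := s))))
    have m2 : Measurable (fun x => volume (Icc (-s) s \ sec E x)) :=
      sec_vol_meas ((measurable_snd (measurableSet_Icc (a := -s) (b := s))).diff hEm)
    exact measurableSet_Icc.inter ((measurableSet_lt measurable_const m1).inter (measurableSet_lt measurable_const m2))
  have hae : ∀ᵐ x : ℝ, ∀ᵐ y : ℝ, Tendsto (fun n => u n (x, y)) atTop (nhds (E.indicator 1 (x, y))) := by
    have := hψl _ hIE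
    rw [Measure.volume_eq_prod] at this
    exact Measure.ae_ae_of_ae_prod this
  have hone : ∀ᵐ x : ℝ, x ∈ {x | x ∈ Icc (-s) s ∧ 0 < volume (sec E x ∩ Icc (-s) s) ∧ 0 < volume (Icc (-s) s \ sec E x)} →
      1 ≤ liminf (fun n => g n x) atTop := by
    filter_upwards [hae] with x hx hxX
    obtain ⟨hxs, hp1, hp2⟩ := hxX
    obtain ⟨y1, hy1, hl1⟩ := exists_of_ae_of_pos hx hp1
    obtain ⟨y2, hy2, hl2⟩ := exists_of_ae_of_pos hx hp2
    have i1 : E.indicator (1 : ℝ × ℝ → ℝ) (x, y1) = 1 := indicator_of_mem (show (x, y1) ∈ E from hy1.1) _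
    have i2 : E.indicator (1 : ℝ × ℝ → ℝ) (x, y2) = 0 := indicator_of_notMem (show (x, y2) ∉ E from hy2.2) _
    rw [i1] at hl1
    rw [i2] at hl2
    have hl : Tendsto (fun n => ‖u n (x, y1) - u n (x, y2)‖ₑ) atTop (nhds 1) := by
      have := (hl1.sub hl2).enorm
      simpa using this
    rw [← hl.liminf_eq]
    exact liminf_le_liminf (Eventually.of_forall fun n => line_bound (hus n) hy1.2 hy2.1)
  calc _ = ∫⁻ x in {x | x ∈ Icc (-s) s ∧ 0 < volume (sec E x ∩ Icc (-s) s) ∧ 0 < volume (Icc (-s) s \ sec E x)}, 1 := by simp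
    _ ≤ ∫⁻ x in {x | x ∈ Icc (-s) s ∧ 0 < volume (sec E x ∩ Icc (-s) s) ∧ 0 < volume (Icc (-s) s \ sec E x)},
        liminf (fun n => g n x) atTop := setLIntegral_mono_ae' hXm hone
    _ ≤ _ := (lintegral_mono_set (fun x hx => hx.1)).trans hfat

lemma pos_of_union {S : Set ℝ} (hS : 0 < volume (S ∩ Ioo (-1) 1)) :
    ∃ m : ℕ, 0 < volume (S ∩ Icc (-(1 - 1 / ((m:ℝ) + 1))) (1 - 1 / ((m:ℝ) + 1))) := by
  by_contra hcon
  push Not at hcon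
  have hz : ∀ m : ℕ, volume (S ∩ Icc (-(1 - 1 / ((m:ℝ) + 1))) (1 - 1 / ((m:ℝ) + 1))) = 0 :=
    fun m => le_antisymm (hcon m) zero_le
  have : S ∩ Ioo (-1) 1 ⊆ ⋃ m : ℕ, (S ∩ Icc (-(1 - 1 / ((m:ℝ) + 1))) (1 - 1 / ((m:ℝ) + 1))) := by
    rintro x ⟨hxS, hx1, hx2⟩
    obtain ⟨m, hm⟩ := exists_nat_one_div_lt (K := ℝ) (ε := min (1 + x) (1 - x)) (lt_min (by linarith) (by linarith))
    rw [lt_min_iff] at hm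
    exact mem_iUnion.2 ⟨m, hxS, by linarith [hm.1], by linarith [hm.2]⟩
  have h0 := measure_mono (μ := volume) this
  rw [measure_iUnion_null hz] at h0
  exact absurd hS (not_lt.2 h0)

lemma Js_mono {m n : ℕ} (h : m ≤ n) : Icc (-(1 - 1 / ((m:ℝ) + 1))) (1 - 1 / ((m:ℝ) + 1)) ⊆
    Icc (-(1 - 1 / ((n:ℝ) + 1))) (1 - 1 / ((n:ℝ) + 1)) := by
  have : 1 / ((n:ℝ) + 1) ≤ 1 / ((m:ℝ) + 1) := Nat.one_div_le_one_div h
  exact Icc_subset_Icc (by linarith) (by linarith)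

lemma crossing {τ : ℝ × ℝ → ℝ} {E : Set (ℝ × ℝ)} (hEm : MeasurableSet E)
    (hE : E ⊆ Isq) {c : ℝ} (h : EB τ E c) {t : ℝ} (ht : 0 < t) (htτ : ∀ v : ℝ × ℝ, t * |v.2| ≤ τ v) :
    volume (Ioo (-1) 1 ∩ {x | 0 < volume (sec E x) ∧ 0 < volume (sec (Isq \ E) x)})
      ≤ ENNReal.ofReal (c / t) := by
  let X : ℕ → Set ℝ := fun m => {x | x ∈ Icc (-(1 - 1 / ((m:ℝ) + 1))) (1 - 1 / ((m:ℝ) + 1)) ∧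
    0 < volume (sec E x ∩ Icc (-(1 - 1 / ((m:ℝ) + 1))) (1 - 1 / ((m:ℝ) + 1))) ∧
    0 < volume (Icc (-(1 - 1 / ((m:ℝ) + 1))) (1 - 1 / ((m:ℝ) + 1)) \ sec E x)}
  have hX : Monotone X := by
    intro m n hmn x hx
    have hJ := Js_mono hmn
    exact ⟨hJ hx.1, hx.2.1.trans_le (measure_mono (inter_subset_inter_right _ hJ)),
      hx.2.2.trans_le (measure_mono (diff_subset_diff_left hJ))⟩
  have hsub : (Ioo (-1) 1 ∩ {x | 0 < volume (sec E x) ∧ 0 < volume (sec (Isq \ E) x)}) ⊆ ⋃ m, X m := by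
    rintro x ⟨hx, h1, h2⟩
    have hIoo : ∀ S : Set ℝ, S ⊆ Icc (-1) 1 → 0 < volume S → 0 < volume (S ∩ Ioo (-1) 1) := by
      intro S hS hp
      have : volume (S ∩ Ioo (-1) 1) = volume (S ∩ Icc (-1) 1) :=
        measure_congr ((ae_eq_refl S).inter Ioo_ae_eq_Icc)
      rw [this, inter_eq_left.2 hS]; exact hp
    have s1 : sec E x ⊆ Icc (-1) 1 := fun y hy => (mem_isq.1 (hE hy)).2
    have s2 : sec (Isq \ E) x ⊆ Icc (-1) 1 := fun y hy => (mem_isq.1 hy.1).2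
    obtain ⟨m1, hm1⟩ := pos_of_union (hIoo _ s1 h1)
    obtain ⟨m2, hm2⟩ := pos_of_union (hIoo _ s2 h2)
    obtain ⟨m3, hm3⟩ := exists_nat_one_div_lt (K := ℝ) (ε := min (1 + x) (1 - x)) (lt_min (by linarith [hx.1]) (by linarith [hx.2]))
    rw [lt_min_iff] at hm3
    refine mem_iUnion.2 ⟨max m1 (max m2 m3), ?_, ?_, ?_⟩
    · apply Js_mono (le_trans (le_max_right m2 m3) (le_max_right _ _))
      exact ⟨by linarith [hm3.1], by linarith [hm3.2]⟩
    · exact hm1.trans_le (measure_mono (inter_subset_inter_right _ (Js_mono (le_max_left _ _))))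
    · refine hm2.trans_le (measure_mono ?_)
      rintro y ⟨hy1, hy2⟩
      exact ⟨Js_mono (le_trans (le_max_left m2 m3) (le_max_right _ _)) hy2, hy1.2⟩
  refine (measure_mono hsub).trans ?_
  rw [hX.measure_iUnion]
  refine iSup_le fun m => crossing_s hEm hE h ht htτ ?_
  have : 0 < 1 / ((m:ℝ) + 1) := by positivity
  linarith

/-! ### Pushing the two halves apart -/

/-- left part volume -/
noncomputable def lvol (G : Set (ℝ × ℝ)) (s : ℝ) : ℝ := volume.real (G ∩ {x | x.1 ≤ s})

lemma half_meas (s : ℝ) : MeasurableSet {x : ℝ × ℝ | x.1 ≤ s} :=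
  measurableSet_le measurable_fst measurable_const

lemma fin_of_sub {G : Set (ℝ × ℝ)} (hG : G ⊆ Isq) : volume G ≠ ⊤ := (volume_lt_top_of_subset hG).ne

lemma lvol_split {G : Set (ℝ × ℝ)} (hG : G ⊆ Isq) (s : ℝ) :
    lvol G s + volume.real (G ∩ {x | s < x.1}) = volume.real G := by
  have := measureReal_inter_add_sdiff (μ := volume) (s := G) (half_meas s) (fin_of_sub hG)
  rw [← this]
  congr 2
  ext x; simp

lemma lvol_diff {G : Set (ℝ × ℝ)} (hG : G ⊆ Isq) {s s' : ℝ} (hs : s ≤ s') :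
    lvol G s ≤ lvol G s' ∧ lvol G s' ≤ lvol G s + 2 * (s' - s) := by
  have hf : ∀ u, volume (G ∩ {x | x.1 ≤ u}) ≠ ⊤ := fun u => fin_of_sub (inter_subset_left.trans hG)
  refine ⟨measureReal_mono (fun x hx => ⟨hx.1, le_trans hx.2 hs⟩) (hf _), ?_⟩
  have hsub : G ∩ {x | x.1 ≤ s'} ⊆ (G ∩ {x | x.1 ≤ s}) ∪ (Icc s s' ×ˢ Icc (-1:ℝ) 1) := by
    rintro x ⟨hx, hxs⟩
    by_cases h : x.1 ≤ s
    · exact Or.inl ⟨hx, h⟩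
    · exact Or.inr ⟨⟨(not_le.1 h).le, hxs⟩, (mem_isq.1 (hG hx)).2⟩
  have hv : volume.real (Icc s s' ×ˢ Icc (-1:ℝ) 1) = 2 * (s' - s) := by
    unfold Measure.real
    rw [Measure.volume_eq_prod, Measure.prod_prod, Real.volume_Icc, Real.volume_Icc,
      ENNReal.toReal_mul, ENNReal.toReal_ofReal (by linarith), ENNReal.toReal_ofReal (by norm_num)]
    ring
  have hfin : volume ((G ∩ {x | x.1 ≤ s}) ∪ (Icc s s' ×ˢ Icc (-1:ℝ) 1)) ≠ ⊤ :=
    (measure_union_lt_top (hf s).lt_top (isCompact_Icc.prod isCompact_Icc).measure_lt_top).ne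
  calc lvol G s' ≤ _ := measureReal_mono hsub hfin
    _ ≤ _ := measureReal_union_le _ _
    _ = _ := by rw [hv]; rfl

lemma lvol_continuous {G : Set (ℝ × ℝ)} (hG : G ⊆ Isq) : Continuous (lvol G) := by
  refine LipschitzWith.continuous (K := 2) (LipschitzWith.of_dist_le_mul fun s s' => ?_)
  rw [Real.dist_eq, Real.dist_eq]
  push_cast
  rcases le_total s s' with h | h
  · have := lvol_diff hG h
    rw [abs_sub_comm, abs_sub_comm s s', abs_of_nonneg (by linarith), abs_of_nonneg (by linarith)]
    linarith
  · have := lvol_diff hG h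
    rw [abs_of_nonneg (by linarith), abs_of_nonneg (by linarith)]
    linarith

lemma lvol_neg_one {G : Set (ℝ × ℝ)} (hG : G ⊆ Isq) : lvol G (-1) = 0 := by
  have hsub : G ∩ {x | x.1 ≤ -1} ⊆ ({(-1:ℝ)} : Set ℝ) ×ˢ univ := by
    rintro x ⟨hx, hx1⟩
    exact ⟨le_antisymm hx1 (mem_isq.1 (hG hx)).1.1, trivial⟩
  have h0 : volume (({(-1:ℝ)} : Set ℝ) ×ˢ (univ : Set ℝ)) = 0 := by
    rw [Measure.volume_eq_prod, Measure.prod_prod]; simp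
  simp [lvol, Measure.real, measure_mono_null hsub h0]

lemma lvol_one {G : Set (ℝ × ℝ)} (hG : G ⊆ Isq) : lvol G 1 = volume.real G := by
  unfold lvol
  have : G ⊆ {x | x.1 ≤ 1} := fun x hx => (mem_isq.1 (hG hx)).1.2
  rw [inter_eq_left.2 this]

lemma push {τ : ℝ × ℝ → ℝ} {D : Set (ℝ × ℝ)} (hDm : MeasurableSet D) (hD : D ⊆ Isq) {c : ℝ}
    (h : EB τ D c) {x0 : ℝ} (hx0 : x0 ∈ Ioo (-1:ℝ) 1) (hthin : Thin D x0) {b : ℝ} (hb0 : 0 ≤ b)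
    (hb : b ≤ volume.real D) :
    ∃ D', MeasurableSet D' ∧ D' ⊆ Isq ∧ volume.real D' = b ∧ EB τ D' c := by
  set L := D ∩ {x | x.1 ≤ x0} with hL
  set R := D \ {x | x.1 ≤ x0} with hR
  have hLm : MeasurableSet L := hDm.inter (half_meas _)
  have hRm : MeasurableSet R := hDm.diff (half_meas _)
  have hLs : L ⊆ Isq := inter_subset_left.trans hD
  have hRs : R ⊆ Isq := sdiff_subset.trans hD
  have hLR : volume.real L + volume.real R = volume.real D :=
    measureReal_inter_add_sdiff (half_meas x0) (fin_of_sub hD)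
  let g : ℝ → ℝ := fun h => (volume.real L - lvol L (-1 + h)) + lvol R (1 - h)
  have hgc : Continuous g := by
    have := lvol_continuous hLs
    have := lvol_continuous hRs
    fun_prop
  have g0 : g 0 = volume.real D := by
    simp only [g, add_zero, sub_zero, lvol_neg_one hLs, lvol_one hRs, hLR]
  have g2 : g 2 = 0 := by
    simp only [g]
    norm_num [lvol_neg_one hRs, lvol_one hLs]
  obtain ⟨t, ht, hgt⟩ : b ∈ g '' Icc 0 2 :=
    intermediate_value_Icc' (by norm_num) hgc.continuousOn (by rw [g0, g2]; exact ⟨hb0, hb⟩)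
  let T : ℝ → ℝ × ℝ → ℝ × ℝ := fun h x => (h, (0:ℝ)) + (1:ℝ) • x
  have hTm : ∀ h, Measurable (T h) := fun h => by fun_prop
  set P := T t ⁻¹' (L ∩ {x | -1 + t < x.1}) with hP
  set Q := T (-t) ⁻¹' (R ∩ {x | x.1 ≤ 1 - t}) with hQ
  have hLm' : MeasurableSet (L ∩ {x | -1 + t < x.1}) :=
    hLm.inter (measurableSet_lt measurable_const measurable_fst)
  have hRm' : MeasurableSet (R ∩ {x | x.1 ≤ 1 - t}) := hRm.inter (half_meas _)
  have hPm : MeasurableSet P := hTm t hLm'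
  have hQm : MeasurableSet Q := hTm (-t) hRm'
  have hT1 : ∀ h x, (T h x).1 = h + x.1 := fun h x => by simp [T]
  have hT2 : ∀ h x, (T h x).2 = x.2 := fun h x => by simp [T]
  have hPs : P ⊆ Isq := by
    rintro x ⟨hx, hx1⟩
    have h1 := mem_isq.1 (hLs hx)
    have h2 : (T t x).1 ≤ x0 := hx.2
    have h3 : -1 + t < (T t x).1 := hx1
    rw [hT1, hT2] at *
    rw [mem_isq]
    refine ⟨⟨?_, ?_⟩, h1.2⟩ <;> linarith [ht.1, hx0.2]
  have hQs : Q ⊆ Isq := by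
    rintro x ⟨hx, hx1⟩
    have h1 := mem_isq.1 (hRs hx)
    have h2 : ¬ (T (-t) x).1 ≤ x0 := hx.2
    have h3 : (T (-t) x).1 ≤ 1 - t := hx1
    rw [hT1, hT2] at *
    rw [mem_isq]
    refine ⟨⟨?_, ?_⟩, h1.2⟩ <;> linarith [ht.1, hx0.1]
  have hdisj : Disjoint P Q := by
    rw [Set.disjoint_left]
    rintro x ⟨hx, _⟩ ⟨hx', _⟩
    have h2 : (T t x).1 ≤ x0 := hx.2
    have h3 : ¬ (T (-t) x).1 ≤ x0 := hx'.2
    rw [hT1] at *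
    linarith [ht.1]
  refine ⟨P ∪ Q, hPm.union hQm, union_subset hPs hQs, ?_, ?_⟩
  · rw [measureReal_union hdisj hQm (fin_of_sub hPs) (fin_of_sub hQs), hP, hQ, volume_affine hLm' _ one_pos,
      volume_affine hRm' _ one_pos, ← hgt]
    have := lvol_split hLs (-1 + t)
    simp only [g, lvol] at *
    simp only [one_pow, inv_one, one_mul]
    linarith
  · intro f hf
    have hi := div2_integrable hf.1 hf.2.1
    have hfd : Differentiable ℝ f := hf.1.differentiable (by simp)
    rw [setIntegral_union hdisj hQm hi.integrableOn hi.integrableOn]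
    have z1 : ∀ x : ℝ × ℝ, x.1 ≤ -1 → div2 f x = 0 := fun x hx => div2_zero_of_notMem fun hx' => by
      have := mem_sq.1 (hf.2.2.1 hx'); linarith [this.1.1]
    have z2 : ∀ x : ℝ × ℝ, 1 ≤ x.1 → div2 f x = 0 := fun x hx => div2_zero_of_notMem fun hx' => by
      have := mem_sq.1 (hf.2.2.1 hx'); linarith [this.1.2]
    have z2' : ∀ x : ℝ × ℝ, 1 < x.1 → div2 f x = 0 := fun x hx => z2 x hx.le
    have cut' := cut hDm hD h hx0 hthin
      (fl := fun x => f ((-t, (0:ℝ)) + (1:ℝ) • x)) (fr := fun x => f ((t, (0:ℝ)) + (1:ℝ) • x))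
      (hf.1.comp (contDiff_const.add (contDiff_id.const_smul _)))
      (hf.2.1.comp_homeomorph ((Homeomorph.addLeft (-t, (0:ℝ))).trans (Homeomorph.refl _)) |> fun h => by
        simpa [Function.comp_def] using h)
      (fun x hx => by
        have := mem_sq.1 (hf.2.2.1 (tsupport_comp_subset_preimage f (f := T (-t)) (by fun_prop) hx))
        rw [hT1, hT2] at this
        exact ⟨by linarith [ht.1, this.1.1], this.2⟩)
      (fun x => hf.2.2.2 _)
      (hf.1.comp (contDiff_const.add (contDiff_id.const_smul _)))
      (hf.2.1.comp_homeomorph ((Homeomorph.addLeft (t, (0:ℝ))).trans (Homeomorph.refl _)) |> fun h => by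
        simpa [Function.comp_def] using h)
      (fun x hx => by
        have := mem_sq.1 (hf.2.2.1 (tsupport_comp_subset_preimage f (f := T t) (by fun_prop) hx))
        rw [hT1, hT2] at this
        exact ⟨by linarith [ht.1, this.1.2], this.2⟩)
      (fun x => hf.2.2.2 _)
    simp only [div2_comp_affine hfd, one_mul] at cut'
    have e1 : ∫ x in P, div2 f x = ∫ x in L, div2 f ((-t, (0:ℝ)) + (1:ℝ) • x) := by
      have := setIntegral_comp_affine hLm (fun x => div2 f ((-t, (0:ℝ)) + (1:ℝ) • x)) (t, (0:ℝ)) one_pos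
      simp only [one_pow, inv_one, one_mul] at this
      rw [← this]
      have e : ∀ x : ℝ × ℝ, (-t, (0:ℝ)) + (1:ℝ) • ((t, (0:ℝ)) + (1:ℝ) • x) = x := by
        intro x; ext <;> simp
      simp only [e]
      symm
      apply setIntegral_eq_of_subset_of_forall_sdiff_eq_zero (hTm t hLm)
      · exact fun x hx => hx.1
      · rintro x ⟨hx, hxn⟩
        apply z1
        by_contra hcon
        refine hxn ⟨hx, ?_⟩
        show -1 + t < (T t x).1
        rw [hT1]; linarith
    have e2 : ∫ x in Q, div2 f x = ∫ x in R, div2 f ((t, (0:ℝ)) + (1:ℝ) • x) := by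
      have := setIntegral_comp_affine hRm (fun x => div2 f ((t, (0:ℝ)) + (1:ℝ) • x)) (-t, (0:ℝ)) one_pos
      simp only [one_pow, inv_one, one_mul] at this
      rw [← this]
      have e : ∀ x : ℝ × ℝ, (t, (0:ℝ)) + (1:ℝ) • ((-t, (0:ℝ)) + (1:ℝ) • x) = x := by
        intro x; ext <;> simp
      simp only [e]
      symm
      apply setIntegral_eq_of_subset_of_forall_sdiff_eq_zero (hTm (-t) hRm)
      · exact fun x hx => hx.1
      · rintro x ⟨hx, hxn⟩
        apply z2'
        by_contra hcon
        refine hxn ⟨hx, ?_⟩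
        show (T (-t) x).1 ≤ 1 - t
        rw [hT1]; linarith
    rw [e1, e2]
    exact cut'

/-! ### One step of the volume increase -/

/-- uncrossed vertical lines missing `E` -/
def XD (E : Set (ℝ × ℝ)) : Set ℝ := Ioo (-1) 1 ∩ {x | volume (sec E x) = 0}

/-- a strictly better competitor of volume `a` exists -/
def Good (τ : ℝ × ℝ → ℝ) (a ρ : ℝ) : Prop :=
  ∃ E', MeasurableSet E' ∧ E' ⊆ Isq ∧ volume.real E' = a ∧ ∃ c, c < ρ * a ∧ EB τ E' c

lemma Good.mono {τ : ℝ × ℝ → ℝ} {a ρ ρ' : ℝ} (ha : 0 ≤ a) (hρ : ρ ≤ ρ') (h : Good τ a ρ) :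
    Good τ a ρ' := by
  obtain ⟨E', h1, h2, h3, c, h4, h5⟩ := h
  exact ⟨E', h1, h2, h3, c, h4.trans_le (mul_le_mul_of_nonneg_right hρ ha), h5⟩

lemma Good.swap {τ : ℝ × ℝ → ℝ} {a ρ : ℝ} (h : Good (swapN τ) a ρ) : Good τ a ρ := by
  obtain ⟨E', h1, h2, h3, c, h4, h5⟩ := h
  exact ⟨Prod.swap ⁻¹' E', measurableSet_swap h1, swap_subset_isq h2, by rw [volume_swap, h3], c, h4,
    by simpa only [swapN_swapN] using h5.swap⟩

lemma XD_meas {E : Set (ℝ × ℝ)} (hE : MeasurableSet E) : MeasurableSet (XD E) :=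
  measurableSet_Ioo.inter (sec_vol_meas hE (measurableSet_singleton 0))

lemma thin_pt {E : Set (ℝ × ℝ)} (hEm : MeasurableSet E) (hE : E ⊆ Isq) {S : Set ℝ}
    (hS : MeasurableSet S) (hp : 0 < volume (XD E ∩ S)) : ∃ x0 ∈ XD E ∩ S, Thin E x0 := by
  have hm := (XD_meas hEm).inter hS
  have h := ae_thin hEm hE hm (fun x hx => hx.1.2)
  rw [ae_restrict_iff' hm] at h
  obtain ⟨x, hx, hx'⟩ := exists_of_ae_of_pos h hp
  exact ⟨x, hx, hx' hx⟩

lemma compl_compl_isq {E : Set (ℝ × ℝ)} (hE : E ⊆ Isq) : Isq \ (Isq \ E) = E := by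
  rw [sdiff_sdiff_right_self]; exact inter_eq_right.2 hE

lemma vol_compl {E : Set (ℝ × ℝ)} (hEm : MeasurableSet E) (hE : E ⊆ Isq) :
    volume.real (Isq \ E) = 4 - volume.real E := by
  have h := measureReal_inter_add_sdiff (μ := volume) (s := Isq) hEm (fin_of_sub subset_rfl)
  rw [inter_eq_right.2 hE] at h
  have h4 : volume.real Isq = 4 := by simp [Measure.real, volume_isq]
  linarith

lemma caseA {τ : ℝ × ℝ → ℝ} (hτ : IsNorm2 τ) {E : Set (ℝ × ℝ)} (hEm : MeasurableSet E)
    (hE : E ⊆ Isq) {a ρ : ℝ} (ha : a ≤ 4) (hρ : 0 < ρ) (hEa : volume.real E < a)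
    (h : EB τ E (ρ * volume.real E)) (hp : 0 < volume (XD (Isq \ E))) : Good τ a ρ := by
  have hDm := isq_measurable.diff hEm
  obtain ⟨x0, hx0, hth⟩ := thin_pt hDm sdiff_subset MeasurableSet.univ (by simpa using hp)
  have hv := vol_compl hEm hE
  obtain ⟨D', m, s, v, e⟩ := push hDm sdiff_subset (h.compl hτ hE hEm) hx0.1.1 hth (b := 4 - a) (by linarith)
    (by linarith)
  refine ⟨Isq \ D', isq_measurable.diff m, sdiff_subset, ?_, _, ?_, e.compl hτ s m⟩
  · rw [vol_compl m s, v]; ring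
  · exact mul_lt_mul_of_pos_left hEa hρ

lemma cover {τ : ℝ × ℝ → ℝ} {E : Set (ℝ × ℝ)} (hEm : MeasurableSet E)
    (hE : E ⊆ Isq) {c : ℝ} (h : EB τ E c) {t : ℝ} (ht : 0 < t) (htτ : ∀ v : ℝ × ℝ, t * |v.2| ≤ τ v) :
    2 ≤ volume (XD E) + volume (XD (Isq \ E)) + ENNReal.ofReal (c / t) := by
  have hsub : Ioo (-1:ℝ) 1 ⊆ (XD E ∪ XD (Isq \ E)) ∪
      (Ioo (-1) 1 ∩ {x | 0 < volume (sec E x) ∧ 0 < volume (sec (Isq \ E) x)}) := by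
    intro x hx
    by_cases h1 : volume (sec E x) = 0
    · exact Or.inl (Or.inl ⟨hx, h1⟩)
    by_cases h2 : volume (sec (Isq \ E) x) = 0
    · exact Or.inl (Or.inr ⟨hx, h2⟩)
    · exact Or.inr ⟨hx, pos_iff_ne_zero.2 h1, pos_iff_ne_zero.2 h2⟩
  have h2 : volume (Ioo (-1:ℝ) 1) = 2 := by rw [Real.volume_Ioo]; norm_num
  rw [← h2]
  refine (measure_mono hsub).trans ((measure_union_le _ _).trans ?_)
  exact add_le_add (measure_union_le _ _) (crossing hEm hE h ht htτ)

lemma vol_le_of_XE_zero {τ : ℝ × ℝ → ℝ} {E : Set (ℝ × ℝ)} (hEm : MeasurableSet E)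
    (hE : E ⊆ Isq) {c : ℝ} (hc : 0 ≤ c) (h : EB τ E c) {t : ℝ} (ht : 0 < t)
    (htτ : ∀ v : ℝ × ℝ, t * |v.2| ≤ τ v) (h0 : volume (XD (Isq \ E)) = 0) :
    volume.real E ≤ 2 * (c / t) := by
  set C := (Ioo (-1) 1 ∩ {x | 0 < volume (sec E x) ∧ 0 < volume (sec (Isq \ E) x)}) with hC
  have hCm : MeasurableSet C := measurableSet_Ioo.inter
    ((measurableSet_lt measurable_const (sec_vol_meas hEm)).inter
      (measurableSet_lt measurable_const (sec_vol_meas (isq_measurable.diff hEm))))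
  have hv : volume E ≤ 2 * volume C := by
    rw [Measure.volume_eq_prod, Measure.prod_apply hEm]
    calc ∫⁻ x, volume (sec E x) ≤ ∫⁻ x, C.indicator (fun _ => 2) x := by
          have a1 : ∀ᵐ x : ℝ, x ∉ XD (Isq \ E) := measure_eq_zero_iff_ae_notMem.1 h0
          have a2 : ∀ᵐ x : ℝ, x ≠ -1 := ae_iff.2 (by simp)
          have a3 : ∀ᵐ x : ℝ, x ≠ 1 := ae_iff.2 (by simp)
          apply lintegral_mono_ae
          filter_upwards [a1, a2, a3] with x h1 h2 h3
          by_cases hx : x ∈ C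
          · rw [indicator_of_mem hx]
            have hsec : sec E x ⊆ Icc (-1) 1 := fun y hy => (mem_isq.1 (hE hy)).2
            refine (measure_mono hsec).trans ?_
            rw [Real.volume_Icc]; norm_num
          · rw [indicator_of_notMem hx]
            by_contra hpos
            apply hx
            have hpos' : 0 < volume (sec E x) := not_le.1 hpos
            obtain ⟨y, hy⟩ := nonempty_of_measure_ne_zero hpos'.ne'
            have hxy := (mem_isq.1 (hE hy)).1
            have hxI : x ∈ Ioo (-1:ℝ) 1 := ⟨lt_of_le_of_ne hxy.1 h2.symm, lt_of_le_of_ne hxy.2 h3⟩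
            exact ⟨hxI, hpos', pos_iff_ne_zero.2 (fun h => h1 ⟨hxI, h⟩)⟩
      _ = 2 * volume C := by rw [lintegral_indicator hCm]; simp
  have hv2 : volume E ≤ 2 * ENNReal.ofReal (c / t) :=
    hv.trans (by gcongr; exact crossing hEm hE h ht htτ)
  have := ENNReal.toReal_mono (ENNReal.mul_ne_top (by norm_num) ENNReal.ofReal_ne_top) hv2
  rw [ENNReal.toReal_mul, ENNReal.toReal_ofReal (div_nonneg hc ht.le)] at this
  simpa [Measure.real] using this

lemma setInt_zero (G : Set (ℝ × ℝ)) : ∫ x in G, div2 (fun _ => (0 : ℝ × ℝ)) x = 0 := by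
  have h0 : ∀ x, div2 (fun _ => (0 : ℝ × ℝ)) x = 0 := by intro x; simp [div2]
  simp [h0]

lemma stepx {τ : ℝ × ℝ → ℝ} (hτ : IsNorm2 τ) {E : Set (ℝ × ℝ)} (hEm : MeasurableSet E)
    (hE : E ⊆ Isq) {a ρ : ℝ} (ha : a ≤ 4) (hρ : 0 < ρ) (hE0 : 0 < volume.real E) (hEa : volume.real E < a)
    (h : EB τ E (ρ * volume.real E)) {t : ℝ} (ht : 0 < t)
    (htτ : ∀ v : ℝ × ℝ, t * |v.2| ≤ τ v) {δ : ℝ} (hδ : 0 < δ) (hδ' : ρ * volume.real E ≤ (2 - δ) * t) :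
    Good τ a ρ ∨ ∃ F, MeasurableSet F ∧ F ⊆ E ∧ 0 < volume.real F ∧ EB τ F (ρ * volume.real F) ∧
      ((∀ x ∈ F, x.1 ≤ 1 - δ / 3) ∨ (∀ x ∈ F, -1 + δ / 3 ≤ x.1)) := by
  rcases eq_or_ne (volume (XD (Isq \ E))) 0 with h0 | h0
  swap
  · exact Or.inl (caseA hτ hEm hE ha hρ hEa h (pos_iff_ne_zero.2 h0))
  right
  have hc := cover hEm hE h ht htτ
  rw [h0, add_zero] at hc
  have hdt : ρ * volume.real E / t ≤ 2 - δ := (div_le_iff₀ ht).2 hδ'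
  have hd2 : 0 ≤ 2 - δ := le_trans (by positivity) hdt
  have hXD : ENNReal.ofReal δ ≤ volume (XD E) := by
    have h1 : (2:ℝ≥0∞) ≤ volume (XD E) + ENNReal.ofReal (2 - δ) :=
      hc.trans (by gcongr)
    have h2 : (2:ℝ≥0∞) = ENNReal.ofReal δ + ENNReal.ofReal (2 - δ) := by
      rw [← ENNReal.ofReal_add hδ.le hd2]; norm_num
    rw [h2] at h1
    exact (ENNReal.add_le_add_iff_right ENNReal.ofReal_ne_top).1 h1
  set S := Icc (-(1 - δ / 3)) (1 - δ / 3) with hS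
  have hp : 0 < volume (XD E ∩ S) := by
    rw [pos_iff_ne_zero]
    intro hz
    have hsub : XD E ⊆ (XD E ∩ S) ∪ (Ioo (-1) (-(1 - δ / 3)) ∪ Ioo (1 - δ / 3) 1) := by
      intro x hx
      by_cases hxS : x ∈ S
      · exact Or.inl ⟨hx, hxS⟩
      · right
        rw [hS, mem_Icc, not_and_or, not_le, not_le] at hxS
        rcases hxS with h | h
        · exact Or.inl ⟨hx.1.1, h⟩
        · exact Or.inr ⟨h, hx.1.2⟩
    have h1 := (measure_mono hsub).trans (measure_union_le (μ := volume) _ _)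
    rw [hz, zero_add] at h1
    have h2 := h1.trans (measure_union_le _ _)
    rw [Real.volume_Ioo, Real.volume_Ioo, ← ENNReal.ofReal_add (by linarith) (by linarith)] at h2
    have h3 := hXD.trans h2
    rw [ENNReal.ofReal_le_ofReal_iff (by linarith)] at h3
    linarith
  obtain ⟨x0, ⟨hx0, hx0S⟩, hth⟩ := thin_pt hEm hE measurableSet_Icc hp
  set L := E ∩ {x | x.1 ≤ x0} with hL
  set R := E \ {x | x.1 ≤ x0} with hR
  have hLm : MeasurableSet L := hEm.inter (half_meas _)
  have hRm : MeasurableSet R := hEm.diff (half_meas _)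
  have hLR : volume.real L + volume.real R = volume.real E :=
    measureReal_inter_add_sdiff (half_meas x0) (fin_of_sub hE)
  have hcut : ∀ fl fr, Adm τ fl → Adm τ fr →
      (∫ x in L, div2 fl x) + ∫ x in R, div2 fr x ≤ ρ * volume.real E := by
    intro fl fr hl hr
    refine cut hEm hE h hx0.1 hth hl.1 hl.2.1 (fun x hx => ?_) hl.2.2.2 hr.1 hr.2.1 (fun x hx => ?_) hr.2.2.2
    · have := mem_sq.1 (hl.2.2.1 hx); exact ⟨this.1.1, this.2⟩
    · have := mem_sq.1 (hr.2.2.1 hx); exact ⟨this.1.2, this.2⟩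
  have gL : 0 < volume.real L → EB τ L (ρ * volume.real L) → ∃ F, MeasurableSet F ∧ F ⊆ E ∧ 0 < volume.real F ∧ EB τ F (ρ * volume.real F) ∧
      ((∀ x ∈ F, x.1 ≤ 1 - δ / 3) ∨ (∀ x ∈ F, -1 + δ / 3 ≤ x.1)) := fun h1 h2 =>
    ⟨L, hLm, inter_subset_left, h1, h2, Or.inl fun x hx => (le_trans hx.2 hx0S.2)⟩
  have gR : 0 < volume.real R → EB τ R (ρ * volume.real R) → ∃ F, MeasurableSet F ∧ F ⊆ E ∧ 0 < volume.real F ∧ EB τ F (ρ * volume.real F) ∧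
      ((∀ x ∈ F, x.1 ≤ 1 - δ / 3) ∨ (∀ x ∈ F, -1 + δ / 3 ≤ x.1)) := fun h1 h2 =>
    ⟨R, hRm, sdiff_subset, h1, h2, Or.inr fun x hx => by
      have h3 : ¬ x.1 ≤ x0 := hx.2
      have := hx0S.1
      linarith⟩
  rcases eq_or_lt_of_le (measureReal_nonneg (μ := volume) (s := L)) with hl0 | hl0
  · refine gR (by linarith) fun f hf => ?_
    have := hcut _ f (Adm.zero hτ) hf
    rw [setInt_zero, zero_add] at this
    rwa [← hLR, ← hl0, zero_add] at this
  rcases eq_or_lt_of_le (measureReal_nonneg (μ := volume) (s := R)) with hr0 | hr0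
  · refine gL (by linarith) fun f hf => ?_
    have := hcut f _ hf (Adm.zero hτ)
    rw [setInt_zero, add_zero] at this
    rwa [← hLR, ← hr0, add_zero] at this
  by_cases hEL : EB τ L (ρ * volume.real L)
  · exact gL hl0 hEL
  · apply gR hr0
    unfold EB at hEL
    push Not at hEL
    obtain ⟨fl, hfl, hfl'⟩ := hEL
    intro fr hfr
    have := hcut fl fr hfl hfr
    rw [← hLR, mul_add] at this
    linarith

/-! ### Iteration -/

lemma exists_t {τ : ℝ × ℝ → ℝ} (hτ : IsNorm2 τ) :
    ∃ t ν : ℝ, 0 < t ∧ (∀ v : ℝ × ℝ, t * |v.2| ≤ τ v) ∧ τ (ν, 1) = t := by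
  obtain ⟨k, hk, hkl⟩ := hτ.lower
  have hc : Continuous (fun ν : ℝ => τ (ν, 1)) := hτ.continuous.comp (by fun_prop)
  have hlim : Tendsto (fun ν : ℝ => τ (ν, 1)) (cocompact ℝ) atTop := by
    have h1 : Tendsto (fun ν : ℝ => k * ‖ν‖) (cocompact ℝ) atTop :=
      (tendsto_norm_cocompact_atTop).const_mul_atTop hk
    refine tendsto_atTop_mono (fun ν => le_trans ?_ (hkl (ν, 1))) h1
    gcongr
    exact norm_fst_le (ν, (1:ℝ))
  obtain ⟨ν, hν⟩ := hc.exists_forall_le hlim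
  refine ⟨τ (ν, 1), ν, ?_, ?_, rfl⟩
  · refine lt_of_le_of_ne (hτ.nonneg _) (fun h => ?_)
    have := (hτ.1 _).1 h.symm
    simp at this
  · intro v
    by_cases hv : v.2 = 0
    · rw [hv]; simpa using hτ.nonneg v
    · have h1 := hν (v.1 / v.2)
      have h2 := hτ.2.1 v.2 (v.1 / v.2, 1)
      have h3 : v.2 • ((v.1 / v.2, 1) : ℝ × ℝ) = v := by
        ext <;> simp; field_simp
      rw [h3] at h2
      rw [h2, mul_comm]
      gcongr

lemma dil {τ : ℝ × ℝ → ℝ} {F : Set (ℝ × ℝ)} (hFm : MeasurableSet F)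
    {a ρ : ℝ} (hρ : 0 < ρ) (hF0 : 0 < volume.real F) (hFa : volume.real F < a)
    (h : EB τ F (ρ * volume.real F)) {c0 : ℝ × ℝ} (hc0 : c0 ∈ Isq) {k0 : ℝ} (hk0 : 0 < k0) (hk1 : k0 < 1)
    (hsub : ∀ k, k0 ≤ k → k ≤ 1 → (fun x => (1 - k) • c0 + k • x) ⁻¹' F ⊆ Isq) :
    Good τ a ρ ∨ ∃ F', MeasurableSet F' ∧ F' ⊆ Isq ∧ 0 < volume.real F' ∧ volume.real F' < a ∧
      EB τ F' (k0 * ρ * volume.real F') := by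
  have hm : ∀ k : ℝ, MeasurableSet ((fun x : ℝ × ℝ => (1 - k) • c0 + k • x) ⁻¹' F) := fun k =>
    (by fun_prop : Measurable (fun x : ℝ × ℝ => (1 - k) • c0 + k • x)) hFm
  have ha : 0 < a := hF0.trans hFa
  by_cases hcase : a ≤ (k0 ^ 2)⁻¹ * volume.real F
  · left
    set k := Real.sqrt (volume.real F / a) with hk
    have hksq : k ^ 2 = volume.real F / a := Real.sq_sqrt (by positivity)
    have hkp : 0 < k := Real.sqrt_pos.2 (by positivity)
    have hk1' : k < 1 := by
      rw [hk, Real.sqrt_lt' one_pos, one_pow, div_lt_one ha]; exact hFa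
    have hkk : k0 ≤ k := by
      apply Real.le_sqrt_of_sq_le
      rw [le_div_iff₀ ha]
      rw [inv_mul_eq_div, le_div_iff₀ (by positivity)] at hcase
      linarith
    refine ⟨_, hm k, hsub k hkk hk1'.le, ?_, _, ?_, h.dilate hFm hc0 hkp hk1'.le⟩
    · rw [volume_affine hFm _ hkp, hksq]; field_simp
    · have : volume.real F = k ^ 2 * a := by rw [hksq]; field_simp
      rw [this]
      have e : k⁻¹ * (ρ * (k ^ 2 * a)) = k * (ρ * a) := by field_simp
      rw [e]
      exact mul_lt_of_lt_one_left (by positivity) hk1'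
  · right
    push Not at hcase
    refine ⟨_, hm k0, hsub k0 le_rfl hk1.le, ?_, ?_, ?_⟩
    · rw [volume_affine hFm _ hk0]; positivity
    · rw [volume_affine hFm _ hk0]; exact hcase
    · rw [volume_affine hFm _ hk0]
      convert h.dilate hFm hc0 hk0 hk1.le using 1
      field_simp

lemma corner_coord {c η k x : ℝ} (hk : 0 < k) (hkη : 1 - η / 2 ≤ k)
    (hy : -1 ≤ (1 - k) * c + k * x ∧ (1 - k) * c + k * x ≤ 1)
    (hc : (c = -1 ∧ (1 - k) * c + k * x ≤ 1 - η) ∨ (c = 1 ∧ -1 + η ≤ (1 - k) * c + k * x)) :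
    -1 ≤ x ∧ x ≤ 1 := by
  rcases hc with ⟨rfl, h⟩ | ⟨rfl, h⟩
  · constructor
    · apply le_of_mul_le_mul_left _ hk; linarith [hy.1]
    · apply le_of_mul_le_mul_left _ hk; linarith
  · constructor
    · apply le_of_mul_le_mul_left _ hk; linarith
    · apply le_of_mul_le_mul_left _ hk; linarith [hy.2]

lemma step {τ : ℝ × ℝ → ℝ} (hτ : IsNorm2 τ) {E : Set (ℝ × ℝ)} (hEm : MeasurableSet E)
    (hE : E ⊆ Isq) {a ρ : ℝ} (ha : a ≤ 4) (hρ : 0 < ρ) (hE0 : 0 < volume.real E) (hEa : volume.real E < a)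
    (h : EB τ E (ρ * volume.real E)) {t t' : ℝ} (ht : 0 < t)
    (htτ : ∀ v : ℝ × ℝ, t * |v.2| ≤ τ v) (ht' : 0 < t') (htτ' : ∀ v : ℝ × ℝ, t' * |v.2| ≤ swapN τ v)
    {δ : ℝ} (hδ : 0 < δ) (hδ2 : δ ≤ 2) (hδ' : ρ * volume.real E ≤ (2 - δ) * t) (hδ'' : ρ * volume.real E ≤ (2 - δ) * t') :
    Good τ a ρ ∨ ∃ F', MeasurableSet F' ∧ F' ⊆ Isq ∧ 0 < volume.real F' ∧ volume.real F' < a ∧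
      EB τ F' ((1 - δ / 6) * ρ * volume.real F') := by
  rcases stepx hτ hEm hE ha hρ hE0 hEa h ht htτ hδ hδ' with hg | ⟨F, hFm, hFE, hF0, hFB, hFc⟩
  · exact Or.inl hg
  have hFle : volume.real F ≤ volume.real E := measureReal_mono hFE (fin_of_sub hE)
  have hFs : F ⊆ Isq := hFE.trans hE
  rcases stepx hτ.swap (measurableSet_swap hFm) (swap_subset_isq hFs) ha hρ (by rwa [volume_swap])
    (by rw [volume_swap]; linarith) (by rw [volume_swap]; exact hFB.swap) ht' htτ' hδ
    (by rw [volume_swap]; refine le_trans ?_ hδ''; gcongr) with hg | ⟨G, hGm, hGF, hG0, hGB, hGc⟩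
  · exact Or.inl hg.swap
  have hGs : Prod.swap ⁻¹' G ⊆ F := fun x hx => by simpa using hGF hx
  have hcx : ∃ cx : ℝ, (cx = -1 ∨ cx = 1) ∧ ∀ x ∈ Prod.swap ⁻¹' G, (cx = -1 ∧ x.1 ≤ 1 - δ / 3) ∨ (cx = 1 ∧ -1 + δ / 3 ≤ x.1) := by
    rcases hFc with h | h
    · exact ⟨-1, Or.inl rfl, fun x hx => Or.inl ⟨rfl, h x (hGs hx)⟩⟩
    · exact ⟨1, Or.inr rfl, fun x hx => Or.inr ⟨rfl, h x (hGs hx)⟩⟩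
  have hcy : ∃ cy : ℝ, (cy = -1 ∨ cy = 1) ∧ ∀ x ∈ Prod.swap ⁻¹' G, (cy = -1 ∧ x.2 ≤ 1 - δ / 3) ∨ (cy = 1 ∧ -1 + δ / 3 ≤ x.2) := by
    rcases hGc with h | h
    · exact ⟨-1, Or.inl rfl, fun x hx => Or.inl ⟨rfl, h x.swap hx⟩⟩
    · exact ⟨1, Or.inr rfl, fun x hx => Or.inr ⟨rfl, h x.swap hx⟩⟩
  obtain ⟨cx, hcx0, hcx⟩ := hcx
  obtain ⟨cy, hcy0, hcy⟩ := hcy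
  have hGle : volume.real G ≤ volume.real F := by
    rw [← volume_swap F]; exact measureReal_mono hGF (fin_of_sub (swap_subset_isq hFs))
  have hc0 : ((cx, cy) : ℝ × ℝ) ∈ Isq := by
    rw [mem_isq]
    rcases hcx0 with rfl | rfl <;> rcases hcy0 with rfl | rfl <;> norm_num
  refine dil (measurableSet_swap hGm) hρ (by rwa [volume_swap]) (by rw [volume_swap]; linarith)
    (by rw [volume_swap]; exact hGB.swap) hc0 (by linarith) (by linarith) ?_
  intro k hk hk1 x hx
  have hkp : 0 < k := by linarith
  have hy := mem_isq.1 (hFs (hGs hx))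
  have h1 := hcx _ hx
  have h2 := hcy _ hx
  simp only [Prod.fst_add, Prod.smul_fst, Prod.smul_snd, Prod.snd_add, smul_eq_mul] at hy h1 h2
  rw [mem_isq]
  exact ⟨corner_coord hkp (by linarith) hy.1 h1, corner_coord hkp (by linarith) hy.2 h2⟩

lemma not_good_le {τ : ℝ × ℝ → ℝ} (hτ : IsNorm2 τ) {a ρ t ν : ℝ} (ha : a ∈ Icc (0:ℝ) 4)
    (h : ¬ Good τ a ρ) (ht : τ (ν, 1) = t) : ρ * a ≤ 2 * t := by
  by_contra hcon
  push Not at hcon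
  obtain ⟨s, hs⟩ := exists_hset_volume ν ha
  exact h ⟨_, hset_measurable ν s, hset_subset ν s, hs, _, by rw [ht]; exact hcon, hset_EB hτ ν s⟩

lemma case1 {τ : ℝ × ℝ → ℝ} (hτ : IsNorm2 τ) {E : Set (ℝ × ℝ)} (hEm : MeasurableSet E)
    (hE : E ⊆ Isq) {a ρ : ℝ} (ha : a ≤ 4) (hρ : 0 < ρ) (hE0 : 0 < volume.real E) (hEa : volume.real E < a)
    (h : EB τ E (ρ * volume.real E)) : Good τ a ρ := by
  by_contra hng
  have ha0 : 0 < a := hE0.trans hEa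
  obtain ⟨t, ν, ht, htτ, hν⟩ := exists_t hτ
  obtain ⟨t', ν', ht', htτ', hν'⟩ := exists_t hτ.swap
  have b1 := not_good_le hτ ⟨ha0.le, ha⟩ hng hν
  have b2 := not_good_le hτ.swap ⟨ha0.le, ha⟩ (fun h => hng h.swap) hν'
  have hlt : ρ * volume.real E < ρ * a := mul_lt_mul_of_pos_left hEa hρ
  have hng' : ∀ ρ' ≤ ρ, ¬ Good τ a ρ' := fun ρ' h' hg => hng (hg.mono ha0.le h')
  obtain ⟨δ, hδ, hδ2, d1, d2⟩ : ∃ δ, 0 < δ ∧ δ ≤ 2 ∧ ρ * volume.real E ≤ (2 - δ) * t ∧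
      ρ * volume.real E ≤ (2 - δ) * t' := by
    refine ⟨min (2 - ρ * volume.real E / t) (2 - ρ * volume.real E / t'), ?_, ?_, ?_, ?_⟩
    · rw [lt_min_iff, sub_pos, sub_pos, div_lt_iff₀ ht, div_lt_iff₀ ht']
      constructor <;> linarith
    · refine (min_le_left _ _).trans ?_
      have : 0 ≤ ρ * volume.real E / t := by positivity
      linarith
    · rw [← div_le_iff₀ ht]
      linarith [min_le_left (2 - ρ * volume.real E / t) (2 - ρ * volume.real E / t')]
    · rw [← div_le_iff₀ ht']
      linarith [min_le_right (2 - ρ * volume.real E / t) (2 - ρ * volume.real E / t')]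
  rcases step hτ hEm hE ha hρ hE0 hEa h ht htτ ht' htτ' hδ hδ2 d1 d2 with hg | ⟨E1, m1, s1, p1, l1, e1⟩
  · exact hng hg
  set k := 1 - δ / 6 with hk
  have hk0 : 0 < k := by rw [hk]; linarith
  have hk1 : k < 1 := by rw [hk]; linarith
  set δ1 := 2 * (1 - k) with hδ1
  set k1 := 1 - δ1 / 6 with hkk1
  have hk10 : 0 < k1 := by rw [hkk1]; linarith
  have hk11 : k1 < 1 := by rw [hkk1]; linarith
  have iter : ∀ n : ℕ, ∃ F, MeasurableSet F ∧ F ⊆ Isq ∧ 0 < volume.real F ∧ volume.real F < a ∧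
      EB τ F (k1 ^ n * (k * ρ) * volume.real F) := by
    intro n
    induction n with
    | zero => exact ⟨E1, m1, s1, p1, l1, by simpa using e1⟩
    | succ n ih =>
      obtain ⟨F, m, s, p, l, e⟩ := ih
      have hpw : k1 ^ n ≤ 1 := pow_le_one₀ hk10.le hk11.le
      have hρn : 0 < k1 ^ n * (k * ρ) := by positivity
      have hle1 : k1 ^ n * (k * ρ) ≤ k * ρ := mul_le_of_le_one_left (by positivity) hpw
      have hbd : k1 ^ n * (k * ρ) * volume.real F ≤ k * (ρ * a) := by
        calc k1 ^ n * (k * ρ) * volume.real F ≤ (k * ρ) * a := by gcongr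
          _ = _ := by ring
      have hb1 : k * (ρ * a) ≤ k * (2 * t) := by gcongr
      have hb2 : k * (ρ * a) ≤ k * (2 * t') := by gcongr
      rcases step hτ m s ha hρn p l e ht htτ ht' htτ' (δ := δ1) (by rw [hδ1]; linarith) (by rw [hδ1]; linarith)
        (by rw [hδ1]; linarith) (by rw [hδ1]; linarith) with hg | ⟨F', m', s', p', l', e'⟩
      · exact absurd hg (hng' _ (hle1.trans (mul_le_of_le_one_left hρ.le hk1.le)))
      · refine ⟨F', m', s', p', l', ?_⟩
        convert e' using 1
        rw [pow_succ]; ring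
  have hlow : ∀ n : ℕ, t ≤ 2 * (k1 ^ n * (k * ρ)) := by
    intro n
    obtain ⟨F, m, s, p, l, e⟩ := iter n
    have hpw : k1 ^ n ≤ 1 := pow_le_one₀ hk10.le hk11.le
    have hρn : 0 < k1 ^ n * (k * ρ) := by positivity
    have hle1 : k1 ^ n * (k * ρ) ≤ k * ρ := mul_le_of_le_one_left (by positivity) hpw
    rcases eq_or_ne (volume (XD (Isq \ F))) 0 with h0 | h0
    · have := vol_le_of_XE_zero m s (by positivity) e ht htτ h0
      rw [← mul_div_assoc, le_div_iff₀ ht] at this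
      by_contra hcon
      push Not at hcon
      nlinarith
    · exact absurd (caseA hτ m s ha hρn l e (pos_iff_ne_zero.2 h0)) (hng' _ (hle1.trans (mul_le_of_le_one_left hρ.le hk1.le)))
  have hlim : Tendsto (fun n : ℕ => 2 * (k1 ^ n * (k * ρ))) atTop (nhds (2 * (0 * (k * ρ)))) :=
    ((tendsto_pow_atTop_nhds_zero_of_lt_one hk10.le hk11).mul_const _).const_mul _
  have := ge_of_tendsto' hlim hlow
  simp at this
  linarith

lemma vol_inter_XD {E : Set (ℝ × ℝ)} (hEm : MeasurableSet E) : volume (E ∩ (XD E ×ˢ univ)) = 0 := by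
  rw [Measure.volume_eq_prod, Measure.prod_apply (hEm.inter ((XD_meas hEm).prod MeasurableSet.univ)),
    lintegral_eq_zero_iff' (by
      exact (sec_vol_meas (hEm.inter ((XD_meas hEm).prod MeasurableSet.univ))).aemeasurable)]
  refine Eventually.of_forall fun x => ?_
  by_cases hx : x ∈ XD E
  · exact measure_mono_null (fun y hy => hy.1) hx.2
  · have : Prod.mk x ⁻¹' (E ∩ (XD E ×ˢ univ)) = ∅ := by
      ext y; simp [hx]
    simp [this]

lemma EB.pos {τ : ℝ × ℝ → ℝ} (hτ : IsNorm2 τ) {E : Set (ℝ × ℝ)} (hEm : MeasurableSet E)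
    (hE : E ⊆ Isq) (hE0 : 0 < volume.real E) (hE4 : volume.real E < 4) {c : ℝ} (h : EB τ E c) : 0 < c := by
  refine lt_of_le_of_ne (h.nonneg hτ) (fun hc => ?_)
  subst hc
  obtain ⟨t, ν, ht, htτ, hν⟩ := exists_t hτ
  obtain ⟨t', ν', ht', htτ', hν'⟩ := exists_t hτ.swap
  have hDm := isq_measurable.diff hEm
  have hsm := measurableSet_swap hEm
  have hX : volume (XD E) ≠ 0 := by
    intro h0
    have := vol_le_of_XE_zero hDm sdiff_subset le_rfl (h.compl hτ hE hEm) ht htτ (by rwa [compl_compl_isq hE])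
    rw [vol_compl hEm hE] at this
    simp at this; linarith
  have hY : volume (XD (Isq \ Prod.swap ⁻¹' E)) ≠ 0 := by
    intro h0
    have := vol_le_of_XE_zero hsm (swap_subset_isq hE) le_rfl h.swap ht' htτ' h0
    rw [volume_swap] at this
    simp at this; linarith
  have hn2 := vol_inter_XD (isq_measurable.diff hsm)
  have hn1 := vol_inter_XD hEm
  set Y := XD (Isq \ Prod.swap ⁻¹' E) with hYd
  have hn2' : volume (Prod.swap ⁻¹' ((Isq \ Prod.swap ⁻¹' E) ∩ (Y ×ˢ univ))) = 0 := by
    rw [measurePreserving_swap2.measure_preimage_emb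
      (MeasurableEquiv.prodComm (α := ℝ) (β := ℝ)).measurableEmbedding]
    exact hn2
  have hsub : XD E ×ˢ Y ⊆ (E ∩ (XD E ×ˢ univ)) ∪ (Prod.swap ⁻¹' ((Isq \ Prod.swap ⁻¹' E) ∩ (Y ×ˢ univ))) := by
    rintro ⟨x, y⟩ ⟨hx, hy⟩
    by_cases hxy : (x, y) ∈ E
    · exact Or.inl ⟨hxy, hx, trivial⟩
    · refine Or.inr ⟨⟨?_, hxy⟩, hy, trivial⟩
      have h1 := hx.1
      have h2 := hy.1
      rw [mem_isq]
      exact ⟨⟨h2.1.le, h2.2.le⟩, h1.1.le, h1.2.le⟩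
  have hz := measure_mono_null hsub (measure_union_null hn1 hn2')
  rw [Measure.volume_eq_prod, Measure.prod_prod, mul_eq_zero] at hz
  rcases hz with hz | hz
  · exact hX hz
  · exact hY hz

/-! ### Wrapping up the first case -/

lemma exists_hull {E : Set (ℝ × ℝ)} (hE : E ⊆ Isq) : ∃ F, MeasurableSet F ∧ E ⊆ F ∧ F ⊆ Isq ∧
    volume.restrict F = volume.restrict E ∧ volume F = volume E := by
  have hfin : volume E ≠ ⊤ := (volume_lt_top_of_subset hE).ne
  have h1 : volume.restrict (toMeasurable volume E ∩ Isq) = volume.restrict E := by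
    rw [inter_comm, ← Measure.restrict_restrict isq_measurable, Measure.restrict_toMeasurable hfin,
      Measure.restrict_restrict isq_measurable, inter_eq_self_of_subset_right hE]
  refine ⟨toMeasurable volume E ∩ Isq, (measurableSet_toMeasurable _ _).inter isq_measurable,
    subset_inter (subset_toMeasurable _ _) hE, inter_subset_right, h1, ?_⟩
  have := congrArg (fun m => m Set.univ) h1
  simpa using this

lemma per_congr {E F : Set (ℝ × ℝ)} (h : volume.restrict F = volume.restrict E) : per F = per E := by
  unfold per; rw [h]

lemma surfE_congr {τ : ℝ × ℝ → ℝ} {E F : Set (ℝ × ℝ)}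
    (h : volume.restrict F = volume.restrict E) : surfE τ F = surfE τ E := by
  unfold surfE; rw [h]

lemma conduct_le_of_EB {τ : ℝ × ℝ → ℝ} (hτ : IsNorm2 τ) {E : Set (ℝ × ℝ)} (hE : E ⊆ Isq)
    {a c : ℝ} (ha : 0 < a) (hv : volume.real E = a) (h : EB τ E c) :
    MemC E ∧ volume E = ENNReal.ofReal a ∧ conduct τ E ≤ ENNReal.ofReal (c / a) := by
  have hva : volume E = ENNReal.ofReal a := by
    rw [← hv, Measure.real, ENNReal.ofReal_toReal (volume_lt_top_of_subset hE).ne]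
  refine ⟨⟨hE, per_ne_top hτ hE h⟩, hva, ?_⟩
  have h0 : ENNReal.ofReal a ≠ 0 := by simpa using ha
  unfold conduct
  rw [hva, if_neg h0, ENNReal.ofReal_div_of_pos ha]
  exact ENNReal.div_le_div_right (h.surfE_le hτ hE) _

lemma case1_wrap {τ : ℝ × ℝ → ℝ} (hτ : IsNorm2 τ) {a : ℝ} (ha : a ∈ Set.Icc (1 : ℝ) 3)
    {E : Set (ℝ × ℝ)} (hE : E ⊆ Isq) (hvol : volume E < ENNReal.ofReal a) :
    ∃ E' : Set (ℝ × ℝ), MemC E' ∧ volume E' = ENNReal.ofReal a ∧ conduct τ E' < conduct τ E := by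
  have ha0 : 0 < a := by linarith [ha.1]
  by_cases htop : conduct τ E = ⊤
  · obtain ⟨s, hs⟩ := exists_hset_volume 0 (a := a) ⟨by linarith [ha.1], by linarith [ha.2]⟩
    obtain ⟨h1, h2, h3⟩ := conduct_le_of_EB hτ (hset_subset 0 s) ha0 hs (hset_EB hτ 0 s)
    exact ⟨_, h1, h2, by rw [htop]; exact h3.trans_lt ENNReal.ofReal_lt_top⟩
  have hv0 : volume E ≠ 0 := by
    intro h; apply htop; simp [conduct, h]
  have hc : conduct τ E = surfE τ E / volume E := by rw [conduct, if_neg hv0]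
  have hfin : volume E ≠ ⊤ := (volume_lt_top_of_subset hE).ne
  have hs : surfE τ E ≠ ⊤ := by
    intro h; apply htop; rw [hc, h]; exact ENNReal.top_div_of_ne_top hfin
  obtain ⟨F, hFm, _, hF, hFr, hFv⟩ := exists_hull hE
  have hsF : surfE τ F ≠ ⊤ := by rw [surfE_congr hFr]; exact hs
  have hEB := EB_of_surfE hτ hsF
  have hFp : 0 < volume.real F := by
    rw [Measure.real, hFv]; exact ENNReal.toReal_pos hv0 hfin
  have hFa : volume.real F < a := by
    rw [Measure.real, hFv, ← ENNReal.toReal_ofReal ha0.le]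
    exact (ENNReal.toReal_lt_toReal hfin ENNReal.ofReal_ne_top).2 hvol
  have hcp := hEB.pos hτ hFm hF hFp (by linarith [ha.2])
  obtain ⟨E', _, h2, h3, c', h4, h5⟩ := case1 hτ hFm hF (a := a) (ρ := (surfE τ F).toReal / volume.real F)
    (by linarith [ha.2]) (by positivity) hFp hFa (by rwa [div_mul_cancel₀ _ hFp.ne'])
  obtain ⟨k1, k2, k3⟩ := conduct_le_of_EB hτ h2 ha0 h3 h5
  refine ⟨E', k1, k2, k3.trans_lt ?_⟩
  have : conduct τ E = ENNReal.ofReal ((surfE τ F).toReal / volume.real F) := by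
    rw [ENNReal.ofReal_div_of_pos hFp, Measure.real, ENNReal.ofReal_toReal hsF,
      ENNReal.ofReal_toReal (volume_lt_top_of_subset hF).ne, hc, hFv, surfE_congr hFr]
  rw [this]
  refine (ENNReal.ofReal_lt_ofReal_iff (by positivity)).2 ?_
  rwa [div_lt_iff₀ ha0]

/-! ### Submodularity of the perimeter -/

/-- test fields for the perimeter -/
def PAdm (f : ℝ × ℝ → ℝ × ℝ) : Prop :=
  ContDiff ℝ (⊤ : ℕ∞) f ∧ HasCompactSupport f ∧ ∀ x, (f x).1 ^ 2 + (f x).2 ^ 2 ≤ 1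

/-- perimeter bound -/
def PB (E : Set (ℝ × ℝ)) (c : ℝ) : Prop := ∀ f, PAdm f → ∫ x in E, div2 f x ≤ c

lemma PB_of_per {E : Set (ℝ × ℝ)} (h : per E ≠ ⊤) : PB E (per E).toReal := by
  intro f hf
  rw [← ENNReal.ofReal_le_iff_le_toReal h]
  unfold per
  exact le_iSup₂ (f := fun f _ => ENNReal.ofReal (∫ x in E, div2 f x)) f
    ⟨hf.1, hf.2.1, fun x => (eNorm2_le_one_iff _).2 (hf.2.2 x)⟩

lemma PAdm.zero : PAdm (fun _ => (0 : ℝ × ℝ)) :=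
  ⟨contDiff_const, HasCompactSupport.zero, fun x => by simp⟩

/-- near optimal test fields -/
lemma exists_near_per {E : Set (ℝ × ℝ)} {ε : ℝ} (hε : 0 < ε) :
    ∃ f, PAdm f ∧ (per E).toReal - ε < ∫ x in E, div2 f x := by
  by_contra hcon
  push Not at hcon
  have h0 : 0 ≤ (per E).toReal - ε := by
    have := hcon _ PAdm.zero
    rwa [setInt_zero] at this
  have : per E ≤ ENNReal.ofReal ((per E).toReal - ε) := by
    conv_lhs => unfold per
    refine iSup₂_le (fun f hf => ENNReal.ofReal_le_ofReal (hcon f ⟨hf.1, hf.2.1, fun x => ?_⟩))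
    exact (eNorm2_le_one_iff _).1 (hf.2.2 x)
  have h2 := ENNReal.toReal_mono ENNReal.ofReal_ne_top this
  rw [ENNReal.toReal_ofReal h0] at h2
  linarith

lemma exists_qs {f : ℝ × ℝ → ℝ × ℝ} (hf : HasCompactSupport f) : ∃ s, ∀ t, s ≤ t → ∀ x, x ∉ Qs t → f x = 0 := by
  obtain ⟨s, hs⟩ := hf.isCompact.isBounded.subset_closedBall (0 : ℝ × ℝ)
  refine ⟨s, fun t ht x hx => ?_⟩
  by_contra h
  apply hx
  have h1 := hs (subset_tsupport f h)
  rw [mem_closedBall_zero_iff] at h1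
  have a1 : |x.1| ≤ ‖x‖ := norm_fst_le x
  have a2 : |x.2| ≤ ‖x‖ := norm_snd_le x
  have b1 := abs_le.1 (a1.trans (h1.trans ht))
  have b2 := abs_le.1 (a2.trans (h1.trans ht))
  exact ⟨b1, b2⟩

lemma per_submod {A B : Set (ℝ × ℝ)} (hAm : MeasurableSet A) (hA : A ⊆ Isq)
    (hBm : MeasurableSet B) (hB : B ⊆ Isq) {cA cB : ℝ} (hcA : PB A cA) (hcB : PB B cB)
    {f g : ℝ × ℝ → ℝ × ℝ} (hf : PAdm f) (hg : PAdm g) :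
    (∫ x in A ∪ B, div2 f x) + ∫ x in A ∩ B, div2 g x ≤ cA + cB := by
  obtain ⟨ψ, hψ, hlim⟩ := exists_mol
  have hI := integrable_ind hBm hB
  set w : ℕ → ℝ × ℝ → ℝ := fun n => conv (ψ n) (B.indicator 1) with hw
  have hwc : ∀ n, ContDiff ℝ (⊤ : ℕ∞) (w n) := fun n => conv_contDiff (hψ n).smooth (hψ n).cpt hI
  have hw1 : ∀ n x, w n x ≤ 1 := fun n x => (hψ n).conv_le hI (fun y => by
    by_cases hy : y ∈ B <;> simp [hy])
  have hw0 : ∀ n x, 0 ≤ w n x := fun n x => integral_nonneg (fun t =>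
    mul_nonneg ((hψ n).nonneg t) (indicator_nonneg (fun _ _ => zero_le_one) _))
  have hwa : ∀ n x, |w n x| ≤ 1 := fun n x => abs_le.2 ⟨by linarith [hw0 n x], hw1 n x⟩
  have hdf : Differentiable ℝ f := hf.1.differentiable (by simp)
  have hdg : Differentiable ℝ g := hg.1.differentiable (by simp)
  have if1 : Integrable (fun x => (f x).1) := hf.1.continuous.fst.integrable_of_hasCompactSupport
    (hf.2.1.comp_left (g := Prod.fst) rfl)
  have if2 : Integrable (fun x => (f x).2) := hf.1.continuous.snd.integrable_of_hasCompactSupport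
    (hf.2.1.comp_left (g := Prod.snd) rfl)
  have ig1 : Integrable (fun x => (g x).1) := hg.1.continuous.fst.integrable_of_hasCompactSupport
    (hg.2.1.comp_left (g := Prod.fst) rfl)
  have ig2 : Integrable (fun x => (g x).2) := hg.1.continuous.snd.integrable_of_hasCompactSupport
    (hg.2.1.comp_left (g := Prod.snd) rfl)
  set F1 : ℝ × ℝ → ℝ := fun y => (f y).1 + A.indicator (fun y => (g y).1 - (f y).1) y with hF1
  set F2 : ℝ × ℝ → ℝ := fun y => (f y).2 + A.indicator (fun y => (g y).2 - (f y).2) y with hF2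
  have iF1 : Integrable F1 := if1.add ((ig1.sub if1).indicator hAm)
  have iF2 : Integrable F2 := if2.add ((ig2.sub if2).indicator hAm)
  have hFb : ∀ y, F1 y ^ 2 + F2 y ^ 2 ≤ 1 := fun y => by
    by_cases hy : y ∈ A
    · simpa [hF1, hF2, hy] using hg.2.2 y
    · simpa [hF1, hF2, hy] using hf.2.2 y
  obtain ⟨s1, hs1⟩ := exists_qs hf.2.1
  obtain ⟨s2, hs2⟩ := exists_qs hg.2.1
  set s := max s1 s2
  have hFs : ∀ z, z ∉ Qs s → F1 z = 0 ∧ F2 z = 0 := fun z hz => by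
    have e1 := hs1 s (le_max_left _ _) z hz
    have e2 := hs2 s (le_max_right _ _) z hz
    by_cases hy : z ∈ A <;> simp [hF1, hF2, hy, e1, e2]
  -- the mollified field
  have hp : ∀ n : ℕ, PAdm (fun x => (conv (ψ n) F1 x, conv (ψ n) F2 x)) := by
    intro n
    refine ⟨(conv_contDiff (hψ n).smooth (hψ n).cpt iF1).prodMk (conv_contDiff (hψ n).smooth (hψ n).cpt iF2),
      HasCompactSupport.intro (K := Qs (s + 1 / ((n:ℝ) + 1))) (isCompact_Icc.prod isCompact_Icc) (fun x hx => ?_), fun x => ?_⟩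
    · rw [conv_tsupport (hψ n) (fun z hz => (hFs z hz).1) x hx, conv_tsupport (hψ n) (fun z hz => (hFs z hz).2) x hx]
      rfl
    · simp only
      set p1 := conv (ψ n) F1 x with hp1
      set p2 := conv (ψ n) F2 x with hp2
      have hT : ∀ y, (p1, p2).1 * F1 y + (p1, p2).2 * F2 y ≤ Real.sqrt (p1 ^ 2 + p2 ^ 2) := fun y => by
        apply Real.le_sqrt_of_sq_le
        simp only
        have := hFb y
        nlinarith [sq_nonneg (p1 * F2 y - p2 * F1 y), sq_nonneg p1, sq_nonneg p2]
      have h := (hψ n).conv_constraint iF1 iF2 hT x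
      simp only [← hp1, ← hp2] at h
      have hsq := Real.sq_sqrt (by positivity : 0 ≤ p1 ^ 2 + p2 ^ 2)
      have hnn := Real.sqrt_nonneg (p1 ^ 2 + p2 ^ 2)
      set q := Real.sqrt (p1 ^ 2 + p2 ^ 2)
      have : q ≤ 1 := by nlinarith
      nlinarith
  have hq : ∀ n : ℕ, PAdm (fun x => f x + w n x • (g x - f x)) := by
    intro n
    refine ⟨hf.1.add ((hwc n).smul (hg.1.sub hf.1)), hf.2.1.add ((hg.2.1.sub hf.2.1).smul_left (f := w n)), fun x => ?_⟩
    have a1 := hf.2.2 x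
    have a2 := hg.2.2 x
    have b0 := hw0 n x
    have b1 := hw1 n x
    simp only [Prod.fst_add, Prod.snd_add, Prod.smul_fst, Prod.smul_snd, Prod.fst_sub, Prod.snd_sub, smul_eq_mul]
    nlinarith [mul_nonneg (mul_nonneg b0 (sub_nonneg.2 b1)) (sq_nonneg ((g x).1 - (f x).1)),
      mul_nonneg (mul_nonneg b0 (sub_nonneg.2 b1)) (sq_nonneg ((g x).2 - (f x).2)),
      mul_nonneg b0 (sub_nonneg.2 a2), mul_nonneg (sub_nonneg.2 b1) (sub_nonneg.2 a1)]
  have cdf := div2_continuous hf.1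
  have cdg := div2_continuous hg.1
  have idf := div2_integrable hf.1 hf.2.1
  have idg := div2_integrable hg.1 hg.2.1
  obtain ⟨Mf, hMf0, hMf⟩ := exists_bound cdf (div2_hasCompactSupport hf.2.1)
  obtain ⟨Mg, hMg0, hMg⟩ := exists_bound cdg (div2_hasCompactSupport hg.2.1)
  have hstep : ∀ n, (∫ x in A, (div2 f x + w n x * (div2 g x - div2 f x))) + ∫ x, w n x * div2 f x ≤ cA + cB := by
    intro n
    have h1 := hcA _ (hq n)
    have h2 := hcB _ (hp n)
    rw [(hψ n).dual_div iF1 iF2 hBm (volume_lt_top_of_subset hB)] at h2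
    rw [integral_smul_div2 (hwc n) hf.1 hf.2.1]
    have hwd : Continuous (fderiv ℝ (w n)) := (hwc n).continuous_fderiv (by simp)
    have cf := hf.1.continuous
    have cg := hg.1.continuous
    set r : ℝ × ℝ → ℝ := fun x => fderiv ℝ (w n) x (1, 0) * (g x - f x).1 + fderiv ℝ (w n) x (0, 1) * (g x - f x).2 with hr
    have crc : Continuous r := by
      have c1 : Continuous (fun x => fderiv ℝ (w n) x (1, 0)) := hwd.clm_apply continuous_const
      have c2 : Continuous (fun x => fderiv ℝ (w n) x (0, 1)) := hwd.clm_apply continuous_const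
      exact (c1.mul (cg.sub cf).fst).add (c2.mul (cg.sub cf).snd)
    have ri : IntegrableOn r A := (crc.continuousOn.integrableOn_compact isq_compact).mono_set hA
    have e1 : ∀ x, div2 (fun x => f x + w n x • (g x - f x)) x =
        (div2 f x + w n x * (div2 g x - div2 f x)) + r x := by
      intro x
      rw [div2_add (f := f) (g := fun x => w n x • (g x - f x)) hdf
        (((hwc n).differentiable (by simp)).smul (hdg.sub hdf)),
        div2_smul (f := fun x => g x - f x) ((hwc n).differentiable (by simp)) (hdg.sub hdf)]
      have : div2 (fun x => g x - f x) x = div2 g x - div2 f x := by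
        have := div2_add (f := g) (g := fun x => - f x) hdg hdf.neg x
        rw [div2_neg] at this
        simpa [sub_eq_add_neg] using this
      rw [this]; simp only [hr]; ring
    simp_rw [e1] at h1
    have i3 : IntegrableOn (fun x => div2 f x + w n x * (div2 g x - div2 f x)) A :=
      ((cdf.add ((hwc n).continuous.mul (cdg.sub cdf))).continuousOn.integrableOn_compact isq_compact).mono_set hA
    rw [integral_add i3 ri] at h1
    have e2 : ∀ z, F1 z * fderiv ℝ (w n) z (1, 0) + F2 z * fderiv ℝ (w n) z (0, 1) =
        (fderiv ℝ (w n) z (1, 0) * (f z).1 + fderiv ℝ (w n) z (0, 1) * (f z).2) + A.indicator r z := by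
      intro z
      by_cases hz : z ∈ A
      · simp only [hF1, hF2, hr, indicator_of_mem hz, Prod.fst_sub, Prod.snd_sub]; ring
      · simp only [hF1, hF2, hr, indicator_of_notMem hz]; ring
    have e3 : (∫ z, (F1 z * fderiv ℝ (w n) z (1, 0) + F2 z * fderiv ℝ (w n) z (0, 1))) =
        (∫ z, (fderiv ℝ (w n) z (1, 0) * (f z).1 + fderiv ℝ (w n) z (0, 1) * (f z).2)) + ∫ z in A, r z := by
      simp_rw [e2]
      rw [integral_add ?_ ((integrable_indicator_iff hAm).2 ri), integral_indicator hAm]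
      have c1 : Continuous (fun x => fderiv ℝ (w n) x (1, 0)) := hwd.clm_apply continuous_const
      have c2 : Continuous (fun x => fderiv ℝ (w n) x (0, 1)) := hwd.clm_apply continuous_const
      exact ((c1.mul cf.fst).integrable_of_hasCompactSupport ((hf.2.1.comp_left (g := Prod.fst) rfl).mul_left)).add
        ((c2.mul cf.snd).integrable_of_hasCompactSupport ((hf.2.1.comp_left (g := Prod.snd) rfl).mul_left))
    have e4 : (∫ z, (F1 z * fderiv ℝ (conv (ψ n) (B.indicator 1)) z (1, 0) + F2 z * fderiv ℝ (conv (ψ n) (B.indicator 1)) z (0, 1))) = _ := e3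
    rw [e4] at h2
    linarith
  have l1 : Tendsto (fun n => ∫ x in A, (div2 f x + w n x * (div2 g x - div2 f x))) atTop
      (nhds (∫ x in A, (div2 f x + B.indicator 1 x * (div2 g x - div2 f x)))) := by
    refine tendsto_integral_set_bdd (volume_lt_top_of_subset hA) (Mf + (Mg + Mf)) (fun n => ?_) (fun n x => ?_) ?_
    · exact (cdf.add ((hwc n).continuous.mul (cdg.sub cdf))).aestronglyMeasurable
    · refine (abs_add_le _ _).trans (add_le_add (hMf x) ?_)
      rw [abs_mul]
      calc |w n x| * |div2 g x - div2 f x| ≤ 1 * (Mg + Mf) :=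
            mul_le_mul (hwa n x) ((abs_sub _ _).trans (add_le_add (hMg x) (hMf x))) (abs_nonneg _) zero_le_one
        _ = _ := one_mul _
    · filter_upwards [ae_restrict_of_ae (hlim _ hI)] with x hx
      exact (hx.mul_const _).const_add _
  have l2 : Tendsto (fun n => ∫ x, w n x * div2 f x) atTop (nhds (∫ x, B.indicator 1 x * div2 f x)) := by
    refine tendsto_integral_of_dominated_convergence (fun x => |div2 f x|) (fun n => ?_) idf.abs (fun n => ?_) ?_
    · exact ((hwc n).continuous.mul cdf).aestronglyMeasurable
    · refine Eventually.of_forall (fun x => ?_)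
      rw [Real.norm_eq_abs, abs_mul]
      exact mul_le_of_le_one_left (abs_nonneg _) (hwa n x)
    · filter_upwards [hlim _ hI] with x hx
      exact hx.mul_const _
  have hfin := le_of_tendsto (l1.add l2) (Eventually.of_forall hstep)
  refine le_trans (le_of_eq ?_) hfin
  have e5 : ∀ (h : ℝ × ℝ → ℝ) (x : ℝ × ℝ), B.indicator 1 x * h x = B.indicator h x := fun h x => by
    by_cases hx : x ∈ B <;> simp [hx]
  have e6 : ∫ x, B.indicator 1 x * div2 f x = ∫ x in B, div2 f x := by
    simp_rw [e5]; rw [integral_indicator hBm]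
  have e7 : ∫ x in A, (div2 f x + B.indicator 1 x * (div2 g x - div2 f x)) =
      (∫ x in A, div2 f x) + ((∫ x in A ∩ B, div2 g x) - ∫ x in A ∩ B, div2 f x) := by
    simp_rw [e5 (fun x => div2 g x - div2 f x)]
    have i9 : Integrable (B.indicator (fun x => div2 g x - div2 f x)) (volume.restrict A) :=
      ((idg.sub idf : Integrable (fun x => div2 g x - div2 f x) volume).indicator hBm).mono_measure
        Measure.restrict_le_self
    rw [integral_add idf.integrableOn i9, setIntegral_indicator hBm,
      integral_sub idg.integrableOn idf.integrableOn]
  have e8 : (∫ x in A ∪ B, div2 f x) = (∫ x in A \ B, div2 f x) + ∫ x in B, div2 f x := by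
    rw [← sdiff_union_self, setIntegral_union disjoint_sdiff_left hBm idf.integrableOn idf.integrableOn]
  have e9 := integral_inter_add_sdiff (f := div2 f) (s := A) hBm idf.integrableOn
  rw [e6, e7]
  linarith

/-! ### Decompositions are essentially disjoint -/

lemma inter_null {A B : Set (ℝ × ℝ)} (hAm : MeasurableSet A) (hA : A ⊆ Isq)
    (hBm : MeasurableSet B) (hB : B ⊆ Isq) (hpA : per A ≠ ⊤) (hpB : per B ≠ ⊤)
    (h : per (A ∪ B) = per A + per B) : volume (A ∩ B) = 0 := by
  have key : ∀ g, PAdm g → ∫ x in A ∩ B, div2 g x ≤ 0 := by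
    intro g hg
    by_contra hcon
    push Not at hcon
    obtain ⟨f, hf, hfl⟩ := exists_near_per (E := A ∪ B) hcon
    have := per_submod hAm hA hBm hB (PB_of_per hpA) (PB_of_per hpB) hf hg
    rw [h, ENNReal.toReal_add hpA hpB] at hfl
    linarith
  let b : ContDiffBump (0 : ℝ × ℝ) := ⟨2, 3, by norm_num, by norm_num⟩
  have hg : PAdm (fun x => b x • ((1 / 3 * x.1, 0) : ℝ × ℝ)) := by
    refine ⟨b.contDiff.smul (by fun_prop), b.hasCompactSupport.smul_right, fun x => ?_⟩
    simp only [Prod.smul_fst, Prod.smul_snd, smul_eq_mul, mul_zero]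
    by_cases hx : x ∈ Metric.ball (0 : ℝ × ℝ) 3
    · rw [mem_ball_zero_iff] at hx
      have a1 : |x.1| ≤ ‖x‖ := norm_fst_le x
      have : |b x * (1 / 3 * x.1)| ≤ 1 := by
        rw [abs_mul, abs_mul, abs_of_nonneg b.nonneg, abs_of_nonneg (by norm_num : (0:ℝ) ≤ 1/3)]
        have := b.le_one (x := x)
        have := b.nonneg (x := x)
        refine mul_le_one₀ b.le_one (by positivity) (by linarith)
      have := (sq_le_one_iff_abs_le_one _).2 this
      linarith
    · have : b x = 0 := by
        rw [← Function.notMem_support, b.support_eq]; exact hx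
      rw [this]; norm_num
  have hd : ∀ x ∈ A ∩ B, div2 (fun x => b x • ((1 / 3 * x.1, 0) : ℝ × ℝ)) x = 1 / 3 := by
    intro x hx
    have hxI := mem_isq.1 (hA hx.1)
    have hxb : x ∈ Metric.ball (0 : ℝ × ℝ) 2 := by
      rw [mem_ball_zero_iff, Prod.norm_def, max_lt_iff, Real.norm_eq_abs, Real.norm_eq_abs, abs_lt, abs_lt]
      refine ⟨⟨?_, ?_⟩, ⟨?_, ?_⟩⟩ <;> linarith [hxI.1.1, hxI.1.2, hxI.2.1, hxI.2.2]
    have he : (fun x => b x • ((1 / 3 * x.1, 0) : ℝ × ℝ)) =ᶠ[nhds x]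
        (fun x => ((1 / 3 * x.1, 0) : ℝ × ℝ)) := by
      filter_upwards [Metric.isOpen_ball.mem_nhds hxb] with y hy
      rw [b.one_of_mem_closedBall (Metric.ball_subset_closedBall hy), one_smul]
    have hf : HasFDerivAt (fun x : ℝ × ℝ => ((1 / 3 * x.1, 0) : ℝ × ℝ))
        (((1 / 3 : ℝ) • ContinuousLinearMap.fst ℝ ℝ ℝ).prod 0) x :=
      (hasFDerivAt_fst.const_mul (1/3 : ℝ)).prodMk (hasFDerivAt_const (0:ℝ) x)
    unfold div2
    rw [he.fderiv_eq, hf.fderiv]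
    simp
  have h1 := key _ hg
  rw [setIntegral_congr_fun (hAm.inter hBm) hd, setIntegral_const, smul_eq_mul] at h1
  have h2 : volume.real (A ∩ B) = 0 := le_antisymm (by linarith) measureReal_nonneg
  rwa [measureReal_eq_zero_iff (fin_of_sub (inter_subset_left.trans hA))] at h2

/-! ### Approximate supporting functionals -/

lemma exists_support {τ : ℝ × ℝ → ℝ} (hτ : IsNorm2 τ) (v : ℝ × ℝ) :
    ∃ w : ℝ × ℝ, (∀ u : ℝ × ℝ, u.1 * w.1 + u.2 * w.2 ≤ τ u) ∧ v.1 * w.1 + v.2 * w.2 = τ v := by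
  have hτ0 : τ 0 = 0 := (hτ.1 0).2 rfl
  obtain ⟨g, hg1, hg2⟩ := exists_extension_of_le_sublinear
    (LinearPMap.mkSpanSingleton' (σ := RingHom.id ℝ) v (τ v) (fun c hc => by
      have h1 := hτ.2.1 c v
      rw [hc, hτ0] at h1
      rcases mul_eq_zero.1 h1.symm with h | h
      · rw [abs_eq_zero.1 h]; simp
      · rw [h]; simp)) τ
    (fun c hc x => by rw [hτ.2.1, abs_of_pos hc]) hτ.2.2 (by
      rintro ⟨x, hx⟩
      obtain ⟨c, rfl⟩ := Submodule.mem_span_singleton.1 hx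
      rw [LinearPMap.mkSpanSingleton'_apply]
      simp only [RingHom.id_apply, smul_eq_mul]
      rw [hτ.2.1]
      exact mul_le_mul_of_nonneg_right (le_abs_self c) (hτ.nonneg v))
  have hg : ∀ u : ℝ × ℝ, g u = u.1 * g (1, 0) + u.2 * g (0, 1) := by
    intro u
    have : u = u.1 • ((1:ℝ), (0:ℝ)) + u.2 • ((0:ℝ), (1:ℝ)) := by ext <;> simp
    conv_lhs => rw [this]
    rw [map_add, map_smul, map_smul]; rfl
  refine ⟨(g (1, 0), g (0, 1)), fun u => ?_, ?_⟩
  · rw [← hg]; exact hg2 u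
  · rw [← hg]
    have := hg1 ⟨v, Submodule.mem_span_singleton_self v⟩
    exact this.trans (LinearPMap.mkSpanSingleton'_apply_self (σ := RingHom.id ℝ) _ _ _ _)

lemma exists_K {τ : ℝ × ℝ → ℝ} (hτ : IsNorm2 τ) {ε : ℝ} (hε : 0 < ε) :
    ∃ K : ℝ × ℝ → ℝ × ℝ, ContDiff ℝ (⊤ : ℕ∞) K ∧
      (∀ v u : ℝ × ℝ, u.1 * (K v).1 + u.2 * (K v).2 ≤ τ u) ∧
      ∀ v : ℝ × ℝ, τ v - ε ≤ v.1 * (K v).1 + v.2 * (K v).2 := by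
  let t : ℝ × ℝ → Set (ℝ × ℝ) := fun v =>
    {w | (∀ u : ℝ × ℝ, u.1 * w.1 + u.2 * w.2 ≤ τ u) ∧ τ v - ε ≤ v.1 * w.1 + v.2 * w.2}
  obtain ⟨g, hg⟩ := exists_contMDiffMap_forall_mem_convex_of_local_const (n := (⊤ : ℕ∞))
    (modelWithCornersSelf ℝ (ℝ × ℝ)) (t := t) (fun v => by
      rintro x ⟨hx1, hx2⟩ y ⟨hy1, hy2⟩ a b ha hb hab
      refine ⟨fun u => ?_, ?_⟩
      · simp only [Prod.fst_add, Prod.snd_add, Prod.smul_fst, Prod.smul_snd, smul_eq_mul]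
        have e : τ u = a * τ u + b * τ u := by rw [← add_mul, hab, one_mul]
        rw [e]
        nlinarith [mul_le_mul_of_nonneg_left (hx1 u) ha, mul_le_mul_of_nonneg_left (hy1 u) hb]
      · simp only [Prod.fst_add, Prod.snd_add, Prod.smul_fst, Prod.smul_snd, smul_eq_mul]
        have e : τ v - ε = a * (τ v - ε) + b * (τ v - ε) := by rw [← add_mul, hab, one_mul]
        rw [e]
        nlinarith [mul_le_mul_of_nonneg_left hx2 ha, mul_le_mul_of_nonneg_left hy2 hb])
    (fun v => by
      obtain ⟨w, hw1, hw2⟩ := exists_support hτ v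
      refine ⟨w, ?_⟩
      have hc := hτ.continuous
      have c : Continuous (fun y : ℝ × ℝ => τ y - ε - (y.1 * w.1 + y.2 * w.2)) := by fun_prop
      have : ∀ᶠ y in nhds v, τ y - ε - (y.1 * w.1 + y.2 * w.2) < 0 :=
        c.continuousAt.eventually_lt continuousAt_const (by linarith)
      filter_upwards [this] with y hy
      exact ⟨hw1, by linarith⟩)
  refine ⟨g, contMDiff_iff_contDiff.1 g.contMDiff, fun v => (hg v).1, fun v => (hg v).2⟩

lemma exists_phi {S : Set (ℝ × ℝ)} (hS : IsCompact S) (hSq : S ⊆ Sq) :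
    ∃ φ : ℝ × ℝ → ℝ, ContDiff ℝ (⊤ : ℕ∞) φ ∧ (∀ x ∈ S, φ x = 1) ∧ (∀ x, 0 ≤ φ x) ∧ (∀ x, φ x ≤ 1) ∧
      tsupport φ ⊆ Sq := by
  obtain ⟨K', hK', h1, h2⟩ := exists_compact_between hS isOpen_sq hSq
  obtain ⟨f, hf1, hf2, hf3⟩ := exists_contMDiffMap_one_nhds_of_subset_interior (n := (⊤ : ℕ∞))
    (modelWithCornersSelf ℝ (ℝ × ℝ)) hS.isClosed h1
  refine ⟨f, contMDiff_iff_contDiff.1 f.contMDiff, fun x hx => ?_, fun x => (hf3 x).1, fun x => (hf3 x).2,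
    (closure_minimal (fun x hx => ?_) hK'.isClosed).trans h2⟩
  · exact (hf1.self_of_nhdsSet) x hx
  · by_contra h; exact hx (hf2 x h)

/-! ### Additivity of the surface energy on decompositions -/

lemma first_variation {G : Set (ℝ × ℝ)} {c ε ε' δ M : ℝ} (hG : PB G c)
    {f p : ℝ × ℝ → ℝ × ℝ} (hf : PAdm f) (hfl : c - ε < ∫ x in G, div2 f x)
    (hp : ContDiff ℝ (⊤ : ℕ∞) p) (hpc : HasCompactSupport p) (hδ : 0 < δ) (hε' : 0 ≤ ε') (hM : 0 ≤ M)
    (hpM : ∀ x, (p x).1 ^ 2 + (p x).2 ^ 2 ≤ M)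
    (hpf : ∀ x, (f x).1 * (p x).1 + (f x).2 * (p x).2 ≤ ε') :
    ∫ x in G, div2 p x ≤ ε / δ + c * (ε' + δ * M / 2) := by
  set s : ℝ := 1 + δ * ε' + δ ^ 2 * M / 2 with hs
  have hs0 : 1 ≤ s := by
    have : 0 ≤ δ * ε' := by positivity
    have : 0 ≤ δ ^ 2 * M / 2 := by positivity
    linarith
  have hs2 : 1 + 2 * δ * ε' + δ ^ 2 * M ≤ s ^ 2 := by
    have : 0 ≤ (δ * ε' + δ ^ 2 * M / 2) ^ 2 := sq_nonneg _
    rw [hs]; nlinarith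
  have hdf : Differentiable ℝ f := hf.1.differentiable (by simp)
  have hdp : Differentiable ℝ p := hp.differentiable (by simp)
  have hadm : PAdm (fun x => s⁻¹ • (f x + δ • p x)) := by
    refine ⟨(hf.1.add (hp.const_smul δ)).const_smul _, ?_, fun x => ?_⟩
    · have h1 : HasCompactSupport (fun x => δ • p x) := hpc.smul_left (f := fun _ => δ)
      exact (hf.2.1.add h1).smul_left (f := fun _ => s⁻¹)
    · simp only [Prod.smul_fst, Prod.smul_snd, Prod.fst_add, Prod.snd_add, smul_eq_mul]
      rw [mul_pow, mul_pow, ← mul_add, inv_pow, inv_mul_le_iff₀ (by positivity), mul_one]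
      have h1 := hf.2.2 x
      have h2 := mul_le_mul_of_nonneg_left (hpM x) (sq_nonneg δ)
      have h3 := mul_le_mul_of_nonneg_left (hpf x) hδ.le
      nlinarith
  have h1 := hG _ hadm
  have e : ∀ x, div2 (fun x => s⁻¹ • (f x + δ • p x)) x = s⁻¹ * (div2 f x + δ * div2 p x) := by
    intro x
    rw [div2_const_smul (f := fun x => f x + δ • p x) (hdf.add (hdp.const_smul δ)),
      div2_add (g := fun x => δ • p x) hdf (hdp.const_smul δ), div2_const_smul hdp]
  simp_rw [e] at h1
  rw [integral_const_mul, integral_add (div2_integrable hf.1 hf.2.1).integrableOn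
    ((div2_integrable hp hpc).const_mul δ).integrableOn, integral_const_mul,
    inv_mul_le_iff₀ (by positivity)] at h1
  have h2 : δ * ∫ x in G, div2 p x ≤ ε + c * (δ * ε' + δ ^ 2 * M / 2) := by
    have : s * c = c + c * (δ * ε' + δ ^ 2 * M / 2) := by rw [hs]; ring
    linarith
  have h3 : ε / δ + c * (ε' + δ * M / 2) = (ε + c * (δ * ε' + δ ^ 2 * M / 2)) / δ := by
    field_simp
  rw [h3, le_div_iff₀ hδ]
  linarith

lemma dual_bound {τ : ℝ × ℝ → ℝ} (hτ : IsNorm2 τ) {w : ℝ × ℝ}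
    (h : ∀ u : ℝ × ℝ, u.1 * w.1 + u.2 * w.2 ≤ τ u) : |w.1| ≤ τ (1, 0) ∧ |w.2| ≤ τ (0, 1) := by
  constructor
  · have h1 := h (1, 0)
    have h2 := h (-(1, 0))
    rw [hτ.neg] at h2
    simp at h1 h2
    exact abs_le.2 ⟨by linarith, h1⟩
  · have h1 := h (0, 1)
    have h2 := h (-(0, 1))
    rw [hτ.neg] at h2
    simp at h1 h2
    exact abs_le.2 ⟨by linarith, h1⟩

lemma energy_add {τ : ℝ × ℝ → ℝ} (hτ : IsNorm2 τ) {A B : Set (ℝ × ℝ)} {c cA cB : ℝ}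
    (hBm : MeasurableSet B) (hnull : volume (A ∩ B) = 0)
    (hcA : PB A cA) (hcB : PB B cB)
    (hnear : ∀ ε > 0, ∃ f, PAdm f ∧ cA + cB - ε < ∫ x in A ∪ B, div2 f x)
    (hE : EB τ (A ∪ B) c) {g h : ℝ × ℝ → ℝ × ℝ} (hg : Adm τ g) (hh : Adm τ h) :
    (∫ x in A, div2 g x) + ∫ x in B, div2 h x ≤ c := by
  have hsplit : ∀ q : ℝ × ℝ → ℝ × ℝ, ContDiff ℝ (⊤ : ℕ∞) q → HasCompactSupport q →
      ∫ x in A ∪ B, div2 q x = (∫ x in A, div2 q x) + ∫ x in B, div2 q x := fun q h1 h2 =>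
    setIntegral_union₀ hnull hBm.nullMeasurableSet (div2_integrable h1 h2).integrableOn
      (div2_integrable h1 h2).integrableOn
  obtain ⟨φ, hφ, hφ1, hφ0, hφle, hφs⟩ := exists_phi
    (S := tsupport g ∪ tsupport h) (hg.2.1.isCompact.union hh.2.1.isCompact) (union_subset hg.2.2.1 hh.2.2.1)
  set M : ℝ := 4 * (τ (1, 0) ^ 2 + τ (0, 1) ^ 2) with hM
  have hM0 : 0 ≤ M := by positivity
  have main : ∀ η > 0, (∫ x in A, div2 g x) + ∫ x in B, div2 h x ≤ c + η * (2 + (cA + cB) * (1 + M / 2)) := by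
    intro η hη
    obtain ⟨K, hK, hK1, hK2⟩ := exists_K hτ hη
    obtain ⟨f, hf, hfl⟩ := hnear (η * η) (by positivity)
    rw [hsplit f hf.1 hf.2.1] at hfl
    have hfA := hcA f hf
    have hfB := hcB f hf
    set q : ℝ × ℝ → ℝ × ℝ := fun x => φ x • K (f x) with hq
    have hqc : ContDiff ℝ (⊤ : ℕ∞) q := hφ.smul (hK.comp hf.1)
    have hqt : ∀ x u, u.1 * (q x).1 + u.2 * (q x).2 ≤ τ u := by
      intro x u
      simp only [hq, Prod.smul_fst, Prod.smul_snd, smul_eq_mul]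
      have h1 := mul_le_mul_of_nonneg_left (hK1 (f x) u) (hφ0 x)
      have h2 := mul_le_mul_of_nonneg_right (hφle x) (hτ.nonneg u)
      linarith
    have hqs : tsupport q ⊆ Sq :=
      (closure_mono (Function.support_smul_subset_left φ (fun x => K (f x)))).trans hφs
    have hqa : Adm τ q := Adm.mk' hqc hqs hqt
    have aux : ∀ {G : Set (ℝ × ℝ)} {c0 : ℝ} {k : ℝ × ℝ → ℝ × ℝ}, PB G c0 → c0 - η * η < ∫ x in G, div2 f x →
        Adm τ k → (∀ x ∈ tsupport k, φ x = 1) →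
        ∫ x in G, div2 k x ≤ (∫ x in G, div2 q x) + (η * η / η + c0 * (η + η * M / 2)) := by
      intro G c0 k hG hGf hk hk1
      have h1 := first_variation (ε := η * η) (ε' := η) (δ := η) (M := M) hG hf hGf (p := fun x => k x + - q x)
        (hk.1.add hqc.neg) (hk.2.1.add hqa.2.1.neg) hη hη.le hM0 (fun x => by
          obtain ⟨a1, a2⟩ := dual_bound hτ (hk.2.2.2 x)
          obtain ⟨b1, b2⟩ := dual_bound hτ (hqt x)
          have d1 : |(k x).1 - (q x).1| ≤ 2 * τ (1, 0) := (abs_sub _ _).trans (by linarith)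
          have d2 : |(k x).2 - (q x).2| ≤ 2 * τ (0, 1) := (abs_sub _ _).trans (by linarith)
          have f1 := sq_le_sq' (abs_le.1 d1).1 (abs_le.1 d1).2
          have f2 := sq_le_sq' (abs_le.1 d2).1 (abs_le.1 d2).2
          simp only [← sub_eq_add_neg, Prod.fst_sub, Prod.snd_sub]
          rw [hM]; linarith) (fun x => by
          simp only [Prod.fst_add, Prod.snd_add, Prod.fst_neg, Prod.snd_neg]
          have k2 := hK2 (f x)
          have e1 : (f x).1 * (q x).1 + (f x).2 * (q x).2 =
            φ x * ((f x).1 * (K (f x)).1 + (f x).2 * (K (f x)).2) := by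
            simp only [hq, Prod.smul_fst, Prod.smul_snd, smul_eq_mul]; ring
          by_cases hx : x ∈ tsupport k
          · rw [hk1 x hx, one_mul] at e1
            have := hk.2.2.2 x (f x)
            linarith
          · have e0 : k x = 0 := image_eq_zero_of_notMem_tsupport hx
            rw [e0]
            simp only [Prod.fst_zero, Prod.snd_zero, zero_add]
            have h1 := mul_le_mul_of_nonneg_left k2 (hφ0 x)
            have h2 := mul_le_mul_of_nonneg_right (hφle x) hη.le
            have h3 := mul_nonneg (hφ0 x) (hτ.nonneg (f x))
            linarith)
      have e : ∀ x, div2 (fun x => k x + - q x) x = div2 k x + - div2 q x := by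
        intro x
        rw [div2_add (g := fun x => - q x) (hk.1.differentiable (by simp)) (hqc.differentiable (by simp)).neg, div2_neg]
      simp_rw [e] at h1
      have i2 : Integrable (fun x => - div2 q x) (volume.restrict G) :=
        ((div2_integrable hqc hqa.2.1).neg : Integrable (fun x => - div2 q x) volume).mono_measure
          Measure.restrict_le_self
      rw [integral_add (div2_integrable hk.1 hk.2.1).integrableOn i2, integral_neg] at h1
      linarith
    have hA := aux hcA (by linarith) hg (fun x hx => hφ1 x (Or.inl hx))
    have hB := aux hcB (by linarith) hh (fun x hx => hφ1 x (Or.inr hx))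
    have hq2 := hE q hqa
    rw [hsplit q hqc hqa.2.1] at hq2
    have e : η * η / η = η := by field_simp
    rw [e] at hA hB
    linarith
  refine le_of_forall_pos_le_add (fun ε hε => ?_)
  set D := |2 + (cA + cB) * (1 + M / 2)| + 1 with hD
  have hD0 : 0 < D := by positivity
  refine (main (ε / D) (by positivity)).trans ?_
  have h1 : 2 + (cA + cB) * (1 + M / 2) ≤ D := (le_abs_self _).trans (by linarith)
  have h2 := mul_le_mul_of_nonneg_left h1 (show 0 ≤ ε / D by positivity)
  rw [div_mul_cancel₀ _ hD0.ne'] at h2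
  linarith

lemma surfE_add_le {τ : ℝ × ℝ → ℝ} (hτ : IsNorm2 τ) {A B : Set (ℝ × ℝ)} (hA : A ⊆ Isq) (hB : B ⊆ Isq)
    (hBm : MeasurableSet B) (hnull : volume (A ∩ B) = 0)
    (hpA : per A ≠ ⊤) (hpB : per B ≠ ⊤) (h : per (A ∪ B) = per A + per B) :
    surfE τ A + surfE τ B ≤ surfE τ (A ∪ B) := by
  by_cases htop : surfE τ (A ∪ B) = ⊤
  · rw [htop]; exact le_top
  have key : ∀ {k l}, Adm τ k → Adm τ l → (∫ x in A, div2 k x) + ∫ x in B, div2 l x ≤ (surfE τ (A ∪ B)).toReal :=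
    fun hk hl => energy_add hτ hBm hnull (PB_of_per hpA) (PB_of_per hpB)
      (fun ε hε => by
        obtain ⟨f, hf, hfl⟩ := exists_near_per (E := A ∪ B) hε
        rw [h, ENNReal.toReal_add hpA hpB] at hfl
        exact ⟨f, hf, hfl⟩) (EB_of_surfE hτ htop) hk hl
  have hAf : EB τ A (surfE τ (A ∪ B)).toReal := fun k hk => by
    have := key hk (Adm.zero hτ)
    rw [setInt_zero] at this
    linarith
  have sA : surfE τ A ≠ ⊤ := ne_top_of_le_ne_top ENNReal.ofReal_ne_top (hAf.surfE_le hτ hA)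
  have hBf : ∀ l, Adm τ l → EB τ A ((surfE τ (A ∪ B)).toReal - ∫ x in B, div2 l x) := fun l hl k hk => by
    have := key hk hl
    linarith
  have hB2 : EB τ B ((surfE τ (A ∪ B)).toReal - (surfE τ A).toReal) := fun l hl => by
    have h1 := (hBf l hl).surfE_le hτ hA
    have h2 := ENNReal.toReal_mono ENNReal.ofReal_ne_top h1
    rw [ENNReal.toReal_ofReal ((hBf l hl).nonneg hτ)] at h2
    linarith
  have h3 := hB2.surfE_le hτ hB
  calc surfE τ A + surfE τ B ≤ ENNReal.ofReal (surfE τ A).toReal +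
        ENNReal.ofReal ((surfE τ (A ∪ B)).toReal - (surfE τ A).toReal) :=
        add_le_add (ENNReal.ofReal_toReal sA).ge h3
    _ = ENNReal.ofReal (surfE τ (A ∪ B)).toReal := by
        rw [← ENNReal.ofReal_add ENNReal.toReal_nonneg (hB2.nonneg hτ)]
        congr 1; ring
    _ = _ := ENNReal.ofReal_toReal htop

/-- one of the two parts does at least as well -/
lemma mediant {s s1 s2 v1 v2 : ℝ≥0∞} (h : s1 + s2 ≤ s) (h1 : v1 ≠ 0) (h2 : v2 ≠ 0)
    (h1t : v1 ≠ ⊤) (h2t : v2 ≠ ⊤) : s1 / v1 ≤ s / (v1 + v2) ∨ s2 / v2 ≤ s / (v1 + v2) := by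
  by_contra hcon
  push Not at hcon
  obtain ⟨k1, k2⟩ := hcon
  have hv : v1 + v2 ≠ 0 := by simp [h1]
  have hvt : v1 + v2 ≠ ⊤ := by simp [h1t, h2t]
  rw [ENNReal.lt_div_iff_mul_lt (Or.inl h1) (Or.inl h1t)] at k1
  rw [ENNReal.lt_div_iff_mul_lt (Or.inl h2) (Or.inl h2t)] at k2
  have := ENNReal.add_lt_add k1 k2
  rw [← mul_add, ENNReal.div_mul_cancel hv hvt] at this
  exact absurd h (not_le.2 this)

lemma decomp_case {τ : ℝ × ℝ → ℝ} (hτ : IsNorm2 τ) {a : ℝ} (ha : a ∈ Set.Icc (1 : ℝ) 3)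
    {E : Set (ℝ × ℝ)} (hE : MemC E) (hvol : volume E ≤ ENNReal.ofReal a) (hD : Decomposable E) :
    ∃ E' : Set (ℝ × ℝ), MemC E' ∧ volume E' = ENNReal.ofReal a ∧ conduct τ E' < conduct τ E := by
  obtain ⟨A, B, rfl, -, hA0, hB0, hper⟩ := hD
  have hAs : A ⊆ Isq := subset_union_left.trans hE.1
  have hBs : B ⊆ Isq := subset_union_right.trans hE.1
  obtain ⟨A', hAm, hAA, hA', hAr, hAv⟩ := exists_hull hAs
  obtain ⟨B', hBm, hBB, hB', hBr, hBv⟩ := exists_hull hBs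
  have hr : volume.restrict (A' ∪ B') = volume.restrict (A ∪ B) := by
    obtain ⟨F, hFm, hEF, hF, hFr, hFv⟩ := exists_hull hE.1
    refine le_antisymm ?_ (Measure.restrict_mono (union_subset_union hAA hBB) le_rfl)
    rw [← hFr]
    have key : ∀ {G G' : Set (ℝ × ℝ)}, G ⊆ F → volume.restrict G' = volume.restrict G →
        volume (G' \ F) = 0 := by
      intro G G' hG hr
      have h1 : volume.restrict G' Fᶜ = volume.restrict G Fᶜ := by rw [hr]
      rw [Measure.restrict_apply hFm.compl, Measure.restrict_apply hFm.compl] at h1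
      have h2 : Fᶜ ∩ G = ∅ := by
        ext x; simp only [mem_inter_iff, mem_compl_iff, mem_empty_iff_false, iff_false]
        exact fun h => h.1 (hG h.2)
      rw [h2, measure_empty] at h1
      rw [diff_eq, inter_comm]; exact h1
    refine Measure.restrict_mono' ?_ le_rfl
    refine ae_le_set.2 ?_
    rw [union_diff_distrib]
    exact measure_union_null (key (subset_union_left.trans hEF) hAr)
      (key (subset_union_right.trans hEF) hBr)
  have hpAB : per A + per B ≠ ⊤ := hper ▸ hE.2
  obtain ⟨hpA, hpB⟩ := ENNReal.add_ne_top.1 hpAB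
  have hpA' : per A' ≠ ⊤ := by rw [per_congr hAr]; exact hpA
  have hpB' : per B' ≠ ⊤ := by rw [per_congr hBr]; exact hpB
  have hper' : per (A' ∪ B') = per A' + per B' := by
    rw [per_congr hr, per_congr hAr, per_congr hBr, hper]
  have hnull := inter_null hAm hA' hBm hB' hpA' hpB' hper'
  have hv : volume (A ∪ B) = volume A + volume B := by
    have h1 := measure_union₀ (μ := volume) (s := A') hBm.nullMeasurableSet hnull
    have h2 : volume.restrict (A' ∪ B') univ = volume.restrict (A ∪ B) univ := by rw [hr]
    simp only [Measure.restrict_apply_univ] at h2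
    rw [← h2, h1, hAv, hBv]
  have hs := surfE_add_le hτ hA' hB' hBm hnull hpA' hpB' hper'
  rw [surfE_congr hr, surfE_congr hAr, surfE_congr hBr] at hs
  have hAt : volume A ≠ ⊤ := (volume_lt_top_of_subset hAs).ne
  have hBt : volume B ≠ ⊤ := (volume_lt_top_of_subset hBs).ne
  have hcE : conduct τ (A ∪ B) = surfE τ (A ∪ B) / (volume A + volume B) := by
    rw [conduct, if_neg (by rw [hv]; simp [hA0.ne']), hv]
  have hcA : conduct τ A = surfE τ A / volume A := by rw [conduct, if_neg hA0.ne']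
  have hcB : conduct τ B = surfE τ B / volume B := by rw [conduct, if_neg hB0.ne']
  rw [hv] at hvol
  rcases mediant hs hA0.ne' hB0.ne' hAt hBt with h | h
  · obtain ⟨E', h1, h2, h3⟩ := case1_wrap hτ ha hAs
      (lt_of_lt_of_le (ENNReal.lt_add_right hAt hB0.ne') hvol)
    exact ⟨E', h1, h2, lt_of_lt_of_le h3 (by rw [hcE, hcA]; exact h)⟩
  · obtain ⟨E', h1, h2, h3⟩ := case1_wrap hτ ha hBs
      (lt_of_lt_of_le (ENNReal.lt_add_right hBt hA0.ne') ((add_comm _ _).trans_le hvol))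
    exact ⟨E', h1, h2, lt_of_lt_of_le h3 (by rw [hcE, hcB]; exact h)⟩

/-- A set of finite perimeter in the square which either has volume `< a`, or has volume
`≤ a` and is decomposable, can be replaced by a set of finite perimeter of volume exactly
`a` with strictly smaller conductance. -/
theorem finite_perimeter_full_volume (τ : ℝ × ℝ → ℝ) (hτ : IsNorm2 τ)
    (a : ℝ) (ha : a ∈ Set.Icc (1 : ℝ) 3)
    (E : Set (ℝ × ℝ)) (hE : MemC E)
    (hvol : volume E < ENNReal.ofReal a ∨
      (volume E ≤ ENNReal.ofReal a ∧ Decomposable E)) :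
    ∃ E' : Set (ℝ × ℝ), MemC E' ∧ volume E' = ENNReal.ofReal a ∧
      conduct τ E' < conduct τ E := by
  rcases hvol with h | ⟨h, hD⟩
  · exact case1_wrap hτ ha hE.1 h
  · exact decomp_case hτ ha hE h hD
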